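/- arXiv:2210.17478 — 12 statements merged into one kernel-verified Lean document; each statement's English description precedes it below -/
import Mathlib

section
/- Convergence of deterministic TiAda (Theorem 3.1): Under the stated assumptions (f is l-smooth, μ-strongly concave in y on Y, each maximizer y*(x) lies in the interior of Y, and the primal function Φ is bounded below), the TiAda iterates with exact gradients satisfy: there exists a constant C (depending only on l, μ, Y, f, the initialization x_0, y_0, v^x_0, v^y_0 and the parameters η^x, η^y, α, β, but not on T) such that for every T ≥ 1, Σ_{t=0}^{T-1} (‖∇_x f(x_t,y_t)‖² + ‖∇_y f(x_t,y_t)‖²) ≤ C; equivalently, (1/T) Σ_{t=0}^{T-1} (‖∇_x f(x_t,y_t)‖² + ‖∇_y f(x_t,y_t)‖²) ≤ C/T. -/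
open Real Finset
open scoped RealInnerProductSpace

/-- Partial gradient of `f` with respect to the primal variable `x`. -/
noncomputable def gradx {d1 d2 : ℕ}
    (f : EuclideanSpace ℝ (Fin d1) → EuclideanSpace ℝ (Fin d2) → ℝ)
    (x : EuclideanSpace ℝ (Fin d1)) (y : EuclideanSpace ℝ (Fin d2)) :
    EuclideanSpace ℝ (Fin d1) :=
  gradient (fun x' => f x' y) x

/-- Partial gradient of `f` with respect to the dual variable `y`. -/
noncomputable def grady {d1 d2 : ℕ}
    (f : EuclideanSpace ℝ (Fin d1) → EuclideanSpace ℝ (Fin d2) → ℝ)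
    (x : EuclideanSpace ℝ (Fin d1)) (y : EuclideanSpace ℝ (Fin d2)) :
    EuclideanSpace ℝ (Fin d2) :=
  gradient (f x) y


/-- A positive monotone sequence controlled by a Lyapunov function is bounded. -/
lemma tiada_growth (v W : ℕ → ℝ) (p c m : ℝ) (t0 : ℕ) (hc : 0 < c) (hp1 : p < 1) (hp0 : 0 < p)
    (hv0 : ∀ t, 0 < v t) (hmono : Monotone v) (hW : ∀ t, m ≤ W t)
    (hstep : ∀ t, t0 ≤ t → W (t + 1) ≤ W t - c * ((v (t + 1) - v t) / v (t + 1) ^ p))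
    (hunb : Filter.Tendsto v Filter.atTop Filter.atTop) : False := by
  have key : ∀ T, t0 ≤ T → c * (v T - v t0) ≤ (W t0 - m) * v T ^ p := by
    intro T hT
    have hTp : 0 < v T ^ p := Real.rpow_pos_of_pos (hv0 T) p
    have ind : ∀ t, t0 ≤ t → t ≤ T → W t ≤ W t0 - c * ((v t - v t0) / v T ^ p) := by
      intro t ht
      induction t, ht using Nat.le_induction with
      | base => intro _; simp
      | succ t ht ih =>
        intro htT
        have h1 := ih (by omega)
        have h2 := hstep t ht
        have h3 : (v (t + 1) - v t) / v T ^ p ≤ (v (t + 1) - v t) / v (t + 1) ^ p := by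
          apply div_le_div_of_nonneg_left
          · have := hmono (Nat.le_succ t)
            simp only [Nat.succ_eq_add_one] at this
            linarith
          · exact Real.rpow_pos_of_pos (hv0 _) p
          · exact Real.rpow_le_rpow (hv0 _).le (hmono htT) hp0.le
        have h4 := mul_le_mul_of_nonneg_left h3 hc.le
        have h5 : c * ((v (t + 1) - v t0) / v T ^ p)
            = c * ((v (t + 1) - v t) / v T ^ p) + c * ((v t - v t0) / v T ^ p) := by ring
        linarith
    have h1 := ind T hT le_rfl
    have h2 := hW T
    have h3 : c * ((v T - v t0) / v T ^ p) ≤ W t0 - m := by linarith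
    rw [← mul_div_assoc, div_le_iff₀ hTp] at h3
    exact h3
  have ht : Filter.Tendsto (fun t => v t ^ (1 - p)) Filter.atTop Filter.atTop :=
    (tendsto_rpow_atTop (by linarith : 0 < 1 - p)).comp hunb
  obtain ⟨T, ⟨h1, h2⟩, h3⟩ := (((hunb.eventually_ge_atTop (2 * v t0)).and
    (ht.eventually_gt_atTop (2 * (W t0 - m) / c))).and (Filter.eventually_ge_atTop t0)).exists
  have hk := key T h3
  have hTp : 0 < v T ^ p := Real.rpow_pos_of_pos (hv0 T) p
  have hs : v T ^ (1 - p) * v T ^ p = v T := by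
    rw [← Real.rpow_add (hv0 T)]; simp
  rw [div_lt_iff₀ hc] at h2
  have h4 := mul_lt_mul_of_pos_right h2 hTp
  have h5 : v T ^ (1 - p) * c * v T ^ p = c * v T := by
    rw [mul_right_comm, hs, mul_comm]
  nlinarith [mul_le_mul_of_nonneg_left h1 hc.le]

/-- Projection is nonexpansive towards points of the set. -/
lemma tiada_proj {d : ℕ} (Y : Set (EuclideanSpace ℝ (Fin d))) (hYconv : Convex ℝ Y)
    (P : EuclideanSpace ℝ (Fin d) → EuclideanSpace ℝ (Fin d))
    (hP : ∀ z, P z ∈ Y ∧ ∀ w ∈ Y, ‖P z - z‖ ≤ ‖w - z‖)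
    (z w : EuclideanSpace ℝ (Fin d)) (hw : w ∈ Y) : ‖P z - w‖ ≤ ‖z - w‖ := by
  obtain ⟨h1, h2⟩ := hP z
  have : Nonempty Y := ⟨⟨w, hw⟩⟩
  have h3 : ‖z - P z‖ = ⨅ w : Y, ‖z - w‖ := by
    apply le_antisymm
    · apply le_ciInf
      intro u
      rw [norm_sub_rev z, norm_sub_rev z]
      exact h2 u u.2
    · exact ciInf_le (f := fun w : Y => ‖z - w‖)
        ⟨0, by rintro _ ⟨u, rfl⟩; exact norm_nonneg _⟩ ⟨P z, h1⟩
  have h4 := (norm_eq_iInf_iff_real_inner_le_zero hYconv h1).1 h3 w hw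
  have h5 : ‖z - w‖ ^ 2 = ‖z - P z‖ ^ 2 - 2 * ⟪z - P z, w - P z⟫ + ‖w - P z‖ ^ 2 := by
    rw [← norm_sub_sq_real]; congr 2; abel
  rw [norm_sub_rev (P z)]
  apply le_of_sq_le_sq _ (norm_nonneg _)
  nlinarith [sq_nonneg ‖z - P z‖]

/-- Crude descent lemma in `x`. -/
lemma tiada_descent {d : ℕ} (g : EuclideanSpace ℝ (Fin d) → ℝ) (hg : Differentiable ℝ g)
    (l : ℝ) (hl : 0 ≤ l) (hs : ∀ a b, ‖gradient g a - gradient g b‖ ≤ l * ‖a - b‖)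
    (a b : EuclideanSpace ℝ (Fin d)) :
    g b ≤ g a + ⟪gradient g a, b - a⟫ + l * ‖b - a‖ ^ 2 := by
  obtain ⟨z, hz, he⟩ := domain_mvt (f := g) (s := Set.univ) (x := a) (y := b)
    (f' := fun z => fderiv ℝ g z)
    (fun z _ => (hg z).hasFDerivAt.hasFDerivWithinAt) convex_univ trivial trivial
  have hin : fderiv ℝ g z (b - a) = ⟪gradient g z, b - a⟫ := by
    simp [gradient]
  have h1 : ⟪gradient g z, b - a⟫ = ⟪gradient g a, b - a⟫ + ⟪gradient g z - gradient g a, b - a⟫ := by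
    rw [← inner_add_left]; congr 1; abel
  have h2 := real_inner_le_norm (gradient g z - gradient g a) (b - a)
  have h3 : ‖z - a‖ ≤ ‖b - a‖ := by
    have := norm_sub_le_of_mem_segment hz
    exact this
  have h4 : ‖gradient g z - gradient g a‖ ≤ l * ‖b - a‖ :=
    (hs z a).trans (mul_le_mul_of_nonneg_left h3 hl)
  have h5 := mul_le_mul_of_nonneg_right h4 (norm_nonneg (b - a))
  rw [hin, h1] at he
  nlinarith

/-- Scalar contraction estimate. -/
lemma tiada_contract (q δ δ' k lam : ℝ) (hlam : 0 < lam) (hlam1 : lam ≤ 1)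
    (hδ' : 0 ≤ δ') (hq : q ^ 2 ≤ (1 - 2 * lam) * δ ^ 2)
    (h : δ' ≤ q + k) : δ' ^ 2 ≤ (1 - lam) * δ ^ 2 + 2 / lam * k ^ 2 := by
  have h1 : δ' ^ 2 ≤ (q + k) ^ 2 := pow_le_pow_left₀ hδ' h 2
  have h2 : (q + k) ^ 2 ≤ (1 + lam) * q ^ 2 + (1 + 1 / lam) * k ^ 2 := by
    have : (1 + lam) * q ^ 2 + (1 + 1 / lam) * k ^ 2 - (q + k) ^ 2 = (lam * q - k) ^ 2 / lam := by
      field_simp; ring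
    have h' : 0 ≤ (lam * q - k) ^ 2 / lam := by positivity
    linarith
  have h3 : (1 + 1 / lam) ≤ 2 / lam := by
    rw [le_div_iff₀ hlam]; field_simp; linarith
  have h4 := mul_le_mul_of_nonneg_right h3 (sq_nonneg k)
  have h5 := mul_le_mul_of_nonneg_left hq (by linarith : 0 ≤ 1 + lam)
  nlinarith [mul_nonneg (sq_nonneg lam) (sq_nonneg δ)]

/-- Theorem 3.1 (deterministic TiAda): under `l`-smoothness, `μ`-strong concavity in `y`,
interior maximizers and a lower-bounded primal function, the sum over the first `T`
iterations of the squared gradient norms of the TiAda iterates (with exact gradients) is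
bounded by a constant `C` independent of `T`. -/
theorem tiada_deterministic_convergence
    {d1 d2 : ℕ}
    (Y : Set (EuclideanSpace ℝ (Fin d2)))
    (hYne : Y.Nonempty) (hYclosed : IsClosed Y) (hYconv : Convex ℝ Y)
    (P : EuclideanSpace ℝ (Fin d2) → EuclideanSpace ℝ (Fin d2))
    (hP : ∀ z, P z ∈ Y ∧ ∀ w ∈ Y, ‖P z - z‖ ≤ ‖w - z‖)
    (f : EuclideanSpace ℝ (Fin d1) → EuclideanSpace ℝ (Fin d2) → ℝ)
    (hdiff : Differentiable ℝ
      (fun p : EuclideanSpace ℝ (Fin d1) × EuclideanSpace ℝ (Fin d2) => f p.1 p.2))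
    (l μ : ℝ) (hμ : 0 < μ) (hμl : μ ≤ l)
    (hsmooth : ∀ x1 x2 : EuclideanSpace ℝ (Fin d1), ∀ y1 ∈ Y, ∀ y2 ∈ Y,
      max ‖gradx f x1 y1 - gradx f x2 y2‖ ‖grady f x1 y1 - grady f x2 y2‖
        ≤ l * (‖x1 - x2‖ + ‖y1 - y2‖))
    (hconc : ∀ x' : EuclideanSpace ℝ (Fin d1), ∀ y1 ∈ Y, ∀ y2 ∈ Y,
      f x' y2 + ⟪grady f x' y1, y1 - y2⟫ + μ / 2 * ‖y1 - y2‖ ^ 2 ≤ f x' y1)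
    (ystar : EuclideanSpace ℝ (Fin d1) → EuclideanSpace ℝ (Fin d2))
    (hystar : ∀ x', ystar x' ∈ Y ∧ ∀ y' ∈ Y, f x' y' ≤ f x' (ystar x'))
    (hint : ∀ x', ystar x' ∈ interior Y)
    (hΦbdd : BddBelow (Set.range fun x' => f x' (ystar x')))
    (ηx ηy α β : ℝ) (hηx : 0 < ηx) (hηy : 0 < ηy)
    (hβ : 0 < β) (hβα : β < α) (hα : α < 1)
    (x : ℕ → EuclideanSpace ℝ (Fin d1)) (y : ℕ → EuclideanSpace ℝ (Fin d2))
    (vx vy : ℕ → ℝ)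
    (hy0 : y 0 ∈ Y) (hvx0 : 0 < vx 0) (hvy0 : 0 < vy 0)
    (hvx : ∀ t, vx (t + 1) = vx t + ‖gradx f (x t) (y t)‖ ^ 2)
    (hvy : ∀ t, vy (t + 1) = vy t + ‖grady f (x t) (y t)‖ ^ 2)
    (hxup : ∀ t, x (t + 1) =
      x t - (ηx / (max (vx (t + 1)) (vy (t + 1))) ^ α) • gradx f (x t) (y t))
    (hyup : ∀ t, y (t + 1) = P (y t + (ηy / (vy (t + 1)) ^ β) • grady f (x t) (y t))) :
    ∃ C : ℝ, ∀ T : ℕ, 1 ≤ T →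
      ∑ t ∈ Finset.range T,
          (‖gradx f (x t) (y t)‖ ^ 2 + ‖grady f (x t) (y t)‖ ^ 2) ≤ C := by
  have hl : 0 < l := lt_of_lt_of_le hμ hμl
  -- basic facts
  have hdx : ∀ b, Differentiable ℝ (fun a => f a b) := fun b =>
    hdiff.comp (differentiable_id.prodMk (differentiable_const b))
  have hsx : ∀ x1 x2 : EuclideanSpace ℝ (Fin d1), ∀ y1 ∈ Y, ∀ y2 ∈ Y,
      ‖gradx f x1 y1 - gradx f x2 y2‖ ≤ l * (‖x1 - x2‖ + ‖y1 - y2‖) :=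
    fun x1 x2 y1 h1 y2 h2 => (le_max_left _ _).trans (hsmooth x1 x2 y1 h1 y2 h2)
  have hsy : ∀ x1 x2 : EuclideanSpace ℝ (Fin d1), ∀ y1 ∈ Y, ∀ y2 ∈ Y,
      ‖grady f x1 y1 - grady f x2 y2‖ ≤ l * (‖x1 - x2‖ + ‖y1 - y2‖) :=
    fun x1 x2 y1 h1 y2 h2 => (le_max_right _ _).trans (hsmooth x1 x2 y1 h1 y2 h2)
  have hsY : ∀ a, ystar a ∈ Y := fun a => (hystar a).1
  have hg0 : ∀ a, grady f a (ystar a) = 0 := by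
    intro a
    have hm : IsLocalMax (f a) (ystar a) := by
      filter_upwards [mem_interior_iff_mem_nhds.1 (hint a)] with z hz
      exact (hystar a).2 z hz
    simp [grady, gradient, hm.fderiv_eq_zero]
  have hmon : ∀ a, ∀ b ∈ Y, ⟪grady f a b, b - ystar a⟫ ≤ -(μ * ‖b - ystar a‖ ^ 2) := by
    intro a b hb
    have h1 := hconc a b hb (ystar a) (hsY a)
    have h2 := hconc a (ystar a) (hsY a) b hb
    rw [hg0, inner_zero_left, norm_sub_rev] at h2
    linarith
  have hlow : ∀ a, ∀ b ∈ Y, μ * ‖b - ystar a‖ ≤ ‖grady f a b‖ := by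
    intro a b hb
    have h1 := hmon a b hb
    have h2 := neg_le_of_abs_le (abs_real_inner_le_norm (grady f a b) (b - ystar a))
    rcases (norm_nonneg (b - ystar a)).eq_or_lt with h | h
    · rw [← h]; simp
    · by_contra! hc
      nlinarith [mul_lt_mul_of_pos_right hc h]
  have hup : ∀ a, ∀ b ∈ Y, ‖grady f a b‖ ≤ l * ‖b - ystar a‖ := by
    intro a b hb
    have := hsy a a b hb (ystar a) (hsY a)
    simpa [hg0] using this
  have hLip : ∀ a b, ‖ystar a - ystar b‖ ≤ l / μ * ‖a - b‖ := by
    intro a b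
    have h1 := hlow b (ystar a) (hsY a)
    have h2 := hsy b a (ystar a) (hsY a) (ystar a) (hsY a)
    rw [hg0, sub_zero, sub_self, norm_zero, add_zero, norm_sub_rev b a] at h2
    rw [div_mul_eq_mul_div, le_div_iff₀ hμ]
    linarith
  have hyY : ∀ t, y t ∈ Y := by
    intro t
    cases t with
    | zero => exact hy0
    | succ t => rw [hyup]; exact (hP _).1
  have hvxm : Monotone vx := monotone_nat_of_le_succ fun t => by
    rw [hvx]; linarith [sq_nonneg ‖gradx f (x t) (y t)‖]
  have hvym : Monotone vy := monotone_nat_of_le_succ fun t => by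
    rw [hvy]; linarith [sq_nonneg ‖grady f (x t) (y t)‖]
  have hvxp : ∀ t, 0 < vx t := fun t => lt_of_lt_of_le hvx0 (hvxm (Nat.zero_le t))
  have hvyp : ∀ t, 0 < vy t := fun t => lt_of_lt_of_le hvy0 (hvym (Nat.zero_le t))
  obtain ⟨m, hm⟩ := hΦbdd
  have hΦm : ∀ a, m ≤ f a (ystar a) := fun a => hm ⟨a, rfl⟩
  -- abbreviations
  obtain ⟨η, hη⟩ : ∃ η : ℕ → ℝ, ∀ t, η t = ηx / (max (vx (t + 1)) (vy (t + 1))) ^ α :=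
    ⟨_, fun _ => rfl⟩
  obtain ⟨γ, hγ⟩ : ∃ γ : ℕ → ℝ, ∀ t, γ t = ηy / (vy (t + 1)) ^ β := ⟨_, fun _ => rfl⟩
  obtain ⟨δ, hδ⟩ : ∃ δ : ℕ → ℝ, ∀ t, δ t = ‖y t - ystar (x t)‖ := ⟨_, fun _ => rfl⟩
  obtain ⟨G, hG⟩ : ∃ G : ℕ → ℝ, ∀ t, G t = ‖gradx f (x t) (y t)‖ := ⟨_, fun _ => rfl⟩
  obtain ⟨H, hH⟩ : ∃ H : ℕ → ℝ, ∀ t, H t = ‖grady f (x t) (y t)‖ := ⟨_, fun _ => rfl⟩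
  obtain ⟨F, hF⟩ : ∃ F : ℕ → ℝ, ∀ t, F t = f (x t) (ystar (x t)) := ⟨_, fun _ => rfl⟩
  simp only [← hη] at hxup
  simp only [← hγ] at hyup
  simp only [← hG] at hvx ⊢
  simp only [← hH] at hvy ⊢
  have hηp : ∀ t, 0 < η t := fun t => by
    rw [hη]; exact div_pos hηx (Real.rpow_pos_of_pos (lt_max_of_lt_left (hvxp _)) _)
  have hγp : ∀ t, 0 < γ t := fun t => by
    rw [hγ]; exact div_pos hηy (Real.rpow_pos_of_pos (hvyp _) _)
  have hGp : ∀ t, 0 ≤ G t := fun t => by rw [hG]; exact norm_nonneg _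
  have hHp : ∀ t, 0 ≤ H t := fun t => by rw [hH]; exact norm_nonneg _
  have hδp : ∀ t, 0 ≤ δ t := fun t => by rw [hδ]; exact norm_nonneg _
  have hδH : ∀ t, μ * δ t ≤ H t := fun t => by rw [hδ, hH]; exact hlow _ _ (hyY t)
  have hHδ : ∀ t, H t ≤ l * δ t := fun t => by rw [hδ, hH]; exact hup _ _ (hyY t)
  have hdxn : ∀ t, ‖x (t + 1) - x t‖ = η t * G t := by
    intro t
    rw [hxup, sub_sub_cancel_left, norm_neg, norm_smul, Real.norm_eq_abs, abs_of_pos (hηp t), hG]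
  have hysn : ∀ t, ‖ystar (x (t + 1)) - ystar (x t)‖ ≤ l / μ * (η t * G t) := by
    intro t; rw [← hdxn]; exact hLip _ _
  obtain ⟨L, hL⟩ : ∃ L, L = l + l * (l / μ) := ⟨_, rfl⟩
  have hLp : 0 < L := by rw [hL]; positivity
  -- descent of the primal function
  have hX : ∀ t, F (t + 1) ≤ F t - η t * G t ^ 2 / 2 + η t * (l ^ 2 * δ t ^ 2) / 2
      + L * (η t) ^ 2 * G t ^ 2 := by
    intro t
    have h1 := tiada_descent (fun a => f a (ystar (x (t + 1)))) (hdx _) l hl.le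
      (fun a b => by
        have := hsx a b _ (hsY (x (t + 1))) _ (hsY (x (t + 1)))
        simpa [gradx] using this) (x t) (x (t + 1))
    change _ ≤ _ + ⟪gradx f (x t) (ystar (x (t + 1))), _⟫ + _ at h1
    have h2 := (hystar (x t)).2 _ (hsY (x (t + 1)))
    have h3 : ⟪gradx f (x t) (ystar (x (t + 1))), x (t + 1) - x t⟫
        = ⟪gradx f (x t) (y t), x (t + 1) - x t⟫
        + ⟪gradx f (x t) (ystar (x (t + 1))) - gradx f (x t) (y t), x (t + 1) - x t⟫ := by
      rw [← inner_add_left]; congr 1; abel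
    have h4 : ⟪gradx f (x t) (y t), x (t + 1) - x t⟫ = - (η t * G t ^ 2) := by
      rw [hxup, sub_sub_cancel_left, inner_neg_right, inner_smul_right,
        real_inner_self_eq_norm_sq, hG]
    have h5 := real_inner_le_norm (gradx f (x t) (ystar (x (t + 1))) - gradx f (x t) (y t))
      (x (t + 1) - x t)
    have h6 := hsx (x t) (x t) _ (hsY (x (t + 1))) _ (hyY t)
    rw [sub_self, norm_zero, zero_add] at h6
    have h7 : ‖ystar (x (t + 1)) - y t‖ ≤ l / μ * (η t * G t) + δ t := by
      have : ystar (x (t + 1)) - y t = (ystar (x (t + 1)) - ystar (x t))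
        - (y t - ystar (x t)) := by abel
      rw [this, hδ]
      exact (norm_sub_le _ _).trans (add_le_add (hysn t) le_rfl)
    have h8 := h6.trans (mul_le_mul_of_nonneg_left h7 hl.le)
    rw [hdxn] at h1 h5
    have hp : 0 ≤ η t * G t := mul_nonneg (hηp t).le (hGp t)
    have h9 := mul_le_mul_of_nonneg_right h8 hp
    have h10 : 0 ≤ η t * (G t - l * δ t) ^ 2 := mul_nonneg (hηp t).le (sq_nonneg _)
    rw [hF, hF, hL]
    rw [h3, h4] at h1
    nlinarith
  -- contraction in y
  have hYc : ∀ t, γ t * l ^ 2 ≤ μ → γ t * μ ≤ 1 →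
      δ (t + 1) ^ 2 ≤ δ t ^ 2 - γ t * μ / 2 * δ t ^ 2
        + 4 / (γ t * μ) * (l / μ * (η t * G t)) ^ 2 := by
    intro t hc1 hc2
    have hγt := hγp t
    have h1 : ‖y (t + 1) - ystar (x t)‖ ≤ ‖y t + γ t • grady f (x t) (y t) - ystar (x t)‖ := by
      rw [hyup]; exact tiada_proj Y hYconv P hP _ _ (hsY _)
    have h2 : ‖y t + γ t • grady f (x t) (y t) - ystar (x t)‖ ^ 2
        = δ t ^ 2 + 2 * (γ t * ⟪grady f (x t) (y t), y t - ystar (x t)⟫) + (γ t * H t) ^ 2 := by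
      have : y t + γ t • grady f (x t) (y t) - ystar (x t)
        = (y t - ystar (x t)) + γ t • grady f (x t) (y t) := by abel
      rw [this, norm_add_sq_real, inner_smul_right, real_inner_comm, norm_smul, Real.norm_eq_abs,
        abs_of_pos hγt, hδ, hH]
    have h3 := hmon (x t) (y t) (hyY t)
    rw [← hδ] at h3
    have h3' := mul_le_mul_of_nonneg_left h3 hγt.le
    have h4 : H t ^ 2 ≤ (l * δ t) ^ 2 := pow_le_pow_left₀ (hHp t) (hHδ t) 2
    have h5 : (γ t * H t) ^ 2 ≤ γ t * μ * δ t ^ 2 := by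
      calc (γ t * H t) ^ 2 = γ t ^ 2 * H t ^ 2 := by ring
        _ ≤ γ t ^ 2 * (l * δ t) ^ 2 := mul_le_mul_of_nonneg_left h4 (sq_nonneg _)
        _ = (γ t * l ^ 2) * (γ t * δ t ^ 2) := by ring
        _ ≤ μ * (γ t * δ t ^ 2) := mul_le_mul_of_nonneg_right hc1 (by positivity)
        _ = _ := by ring
    have h6 : ‖y (t + 1) - ystar (x t)‖ ^ 2 ≤ (1 - 2 * (γ t * μ / 2)) * δ t ^ 2 := by
      have := pow_le_pow_left₀ (norm_nonneg _) h1 2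
      nlinarith
    have h7 : δ (t + 1) ≤ ‖y (t + 1) - ystar (x t)‖ + l / μ * (η t * G t) := by
      have : y (t + 1) - ystar (x (t + 1)) = (y (t + 1) - ystar (x t))
        - (ystar (x (t + 1)) - ystar (x t)) := by abel
      rw [hδ, this]
      exact (norm_sub_le _ _).trans (add_le_add le_rfl (hysn t))
    have h8 := tiada_contract _ (δ t) _ _ (γ t * μ / 2) (by positivity) (by linarith)
      (hδp (t + 1)) h6 h7
    have h9 : 2 / (γ t * μ / 2) = 4 / (γ t * μ) := by field_simp; norm_num
    rw [h9] at h8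
    linarith
  -- unbounded monotone sequences diverge
  have hdiv : ∀ v : ℕ → ℝ, Monotone v → (¬ ∃ B, ∀ t, v t ≤ B) →
      Filter.Tendsto v Filter.atTop Filter.atTop := by
    intro v hv hB
    refine Filter.tendsto_atTop_atTop_of_monotone hv fun b => ?_
    by_contra! hc
    exact hB ⟨b, fun t => (hc t).le⟩
  -- vy is bounded
  have hvyB : ∃ B, ∀ t, vy t ≤ B := by
    by_contra hB
    have hT := hdiv vy hvym hB
    have hT1 : Filter.Tendsto (fun t => vy (t + 1)) Filter.atTop Filter.atTop :=
      hT.comp (Filter.tendsto_add_atTop_nat 1)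
    have hpw : ∀ p : ℝ, 0 < p → ∀ K : ℝ,
        Filter.Tendsto (fun t => K / vy (t + 1) ^ p) Filter.atTop (nhds 0) := fun p hp K =>
      Filter.Tendsto.div_atTop tendsto_const_nhds ((tendsto_rpow_atTop hp).comp hT1)
    have hη' : ∀ t, η t ≤ ηx / vy (t + 1) ^ α := fun t => by
      rw [hη]
      exact div_le_div_of_nonneg_left hηx.le (Real.rpow_pos_of_pos (hvyp _) _)
        (Real.rpow_le_rpow (hvyp _).le (le_max_right _ _) (hβ.trans hβα).le)
    have hηγ : ∀ t, η t ≤ (ηx / ηy) / vy (t + 1) ^ (α - β) * γ t := fun t => by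
      refine (hη' t).trans (le_of_eq ?_)
      have := Real.rpow_pos_of_pos (hvyp (t + 1)) β
      have := Real.rpow_pos_of_pos (hvyp (t + 1)) α
      rw [hγ, Real.rpow_sub (hvyp _)]
      field_simp
    obtain ⟨κ', hκ'⟩ : ∃ κ', κ' = 4 / μ * (l / μ) ^ 2 := ⟨_, rfl⟩
    have hκp : 0 < κ' := by rw [hκ']; positivity
    have e1 := (hpw β hβ ηy).eventually_le_const (by positivity : 0 < min (μ / l ^ 2) (1 / μ))
    have e2 := (hpw α (hβ.trans hβα) ηx).eventually_le_const (by positivity : 0 < 1 / (4 * L))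
    have e3 := (hpw (α - β) (by linarith) (ηx / ηy)).eventually_le_const
      (by positivity : 0 < min (μ / (2 * l ^ 2)) (1 / (4 * κ')))
    obtain ⟨t0, ht0⟩ := Filter.eventually_atTop.1 ((e1.and e2).and e3)
    refine tiada_growth vy (fun t => F t + δ t ^ 2) β (μ * ηy / (4 * l ^ 2)) m t0 (by positivity)
      (by linarith) hβ hvyp hvym (fun t => ?_) (fun t ht => ?_) hT
    · have := hΦm (x t)
      rw [← hF] at this
      nlinarith [sq_nonneg (δ t)]
    · obtain ⟨⟨a1, a2⟩, a3⟩ := ht0 t ht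
      rw [← hγ] at a1
      have hγt := hγp t
      have hηt := hηp t
      have b1 : γ t * l ^ 2 ≤ μ := by
        have := a1.trans (min_le_left _ _)
        rwa [le_div_iff₀ (by positivity)] at this
      have b2 : γ t * μ ≤ 1 := by
        have := a1.trans (min_le_right _ _)
        rwa [le_div_iff₀ (by positivity)] at this
      have b3 : L * η t ≤ 1 / 4 := by
        have := (hη' t).trans a2
        rw [le_div_iff₀ (by positivity)] at this
        linarith
      have b4 : η t * l ^ 2 ≤ γ t * μ / 2 := by
        have := (hηγ t).trans (mul_le_mul_of_nonneg_right (a3.trans (min_le_left _ _)) hγt.le)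
        rw [div_mul_eq_mul_div, le_div_iff₀ (by positivity)] at this
        linarith
      have b5 : κ' * η t ≤ γ t / 4 := by
        have := (hηγ t).trans (mul_le_mul_of_nonneg_right (a3.trans (min_le_right _ _)) hγt.le)
        rw [div_mul_eq_mul_div, le_div_iff₀ (by positivity)] at this
        linarith
      have c1 := hX t
      have c2 := hYc t b1 b2
      have c3 : 4 / (γ t * μ) * (l / μ * (η t * G t)) ^ 2 ≤ η t * G t ^ 2 / 4 := by
        have : 4 / (γ t * μ) * (l / μ * (η t * G t)) ^ 2 = (κ' * η t) / γ t * (η t * G t ^ 2) := by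
          rw [hκ']; field_simp
        rw [this]
        have h' : (κ' * η t) / γ t ≤ 1 / 4 := by
          rw [div_le_iff₀ hγt]; linarith
        have := mul_le_mul_of_nonneg_right h' (by positivity : 0 ≤ η t * G t ^ 2)
        linarith
      have c4 : L * (η t) ^ 2 * G t ^ 2 ≤ η t * G t ^ 2 / 4 := by
        have := mul_le_mul_of_nonneg_right b3 (by positivity : 0 ≤ η t * G t ^ 2)
        nlinarith
      have c5 := mul_le_mul_of_nonneg_right b4 (sq_nonneg (δ t))
      have c6 : μ * ηy / (4 * l ^ 2) * ((vy (t + 1) - vy t) / vy (t + 1) ^ β)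
          ≤ γ t * μ / 4 * δ t ^ 2 := by
        have h4 : H t ^ 2 ≤ (l * δ t) ^ 2 := pow_le_pow_left₀ (hHp t) (hHδ t) 2
        have : μ * ηy / (4 * l ^ 2) * ((vy (t + 1) - vy t) / vy (t + 1) ^ β)
          = γ t * μ / (4 * l ^ 2) * H t ^ 2 := by
          rw [hγ, show vy (t + 1) - vy t = H t ^ 2 by rw [hvy]; ring]; ring
        rw [this]
        refine (mul_le_mul_of_nonneg_left h4 (by positivity)).trans (le_of_eq ?_)
        field_simp
      linarith
  obtain ⟨By, hBy⟩ := hvyB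
  -- vx is bounded
  have hvxB : ∃ B, ∀ t, vx t ≤ B := by
    by_contra hB
    have hT := hdiv vx hvxm hB
    have hT1 : Filter.Tendsto (fun t => vx (t + 1)) Filter.atTop Filter.atTop :=
      hT.comp (Filter.tendsto_add_atTop_nat 1)
    have hα0 : 0 < α := hβ.trans hβα
    have hpw : Filter.Tendsto (fun t => ηx / vx (t + 1) ^ α) Filter.atTop (nhds 0) :=
      Filter.Tendsto.div_atTop tendsto_const_nhds ((tendsto_rpow_atTop hα0).comp hT1)
    have e1 := hpw.eventually_le_const (by positivity : 0 < min (1 / (4 * L)) 1)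
    obtain ⟨t0, ht0⟩ := Filter.eventually_atTop.1 (e1.and (hT1.eventually_ge_atTop By))
    obtain ⟨K, hK⟩ : ∃ K, K = l ^ 2 / μ ^ 2 / 2 := ⟨_, rfl⟩
    have hKp : 0 < K := by rw [hK]; positivity
    refine tiada_growth vx (fun t => F t - K * vy t) α (ηx / 4) (m - K * By) t0 (by positivity)
      hα hα0 hvxp hvxm (fun t => ?_) (fun t ht => ?_) hT
    · have := hΦm (x t)
      rw [← hF] at this
      have := mul_le_mul_of_nonneg_left (hBy t) hKp.le
      linarith
    · obtain ⟨a1, a2⟩ := ht0 t ht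
      have hηe : η t = ηx / vx (t + 1) ^ α := by
        rw [hη, max_eq_left ((hBy _).trans a2)]
      rw [← hηe] at a1
      have hηt := hηp t
      have b1 : L * η t ≤ 1 / 4 := by
        have := a1.trans (min_le_left _ _)
        rw [le_div_iff₀ (by positivity)] at this
        linarith
      have b2 : η t ≤ 1 := a1.trans (min_le_right _ _)
      have c1 := hX t
      have c4 : L * (η t) ^ 2 * G t ^ 2 ≤ η t * G t ^ 2 / 4 := by
        have := mul_le_mul_of_nonneg_right b1 (by positivity : 0 ≤ η t * G t ^ 2)
        nlinarith
      have c5 : η t * (l ^ 2 * δ t ^ 2) / 2 ≤ K * H t ^ 2 := by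
        have h4 : (μ * δ t) ^ 2 ≤ H t ^ 2 :=
          pow_le_pow_left₀ (mul_nonneg hμ.le (hδp t)) (hδH t) 2
        have h5 := mul_le_mul_of_nonneg_left h4 hKp.le
        have h6 : K * (μ * δ t) ^ 2 = l ^ 2 * δ t ^ 2 / 2 := by rw [hK]; field_simp
        have h7 := mul_le_mul_of_nonneg_right b2 (by positivity : 0 ≤ l ^ 2 * δ t ^ 2)
        linarith
      have c6 : ηx / 4 * ((vx (t + 1) - vx t) / vx (t + 1) ^ α) = η t * G t ^ 2 / 4 := by
        rw [hηe, show vx (t + 1) - vx t = G t ^ 2 by rw [hvx]; ring]; ring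
      rw [c6]
      rw [hvy]
      linarith
  obtain ⟨Bx, hBx⟩ := hvxB
  refine ⟨Bx + By, fun T _ => ?_⟩
  have hsum : ∀ T, ∑ t ∈ Finset.range T, (G t ^ 2 + H t ^ 2) = vx T - vx 0 + (vy T - vy 0) := by
    intro T
    induction T with
    | zero => simp
    | succ T ih => rw [Finset.sum_range_succ, ih, hvx, hvy]; ring
  rw [hsum]
  linarith [hBx T, hBy T]
end

section
/- Telescoped descent inequality for the primal variable of deterministic TiAda: Under the stated assumptions (f is l-smooth, μ-strongly concave in y on Y, each maximizer y*(x) lies in the interior of Y, and Φ is bounded below with infimum Φ*), the TiAda iterates satisfy, for every T ≥ 1, Σ_{t=0}^{T-1} η_t ‖∇_x f(x_t,y_t)‖² ≤ 2(Φ(x_0) − Φ*) + 2κl Σ_{t=0}^{T-1} η_t² ‖∇_x f(x_t,y_t)‖² + (η^x κ² / (η^y (v^y_0)^{α−β})) Σ_{t=0}^{T-1} γ_t ‖∇_y f(x_t,y_t)‖². -/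
open Real Finset
open scoped RealInnerProductSpace

lemma descent_aux {E : Type*} [NormedAddCommGroup E] [InnerProductSpace ℝ E] [CompleteSpace E]
    (h : E → ℝ) (hd : Differentiable ℝ h) (l : ℝ)
    (hl : ∀ a b, ‖gradient h a - gradient h b‖ ≤ l * ‖a - b‖) (a b : E) :
    h b ≤ h a + inner ℝ (gradient h a) (b - a) + l / 2 * ‖b - a‖ ^ 2 := by
  set d := b - a with hdd
  set φ : ℝ → ℝ := fun s => h (a + s • d) - s * inner ℝ (gradient h a) d - l / 2 * ‖d‖ ^ 2 * s ^ 2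
    with hφ
  have hder : ∀ s, HasDerivAt φ
      (inner ℝ (gradient h (a + s • d)) d - inner ℝ (gradient h a) d - l * ‖d‖ ^ 2 * s) s := by
    intro s
    have h1 : HasDerivAt (fun s : ℝ => a + s • d) d s := by
      simpa using ((hasDerivAt_id s).smul_const d).const_add a
    have h2 := (hd (a + s • d)).hasGradientAt.hasFDerivAt.comp_hasDerivAt s h1
    have h3 := (h2.sub ((hasDerivAt_id s).mul_const (inner ℝ (gradient h a) d))).sub
      (((hasDerivAt_id s).pow 2).const_mul (l / 2 * ‖d‖ ^ 2))
    refine h3.congr_deriv ?_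
    simp
    ring
  have hanti : AntitoneOn φ (Set.Icc 0 1) := by
    apply antitoneOn_of_deriv_nonpos (convex_Icc 0 1)
    · exact fun s _ => (hder s).continuousAt.continuousWithinAt
    · exact fun s _ => (hder s).differentiableAt.differentiableWithinAt
    · intro s hs
      rw [interior_Icc] at hs
      rw [(hder s).deriv, ← inner_sub_left]
      have e1 := real_inner_le_norm (gradient h (a + s • d) - gradient h a) d
      have e2 := hl (a + s • d) a
      rw [add_sub_cancel_left, norm_smul, Real.norm_of_nonneg hs.1.le] at e2
      nlinarith [mul_le_mul_of_nonneg_right e2 (norm_nonneg d)]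
  have := hanti (Set.left_mem_Icc.2 zero_le_one) (Set.right_mem_Icc.2 zero_le_one) zero_le_one
  simp only [hφ] at this
  rw [zero_smul, add_zero, one_smul] at this
  have hb : a + d = b := by rw [hdd]; abel
  rw [hb] at this
  linarith

/-- Telescoped descent inequality for the primal variable of deterministic TiAda, with
`κ := l/μ`, `Φ(x) := f(x, y*(x))` and `Φ* := inf_x Φ(x)`. -/
theorem tiada_telescoped_descent
    {d1 d2 : ℕ}
    (Y : Set (EuclideanSpace ℝ (Fin d2)))
    (hYne : Y.Nonempty) (hYclosed : IsClosed Y) (hYconv : Convex ℝ Y)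
    (P : EuclideanSpace ℝ (Fin d2) → EuclideanSpace ℝ (Fin d2))
    (hP : ∀ z, P z ∈ Y ∧ ∀ w ∈ Y, ‖P z - z‖ ≤ ‖w - z‖)
    (f : EuclideanSpace ℝ (Fin d1) → EuclideanSpace ℝ (Fin d2) → ℝ)
    (hdiff : Differentiable ℝ
      (fun p : EuclideanSpace ℝ (Fin d1) × EuclideanSpace ℝ (Fin d2) => f p.1 p.2))
    (l μ : ℝ) (hμ : 0 < μ) (hμl : μ ≤ l)
    (hsmooth : ∀ x1 x2 : EuclideanSpace ℝ (Fin d1), ∀ y1 ∈ Y, ∀ y2 ∈ Y,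
      max ‖gradx f x1 y1 - gradx f x2 y2‖ ‖grady f x1 y1 - grady f x2 y2‖
        ≤ l * (‖x1 - x2‖ + ‖y1 - y2‖))
    (hconc : ∀ x' : EuclideanSpace ℝ (Fin d1), ∀ y1 ∈ Y, ∀ y2 ∈ Y,
      f x' y2 + ⟪grady f x' y1, y1 - y2⟫ + μ / 2 * ‖y1 - y2‖ ^ 2 ≤ f x' y1)
    (ystar : EuclideanSpace ℝ (Fin d1) → EuclideanSpace ℝ (Fin d2))
    (hystar : ∀ x', ystar x' ∈ Y ∧ ∀ y' ∈ Y, f x' y' ≤ f x' (ystar x'))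
    (hint : ∀ x', ystar x' ∈ interior Y)
    (hΦbdd : BddBelow (Set.range fun x' => f x' (ystar x')))
    (ηx ηy α β : ℝ) (hηx : 0 < ηx) (hηy : 0 < ηy)
    (hβ : 0 < β) (hβα : β < α) (hα : α < 1)
    (x : ℕ → EuclideanSpace ℝ (Fin d1)) (y : ℕ → EuclideanSpace ℝ (Fin d2))
    (vx vy : ℕ → ℝ)
    (hy0 : y 0 ∈ Y) (hvx0 : 0 < vx 0) (hvy0 : 0 < vy 0)
    (hvx : ∀ t, vx (t + 1) = vx t + ‖gradx f (x t) (y t)‖ ^ 2)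
    (hvy : ∀ t, vy (t + 1) = vy t + ‖grady f (x t) (y t)‖ ^ 2)
    (hxup : ∀ t, x (t + 1) =
      x t - (ηx / (max (vx (t + 1)) (vy (t + 1))) ^ α) • gradx f (x t) (y t))
    (hyup : ∀ t, y (t + 1) = P (y t + (ηy / (vy (t + 1)) ^ β) • grady f (x t) (y t))) :
    ∀ T : ℕ, 1 ≤ T →
      ∑ t ∈ Finset.range T,
          (ηx / (max (vx (t + 1)) (vy (t + 1))) ^ α) * ‖gradx f (x t) (y t)‖ ^ 2
        ≤ 2 * (f (x 0) (ystar (x 0)) - ⨅ x' : EuclideanSpace ℝ (Fin d1), f x' (ystar x'))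
          + 2 * (l / μ) * l *
            ∑ t ∈ Finset.range T,
              (ηx / (max (vx (t + 1)) (vy (t + 1))) ^ α) ^ 2 * ‖gradx f (x t) (y t)‖ ^ 2
          + (ηx * (l / μ) ^ 2 / (ηy * (vy 0) ^ (α - β))) *
            ∑ t ∈ Finset.range T,
              (ηy / (vy (t + 1)) ^ β) * ‖grady f (x t) (y t)‖ ^ 2 := by
  have hl : 0 < l := hμ.trans_le hμl
  have hdx : ∀ y', Differentiable ℝ (fun x' => f x' y') := fun y' =>
    hdiff.comp (differentiable_id.prodMk (differentiable_const y'))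
  have hgrad0 : ∀ x', grady f x' (ystar x') = 0 := by
    intro x'
    have hm : IsLocalMax (f x') (ystar x') := by
      filter_upwards [mem_interior_iff_mem_nhds.1 (hint x')] with z hz
      exact (hystar x').2 z hz
    simp [grady, gradient, hm.fderiv_eq_zero]
  have hquad : ∀ x', ∀ y' ∈ Y, f x' y' + μ / 2 * ‖ystar x' - y'‖ ^ 2 ≤ f x' (ystar x') := by
    intro x' y' hy'
    have := hconc x' (ystar x') (hystar x').1 y' hy'
    rw [hgrad0] at this
    simpa using this
  have herr : ∀ x', ∀ y' ∈ Y, μ * ‖ystar x' - y'‖ ≤ ‖grady f x' y'‖ := by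
    intro x' y' hy'
    have h1 := hquad x' y' hy'
    have h2 := hconc x' y' hy' (ystar x') (hystar x').1
    have h3 := abs_le.1 (abs_real_inner_le_norm (grady f x' y') (y' - ystar x'))
    rw [norm_sub_rev y' (ystar x')] at h2 h3
    rcases (norm_nonneg (ystar x' - y')).eq_or_lt with h | h
    · rw [← h]; simp
    · by_contra hc
      push Not at hc
      nlinarith [mul_lt_mul_of_pos_right hc h]
  have hgx : ∀ x1 x2, ∀ y1 ∈ Y, ∀ y2 ∈ Y,
      ‖gradx f x1 y1 - gradx f x2 y2‖ ≤ l * (‖x1 - x2‖ + ‖y1 - y2‖) :=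
    fun x1 x2 y1 h1 y2 h2 => (le_max_left _ _).trans (hsmooth x1 x2 y1 h1 y2 h2)
  have hΦ : ∀ a b, f b (ystar b) ≤ f a (ystar a) + inner ℝ (gradx f a (ystar a)) (b - a)
      + l / μ * l * ‖b - a‖ ^ 2 := by
    intro a b
    have h1 := descent_aux (fun x' => f x' (ystar b)) (hdx _) l (by
      intro p q
      have := hgx p q _ (hystar b).1 _ (hystar b).1
      simpa [gradx] using this) a b
    change f b (ystar b) ≤ f a (ystar b) + inner ℝ (gradx f a (ystar b)) (b - a)
      + l / 2 * ‖b - a‖ ^ 2 at h1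
    have h2 := hquad a _ (hystar b).1
    have h3 := hgx a a _ (hystar b).1 _ (hystar a).1
    have h4 := real_inner_le_norm (gradx f a (ystar b) - gradx f a (ystar a)) (b - a)
    rw [inner_sub_left] at h4
    rw [sub_self, norm_zero, zero_add, norm_sub_rev (ystar b)] at h3
    have h5 := mul_le_mul_of_nonneg_right h3 (norm_nonneg (b - a))
    generalize ‖ystar a - ystar b‖ = δ at *
    generalize ‖b - a‖ = d at *
    set κ := l / μ with hκ
    have hκl : κ * μ = l := by rw [hκ]; field_simp
    have hκ1 : 1 ≤ κ := by rw [hκ, le_div_iff₀ hμ]; linarith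
    have h6 : l * δ * d ≤ μ / 2 * δ ^ 2 + κ * l / 2 * d ^ 2 := by
      rw [← hκl]
      nlinarith [mul_nonneg hμ.le (sq_nonneg (δ - κ * d))]
    have h7 : l * d ^ 2 ≤ κ * (l * d ^ 2) := le_mul_of_one_le_left (by positivity) hκ1
    nlinarith
  have hyY : ∀ t, y t ∈ Y := by
    intro t
    cases t with
    | zero => exact hy0
    | succ t => rw [hyup]; exact (hP _).1
  have hvylb : ∀ t, vy 0 ≤ vy t := by
    intro t
    induction t with
    | zero => exact le_rfl
    | succ t ih => rw [hvy]; nlinarith [sq_nonneg ‖grady f (x t) (y t)‖]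
  have hstep : ∀ t, (ηx / (max (vx (t + 1)) (vy (t + 1))) ^ α) * ‖gradx f (x t) (y t)‖ ^ 2
      ≤ 2 * (f (x t) (ystar (x t)) - f (x (t + 1)) (ystar (x (t + 1))))
        + 2 * (l / μ) * l *
          ((ηx / (max (vx (t + 1)) (vy (t + 1))) ^ α) ^ 2 * ‖gradx f (x t) (y t)‖ ^ 2)
        + (ηx * (l / μ) ^ 2 / (ηy * (vy 0) ^ (α - β))) *
          ((ηy / (vy (t + 1)) ^ β) * ‖grady f (x t) (y t)‖ ^ 2) := by
    intro t
    have hv : 0 < vy (t + 1) := hvy0.trans_le (hvylb _)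
    have hM : 0 < max (vx (t + 1)) (vy (t + 1)) := hv.trans_le (le_max_right _ _)
    have hη : ηx / (max (vx (t + 1)) (vy (t + 1))) ^ α
        ≤ ηx / (ηy * (vy 0) ^ (α - β)) * (ηy / (vy (t + 1)) ^ β) := by
      have e1 : (vy 0) ^ (α - β) * (vy (t + 1)) ^ β ≤ (max (vx (t + 1)) (vy (t + 1))) ^ α := by
        calc _ ≤ (vy (t + 1)) ^ (α - β) * (vy (t + 1)) ^ β := by
              gcongr
              exact hvylb _
          _ = (vy (t + 1)) ^ α := by rw [← Real.rpow_add hv]; congr 1; ring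
          _ ≤ _ := Real.rpow_le_rpow hv.le (le_max_right _ _) (by linarith)
      have e2 : ηx / (ηy * (vy 0) ^ (α - β)) * (ηy / (vy (t + 1)) ^ β)
          = ηx / ((vy 0) ^ (α - β) * (vy (t + 1)) ^ β) := by
        have := (Real.rpow_pos_of_pos hvy0 (α - β)).ne'
        have := (Real.rpow_pos_of_pos hv β).ne'
        field_simp
      rw [e2]
      have := Real.rpow_pos_of_pos hvy0 (α - β)
      have := Real.rpow_pos_of_pos hv β
      gcongr
    have hη0 : 0 < ηx / (max (vx (t + 1)) (vy (t + 1))) ^ α :=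
      div_pos hηx (Real.rpow_pos_of_pos hM _)
    have h1 := hΦ (x t) (x (t + 1))
    have hxd : x (t + 1) - x t
        = -((ηx / (max (vx (t + 1)) (vy (t + 1))) ^ α) • gradx f (x t) (y t)) := by
      rw [hxup]; abel
    rw [hxd, norm_neg, norm_smul, Real.norm_of_nonneg hη0.le, inner_neg_right,
      inner_smul_right] at h1
    have h2 := hgx (x t) (x t) _ (hyY t) _ (hystar (x t)).1
    rw [sub_self, norm_zero, zero_add, norm_sub_rev (y t)] at h2
    have h3 := herr (x t) (y t) (hyY t)
    have h4 : ‖gradx f (x t) (y t) - gradx f (x t) (ystar (x t))‖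
        ≤ l / μ * ‖grady f (x t) (y t)‖ := by
      refine h2.trans ?_
      calc _ = l / μ * (μ * ‖ystar (x t) - y t‖) := by field_simp
        _ ≤ _ := by gcongr
    have h5 : ‖gradx f (x t) (y t) - gradx f (x t) (ystar (x t))‖ ^ 2
        ≤ (l / μ) ^ 2 * ‖grady f (x t) (y t)‖ ^ 2 := by
      rw [← mul_pow]; gcongr
    rw [norm_sub_sq_real, real_inner_comm] at h5
    have h6 : (ηx / (max (vx (t + 1)) (vy (t + 1))) ^ α)
          * ((l / μ) ^ 2 * ‖grady f (x t) (y t)‖ ^ 2)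
        ≤ (ηx * (l / μ) ^ 2 / (ηy * (vy 0) ^ (α - β))) *
          ((ηy / (vy (t + 1)) ^ β) * ‖grady f (x t) (y t)‖ ^ 2) := by
      refine (mul_le_mul_of_nonneg_right hη (by positivity)).trans (le_of_eq ?_)
      ring
    refine le_trans ?_ (add_le_add_right h6 _)
    generalize ηx / (max (vx (t + 1)) (vy (t + 1))) ^ α = η at *
    have h7 := mul_le_mul_of_nonneg_left h5 hη0.le
    have h8 : 0 ≤ η * ‖gradx f (x t) (ystar (x t))‖ ^ 2 := by positivity
    nlinarith
  intro T _
  have hsum := Finset.sum_le_sum (fun t (_ : t ∈ Finset.range T) => hstep t)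
  rw [Finset.sum_add_distrib, Finset.sum_add_distrib, ← Finset.mul_sum, ← Finset.mul_sum,
    ← Finset.mul_sum, Finset.sum_range_sub' (fun t => f (x t) (ystar (x t)))] at hsum
  have hinf := ciInf_le hΦbdd (x T)
  linarith
end

section
/- Contraction of the dual distance for deterministic TiAda after the dual second moment is large: Under the stated assumptions (f is l-smooth, μ-strongly concave in y on Y, each maximizer y*(x) lies in the interior of Y), if at iteration t the TiAda iterates satisfy (v^y_{t+1})^β > max{4η^y μl/(μ+l), η^y(μ+l)}, then ‖y_{t+1} − y*(x_{t+1})‖² ≤ ‖y_t − y*(x_t)‖² − (η^y / ((μ+l)(v^y_{t+1})^β)) ‖∇_y f(x_t,y_t)‖² + ((μ+l) κ² (v^y_{t+1})^β η_t² / (η^y μl)) ‖∇_x f(x_t,y_t)‖². -/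
open Real Finset
open scoped RealInnerProductSpace

section TiAdaHelpers

variable {E : Type*} [NormedAddCommGroup E] [InnerProductSpace ℝ E] [CompleteSpace E]

/-- Descent lemma on a convex set (lower bound version for `-f`). -/
theorem tiada_descent_s5 {Y : Set E} (hY : Convex ℝ Y) (f : E → ℝ) (g : E → E)
    (hg : ∀ y, HasGradientAt f (g y) y) {l : ℝ}
    (hl : ∀ a ∈ Y, ∀ b ∈ Y, ‖g a - g b‖ ≤ l * ‖a - b‖)
    {a z : E} (ha : a ∈ Y) (hz : z ∈ Y) :
    f a + ⟪g a, z - a⟫ - l / 2 * ‖z - a‖ ^ 2 ≤ f z := by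
  set d := z - a with hd
  have hder : ∀ s : ℝ, HasDerivAt
      (fun s : ℝ => f (a + s • d) - s * ⟪g a, d⟫ + l / 2 * s ^ 2 * ‖d‖ ^ 2)
      (⟪g (a + s • d), d⟫ - ⟪g a, d⟫ + l * s * ‖d‖ ^ 2) s := by
    intro s
    have h1 : HasDerivAt (fun s : ℝ => a + s • d) d s := by
      simpa using ((hasDerivAt_id s).smul_const d).const_add a
    have h2 : HasDerivAt (fun s : ℝ => f (a + s • d)) ⟪g (a + s • d), d⟫ s := by
      have := (hg (a + s • d)).hasFDerivAt.comp_hasDerivAt s h1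
      have e : (InnerProductSpace.toDual ℝ E) (g (a + s • d)) d = ⟪g (a + s • d), d⟫ := by simp
      exact e ▸ this
    have h3 := (hasDerivAt_id s).mul_const ⟪g a, d⟫
    have h4 := (((hasDerivAt_id s).pow 2).const_mul (l / 2)).mul_const (‖d‖ ^ 2)
    refine ((h2.sub h3).add h4).congr_deriv ?_
    simp only [id, Nat.cast_ofNat, Nat.add_one_sub_one, pow_one]
    ring
  have hmono : MonotoneOn
      (fun s : ℝ => f (a + s • d) - s * ⟪g a, d⟫ + l / 2 * s ^ 2 * ‖d‖ ^ 2) (Set.Icc 0 1) := by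
    apply monotoneOn_of_deriv_nonneg (convex_Icc 0 1)
    · exact fun s _ => (hder s).continuousAt.continuousWithinAt
    · exact fun s _ => (hder s).differentiableAt.differentiableWithinAt
    · intro s hs
      rw [interior_Icc] at hs
      rw [(hder s).deriv]
      have hmem : a + s • d ∈ Y := hY.add_smul_sub_mem ha hz ⟨hs.1.le, hs.2.le⟩
      have h1 := hl _ hmem _ ha
      have h2 : -(‖g (a + s • d) - g a‖ * ‖d‖) ≤ ⟪g (a + s • d) - g a, d⟫ :=
        (abs_le.mp (abs_real_inner_le_norm _ _)).1
      have h3 : ‖a + s • d - a‖ = s * ‖d‖ := by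
        rw [add_sub_cancel_left, norm_smul, Real.norm_of_nonneg hs.1.le]
      rw [h3] at h1
      rw [inner_sub_left] at h2
      nlinarith [norm_nonneg d]
  have := hmono (Set.left_mem_Icc.2 zero_le_one) (Set.right_mem_Icc.2 zero_le_one) zero_le_one
  simp [hd] at this
  simp only [hd]
  linarith

/-- Local strong co-coercivity, when enough room is available around both points. -/
theorem tiada_local {Y : Set E} (hY : Convex ℝ Y) (f : E → ℝ) (g : E → E)
    (hg : ∀ y, HasGradientAt f (g y) y) {l μ : ℝ} (hμ : 0 < μ) (hμl : μ < l)
    (hl : ∀ a ∈ Y, ∀ b ∈ Y, ‖g a - g b‖ ≤ l * ‖a - b‖)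
    (hc : ∀ a ∈ Y, ∀ b ∈ Y, f b + ⟪g a, a - b⟫ + μ / 2 * ‖a - b‖ ^ 2 ≤ f a)
    {a b : E} (ha : a ∈ Y) (hb : b ∈ Y)
    (hroom : ∀ w : E, ‖w‖ ≤ (l + μ) / (l - μ) * ‖a - b‖ → a - w ∈ Y ∧ b + w ∈ Y) :
    μ * l * ‖a - b‖ ^ 2 + ‖g a - g b‖ ^ 2 ≤ (l + μ) * ⟪g b - g a, a - b⟫ := by
  set d := a - b with hd
  set D := g b - g a with hD
  have hm : 0 < l - μ := by linarith
  have hDn : ‖D‖ ≤ l * ‖d‖ := by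
    have := hl b hb a ha
    rwa [norm_sub_rev b a] at this
  set w := (l - μ)⁻¹ • (D - μ • d) with hw
  have hwn : ‖w‖ ≤ (l + μ) / (l - μ) * ‖d‖ := by
    rw [hw, norm_smul, Real.norm_of_nonneg (inv_nonneg.2 hm.le), div_eq_inv_mul, mul_assoc]
    apply mul_le_mul_of_nonneg_left _ (inv_nonneg.2 hm.le)
    calc ‖D - μ • d‖ ≤ ‖D‖ + ‖μ • d‖ := norm_sub_le _ _
      _ ≤ l * ‖d‖ + μ * ‖d‖ := by
        rw [norm_smul, Real.norm_of_nonneg hμ.le]; linarith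
      _ = _ := by ring
  obtain ⟨h1, h2⟩ := hroom w hwn
  have u1 := tiada_descent_s5 hY f g hg hl ha h1
  have u2 := tiada_descent_s5 hY f g hg hl hb h2
  have c1 := hc b hb _ h1
  have c2 := hc a ha _ h2
  have e1 : a - w - a = -w := by abel
  have e2 : b + w - b = w := by abel
  have e3 : b - (a - w) = w - d := by rw [hd]; abel
  have e4 : a - (b + w) = d - w := by rw [hd]; abel
  rw [e1] at u1
  rw [e2] at u2
  rw [e3] at c1
  rw [e4] at c2
  rw [norm_neg, inner_neg_right] at u1
  rw [norm_sub_rev, inner_sub_right] at c1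
  rw [inner_sub_right] at c2
  have hDw : (l - μ) • w = D - μ • d := by
    rw [hw, smul_smul, mul_inv_cancel₀ hm.ne', one_smul]
  clear_value w
  have n1 : ‖d - w‖ ^ 2 = ‖d‖ ^ 2 - 2 * ⟪d, w⟫ + ‖w‖ ^ 2 := norm_sub_sq_real d w
  have i1 : (l - μ) * ‖w‖ ^ 2 = ⟪D, w⟫ - μ * ⟪d, w⟫ := by
    rw [← real_inner_self_eq_norm_sq, ← real_inner_smul_left, hDw, inner_sub_left,
      real_inner_smul_left]
  have i2 : (l - μ) * ((l - μ) * ‖w‖ ^ 2) = ‖D‖ ^ 2 - 2 * μ * ⟪D, d⟫ + μ ^ 2 * ‖d‖ ^ 2 := by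
    have : ‖(l - μ) • w‖ ^ 2 = ‖D - μ • d‖ ^ 2 := by rw [hDw]
    rw [norm_smul, norm_sub_sq_real, norm_smul, real_inner_smul_right, mul_pow, mul_pow,
      Real.norm_of_nonneg hm.le, Real.norm_of_nonneg hμ.le] at this
    linarith
  have j1 : ⟪D, w⟫ = ⟪g b, w⟫ - ⟪g a, w⟫ := inner_sub_left _ _ _
  have j2 : ⟪D, d⟫ = ⟪g b, d⟫ - ⟪g a, d⟫ := inner_sub_left _ _ _
  have hnD : ‖g a - g b‖ = ‖D‖ := norm_sub_rev _ _
  rw [hnD]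
  have key : μ * ‖d‖ ^ 2 + (l - μ) * ‖w‖ ^ 2 ≤ ⟪D, d⟫ := by
    rw [n1] at c1 c2
    nlinarith
  have := mul_le_mul_of_nonneg_left key hm.le
  nlinarith

/-- Strong co-coercivity with an interior zero of the gradient, at a point strictly inside. -/
theorem tiada_inside {Y : Set E} (hY : Convex ℝ Y) (f : E → ℝ) (g : E → E)
    (hg : ∀ y, HasGradientAt f (g y) y) {l μ : ℝ} (hμ : 0 < μ) (hμl : μ < l)
    (hl : ∀ a ∈ Y, ∀ b ∈ Y, ‖g a - g b‖ ≤ l * ‖a - b‖)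
    (hc : ∀ a ∈ Y, ∀ b ∈ Y, f b + ⟪g a, a - b⟫ + μ / 2 * ‖a - b‖ ^ 2 ≤ f a)
    {a b : E} (ha : a ∈ interior Y) (hb : b ∈ interior Y) :
    μ * l * ‖a - b‖ ^ 2 + ‖g a - g b‖ ^ 2 ≤ (l + μ) * ⟪g b - g a, a - b⟫ := by
  have hcomp : IsCompact (segment ℝ b a) := by
    rw [segment_eq_image_lineMap]
    exact isCompact_Icc.image (by fun_prop)
  have hsub : segment ℝ b a ⊆ interior Y := hY.interior.segment_subset hb ha
  obtain ⟨δ, hδ, hthick⟩ := hcomp.exists_thickening_subset_open isOpen_interior hsub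
  set d := a - b with hd
  obtain ⟨m, hmlt⟩ := exists_nat_gt ((l + μ) / (l - μ) * ‖d‖ / δ)
  set n : ℕ := m + 1 with hn
  have hnpos : (0 : ℝ) < n := by rw [hn]; positivity
  have hnlt : (l + μ) / (l - μ) * ‖d‖ / n < δ := by
    rw [div_lt_iff₀ hδ] at hmlt
    rw [div_lt_iff₀ hnpos]
    have : (n : ℝ) = m + 1 := by rw [hn]; push_cast; ring
    rw [this]; nlinarith
  set q : ℕ → E := fun i => b + ((i : ℝ) / n) • d with hq
  have hqseg : ∀ i ≤ n, q i ∈ segment ℝ b a := by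
    intro i hi
    rw [segment_eq_image']
    refine ⟨(i : ℝ) / n, ⟨by positivity, ?_⟩, rfl⟩
    rw [div_le_one hnpos]; exact_mod_cast hi
  have hnear : ∀ i ≤ n, ∀ u : E, ‖u‖ < δ → q i + u ∈ Y := by
    intro i hi u hu
    apply interior_subset
    apply hthick
    rw [Metric.mem_thickening_iff]
    exact ⟨q i, hqseg i hi, by simpa [dist_eq_norm] using hu⟩
  have hstep : ∀ i, q (i + 1) - q i = (n : ℝ)⁻¹ • d := by
    intro i
    simp only [hq]
    rw [add_sub_add_left_eq_sub, ← sub_smul]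
    congr 1
    push_cast
    field_simp
    ring
  have hloc : ∀ i ∈ Finset.range n,
      μ * l * ‖d‖ ^ 2 / n + n * ‖g (q (i + 1)) - g (q i)‖ ^ 2
        ≤ (l + μ) * ⟪g (q i) - g (q (i + 1)), d⟫ := by
    intro i hi
    have hi' : i + 1 ≤ n := Finset.mem_range.1 hi
    have hi'' : i ≤ n := by omega
    have h := tiada_local hY f g hg hμ hμl hl hc
      (interior_subset (hsub (hqseg _ hi'))) (interior_subset (hsub (hqseg _ hi''))) (by
        intro w hw
        rw [hstep, norm_smul, Real.norm_of_nonneg (by positivity)] at hw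
        have hw' : ‖w‖ < δ := by
          refine lt_of_le_of_lt hw (lt_of_eq_of_lt ?_ hnlt)
          field_simp
        refine ⟨?_, hnear _ hi'' _ hw'⟩
        rw [sub_eq_add_neg]
        exact hnear _ hi' _ (by rwa [norm_neg]))
    rw [hstep, norm_smul, Real.norm_of_nonneg (by positivity), real_inner_smul_right] at h
    have h' := mul_le_mul_of_nonneg_left h hnpos.le
    calc _ = (n : ℝ) * (μ * l * ((n : ℝ)⁻¹ * ‖d‖) ^ 2 + ‖g (q (i + 1)) - g (q i)‖ ^ 2) := by
            field_simp
      _ ≤ _ := h'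
      _ = _ := by field_simp
  have hsum := Finset.sum_le_sum hloc
  have hq0 : q 0 = b := by simp [hq]
  have hqn : q n = a := by
    simp only [hq]
    rw [div_self hnpos.ne', one_smul, hd]; abel
  have ht1 : ∑ i ∈ Finset.range n, (g (q (i + 1)) - g (q i)) = g a - g b := by
    rw [Finset.sum_range_sub (fun i => g (q i)), hq0, hqn]
  have ht2 : ∑ i ∈ Finset.range n, (g (q i) - g (q (i + 1))) = g b - g a := by
    rw [Finset.sum_range_sub' (fun i => g (q i)), hq0, hqn]
  rw [← Finset.mul_sum, ← sum_inner, ht2, Finset.sum_add_distrib, ← Finset.mul_sum] at hsum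
  simp only [Finset.sum_const, Finset.card_range, nsmul_eq_mul] at hsum
  rw [mul_div_cancel₀ _ hnpos.ne'] at hsum
  have hcs : ‖g a - g b‖ ^ 2 ≤ n * ∑ i ∈ Finset.range n, ‖g (q (i + 1)) - g (q i)‖ ^ 2 := by
    have h1 : ‖g a - g b‖ ≤ ∑ i ∈ Finset.range n, ‖g (q (i + 1)) - g (q i)‖ := by
      rw [← ht1]; exact norm_sum_le _ _
    have h2 := sq_sum_le_card_mul_sum_sq (s := Finset.range n)
      (f := fun i => ‖g (q (i + 1)) - g (q i)‖)
    rw [Finset.card_range] at h2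
    exact (pow_le_pow_left₀ (norm_nonneg _) h1 2).trans h2
  linarith

/-- Strong monotonicity. -/
theorem tiada_mono {Y : Set E} (f : E → ℝ) (g : E → E) {μ : ℝ}
    (hc : ∀ a ∈ Y, ∀ b ∈ Y, f b + ⟪g a, a - b⟫ + μ / 2 * ‖a - b‖ ^ 2 ≤ f a)
    {a b : E} (ha : a ∈ Y) (hb : b ∈ Y) :
    μ * ‖a - b‖ ^ 2 ≤ ⟪g b - g a, a - b⟫ := by
  have h1 := hc a ha b hb
  have h2 := hc b hb a ha
  have e : b - a = -(a - b) := by abel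
  rw [e, norm_neg, inner_neg_right] at h2
  rw [inner_sub_left]
  linarith

/-- Strong co-coercivity between an arbitrary point of `Y` and an interior one. -/
theorem tiada_coco {Y : Set E} (hY : Convex ℝ Y) (f : E → ℝ) (g : E → E)
    (hg : ∀ y, HasGradientAt f (g y) y) {l μ : ℝ} (hμ : 0 < μ) (hμl : μ ≤ l)
    (hl : ∀ a ∈ Y, ∀ b ∈ Y, ‖g a - g b‖ ≤ l * ‖a - b‖)
    (hc : ∀ a ∈ Y, ∀ b ∈ Y, f b + ⟪g a, a - b⟫ + μ / 2 * ‖a - b‖ ^ 2 ≤ f a)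
    {a b : E} (ha : a ∈ Y) (hb : b ∈ interior Y) :
    μ * l * ‖a - b‖ ^ 2 + ‖g a - g b‖ ^ 2 ≤ (l + μ) * ⟪g b - g a, a - b⟫ := by
  have hbY := interior_subset hb
  rcases hμl.eq_or_lt with rfl | hlt
  · have h1 := tiada_mono f g hc ha hbY
    have h2 := pow_le_pow_left₀ (norm_nonneg _) (hl a ha b hbY) 2
    nlinarith
  have hgc : ContinuousOn g Y := by
    have : LipschitzOnWith (Real.toNNReal l) g Y := by
      apply LipschitzOnWith.of_dist_le_mul
      intro u hu v hv
      rw [dist_eq_norm, dist_eq_norm, Real.coe_toNNReal _ (by linarith)]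
      exact hl u hu v hv
    exact this.continuousOn
  set q : ℝ → E := fun s => b + s • (a - b) with hq
  have hqY : ∀ s ∈ Set.Icc (0 : ℝ) 1, q s ∈ Y := fun s hs => hY.add_smul_sub_mem hbY ha hs
  have hqc : Continuous q := by fun_prop
  have hgq : ContinuousOn (fun s => g (q s)) (Set.Icc (0 : ℝ) 1) :=
    hgc.comp hqc.continuousOn hqY
  have hcl : closure (Set.Ico (0 : ℝ) 1) = Set.Icc 0 1 := closure_Ico zero_ne_one
  have key := le_on_closure (s := Set.Ico (0 : ℝ) 1)
    (f := fun s => μ * l * ‖q s - b‖ ^ 2 + ‖g (q s) - g b‖ ^ 2)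
    (g := fun s => (l + μ) * ⟪g b - g (q s), q s - b⟫)
    (by
      intro s hs
      refine tiada_inside hY f g hg hμ hlt hl hc ?_ hb
      have : q s = (1 - s) • b + s • a := by simp only [hq]; module
      rw [this]
      exact hY.combo_interior_self_mem_interior hb ha (by linarith [hs.2]) hs.1 (by ring))
    (by
      rw [hcl]
      have h1 := hqc.continuousOn (s := Set.Icc (0 : ℝ) 1)
      exact ((h1.sub continuousOn_const).norm.pow 2).const_mul _ |>.add
        ((hgq.sub continuousOn_const).norm.pow 2))
    (by
      rw [hcl]
      have h1 := hqc.continuousOn (s := Set.Icc (0 : ℝ) 1)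
      exact ((continuousOn_const.sub hgq).inner (h1.sub continuousOn_const)).const_mul _)
    (x := 1) (by rw [hcl]; exact Set.right_mem_Icc.2 zero_le_one)
  have hq1 : q 1 = a := by simp [hq]
  simpa only [hq1] using key

/-- Projection onto a convex set does not increase distances to points of the set. -/
theorem tiada_proj_s5 {Y : Set E} (hY : Convex ℝ Y) {p z w : E} (hp : p ∈ Y)
    (hmin : ∀ v ∈ Y, ‖p - z‖ ≤ ‖v - z‖) (hw : w ∈ Y) :
    ‖p - w‖ ^ 2 ≤ ‖z - w‖ ^ 2 := by
  have : Nonempty Y := ⟨⟨p, hp⟩⟩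
  have heq : ‖z - p‖ = ⨅ v : Y, ‖z - v‖ := by
    apply le_antisymm
    · apply le_ciInf
      intro v
      rw [norm_sub_rev z p, norm_sub_rev z v]
      exact hmin v v.2
    · exact ciInf_le (f := fun v : Y => ‖z - v‖)
        ⟨0, by rintro _ ⟨v, rfl⟩; exact norm_nonneg _⟩ ⟨p, hp⟩
  have h := (norm_eq_iInf_iff_real_inner_le_zero hY hp).1 heq w hw
  have e : z - w = (z - p) - (w - p) := by abel
  rw [e, norm_sub_sq_real (z - p) (w - p), norm_sub_rev p w]
  nlinarith [sq_nonneg ‖z - p‖]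

/-- Weighted Young inequality. -/
theorem tiada_young (a b : E) {θ : ℝ} (h0 : 0 < θ) (h1 : θ < 1) :
    ‖a + b‖ ^ 2 ≤ ‖a‖ ^ 2 / (1 - θ) + ‖b‖ ^ 2 / θ := by
  have h2 : 0 < 1 - θ := by linarith
  have h := pow_le_pow_left₀ (norm_nonneg _) (norm_add_le a b) 2
  refine h.trans ?_
  rw [div_add_div _ _ h2.ne' h0.ne', le_div_iff₀ (by positivity)]
  nlinarith [sq_nonneg (θ * ‖a‖ - (1 - θ) * ‖b‖)]

end TiAdaHelpers

/-- Contraction of the dual distance for deterministic TiAda once the dual second moment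
is large enough, with `κ := l/μ` and `η_t = η^x / max(v^x_{t+1}, v^y_{t+1})^α`. -/
theorem tiada_dual_distance_contraction
    {d1 d2 : ℕ}
    (Y : Set (EuclideanSpace ℝ (Fin d2)))
    (hYne : Y.Nonempty) (hYclosed : IsClosed Y) (hYconv : Convex ℝ Y)
    (P : EuclideanSpace ℝ (Fin d2) → EuclideanSpace ℝ (Fin d2))
    (hP : ∀ z, P z ∈ Y ∧ ∀ w ∈ Y, ‖P z - z‖ ≤ ‖w - z‖)
    (f : EuclideanSpace ℝ (Fin d1) → EuclideanSpace ℝ (Fin d2) → ℝ)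
    (hdiff : Differentiable ℝ
      (fun p : EuclideanSpace ℝ (Fin d1) × EuclideanSpace ℝ (Fin d2) => f p.1 p.2))
    (l μ : ℝ) (hμ : 0 < μ) (hμl : μ ≤ l)
    (hsmooth : ∀ x1 x2 : EuclideanSpace ℝ (Fin d1), ∀ y1 ∈ Y, ∀ y2 ∈ Y,
      max ‖gradx f x1 y1 - gradx f x2 y2‖ ‖grady f x1 y1 - grady f x2 y2‖
        ≤ l * (‖x1 - x2‖ + ‖y1 - y2‖))
    (hconc : ∀ x' : EuclideanSpace ℝ (Fin d1), ∀ y1 ∈ Y, ∀ y2 ∈ Y,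
      f x' y2 + ⟪grady f x' y1, y1 - y2⟫ + μ / 2 * ‖y1 - y2‖ ^ 2 ≤ f x' y1)
    (ystar : EuclideanSpace ℝ (Fin d1) → EuclideanSpace ℝ (Fin d2))
    (hystar : ∀ x', ystar x' ∈ Y ∧ ∀ y' ∈ Y, f x' y' ≤ f x' (ystar x'))
    (hint : ∀ x', ystar x' ∈ interior Y)
    (ηx ηy α β : ℝ) (hηx : 0 < ηx) (hηy : 0 < ηy)
    (hβ : 0 < β) (hβα : β < α) (hα : α < 1)
    (x : ℕ → EuclideanSpace ℝ (Fin d1)) (y : ℕ → EuclideanSpace ℝ (Fin d2))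
    (vx vy : ℕ → ℝ)
    (hy0 : y 0 ∈ Y) (hvx0 : 0 < vx 0) (hvy0 : 0 < vy 0)
    (hvx : ∀ t, vx (t + 1) = vx t + ‖gradx f (x t) (y t)‖ ^ 2)
    (hvy : ∀ t, vy (t + 1) = vy t + ‖grady f (x t) (y t)‖ ^ 2)
    (hxup : ∀ t, x (t + 1) =
      x t - (ηx / (max (vx (t + 1)) (vy (t + 1))) ^ α) • gradx f (x t) (y t))
    (hyup : ∀ t, y (t + 1) = P (y t + (ηy / (vy (t + 1)) ^ β) • grady f (x t) (y t)))
    (t : ℕ)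
    (hlarge : max (4 * ηy * μ * l / (μ + l)) (ηy * (μ + l)) < (vy (t + 1)) ^ β) :
    ‖y (t + 1) - ystar (x (t + 1))‖ ^ 2
      ≤ ‖y t - ystar (x t)‖ ^ 2
        - (ηy / ((μ + l) * (vy (t + 1)) ^ β)) * ‖grady f (x t) (y t)‖ ^ 2
        + ((μ + l) * (l / μ) ^ 2 * (vy (t + 1)) ^ β *
            (ηx / (max (vx (t + 1)) (vy (t + 1))) ^ α) ^ 2 / (ηy * μ * l)) *
          ‖gradx f (x t) (y t)‖ ^ 2 := by
  have hgy : ∀ x' y', HasGradientAt (f x') (grady f x' y') y' := by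
    intro x' y'
    have h : DifferentiableAt ℝ (f x') y' := by
      have h2 : DifferentiableAt ℝ (fun y'' : EuclideanSpace ℝ (Fin d2) => (x', y'')) y' := by
        fun_prop
      exact DifferentiableAt.comp (g := fun p : EuclideanSpace ℝ (Fin d1) × EuclideanSpace ℝ (Fin d2) => f p.1 p.2) y' (hdiff (x', y')) h2
    exact h.hasGradientAt
  have hzero : ∀ x', grady f x' (ystar x') = 0 := by
    intro x'
    have hmax : IsLocalMax (f x') (ystar x') := by
      filter_upwards [mem_interior_iff_mem_nhds.1 (hint x')] with w hw
      exact (hystar x').2 w hw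
    have h := hmax.hasFDerivAt_eq_zero (hgy x' (ystar x')).hasFDerivAt
    simpa using h
  have hlip : ∀ x' : EuclideanSpace ℝ (Fin d1), ∀ a ∈ Y, ∀ b ∈ Y,
      ‖grady f x' a - grady f x' b‖ ≤ l * ‖a - b‖ := by
    intro x' a ha b hb
    have := (le_max_right _ _).trans (hsmooth x' x' a ha b hb)
    simpa using this
  have hl : 0 < l := lt_of_lt_of_le hμ hμl
  have hystarlip : ∀ x1 x2, ‖ystar x1 - ystar x2‖ ≤ l / μ * ‖x1 - x2‖ := by
    intro x1 x2
    have h1 := tiada_mono (f x2) (grady f x2) (hconc x2) (hystar x1).1 (hystar x2).1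
    rw [hzero, zero_sub] at h1
    have h2 : ‖grady f x2 (ystar x1)‖ ≤ l * ‖x1 - x2‖ := by
      have := (le_max_right _ _).trans
        (hsmooth x1 x2 (ystar x1) (hystar x1).1 (ystar x1) (hystar x1).1)
      simpa [hzero] using this
    have h3 := real_inner_le_norm (-grady f x2 (ystar x1)) (ystar x1 - ystar x2)
    rw [norm_neg] at h3
    have h4 := mul_le_mul_of_nonneg_right h2 (norm_nonneg (ystar x1 - ystar x2))
    rw [div_mul_eq_mul_div, le_div_iff₀ hμ]
    rcases (norm_nonneg (ystar x1 - ystar x2)).eq_or_lt with h0 | h0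
    · rw [← h0]; simp only [zero_mul]; positivity
    · refine le_of_mul_le_mul_right ?_ h0
      nlinarith
  have hyY : ∀ s, y s ∈ Y := by
    intro s
    cases s with
    | zero => exact hy0
    | succ s => rw [hyup]; exact (hP _).1
  have hvypos : ∀ s, 0 < vy s := by
    intro s
    induction s with
    | zero => exact hvy0
    | succ s ih => rw [hvy]; positivity
  set η := ηx / (max (vx (t + 1)) (vy (t + 1))) ^ α with hη
  set V := (vy (t + 1)) ^ β with hV
  have hVpos : 0 < V := Real.rpow_pos_of_pos (hvypos _) _
  set g := grady f (x t) (y t) with hg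
  set gx := gradx f (x t) (y t) with hgx
  set γ := ηy / V with hγ
  have hγpos : 0 < γ := div_pos hηy hVpos
  have hsum : 0 < μ + l := by linarith
  have hγ1 : γ * (μ + l) < 1 := by
    have := (le_max_right _ _).trans_lt hlarge
    rw [hγ, div_mul_eq_mul_div, div_lt_one hVpos]; exact this
  set θ := γ * (μ * l / (μ + l)) with hθ
  have hθpos : 0 < θ := by positivity
  have hθ4 : 4 * θ < 1 := by
    have := (le_max_left _ _).trans_lt hlarge
    have e : 4 * θ = (4 * ηy * μ * l / (μ + l)) / V := by rw [hθ, hγ]; field_simp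
    rw [e, div_lt_one hVpos]; exact this
  have hco := tiada_coco hYconv (f (x t)) (grady f (x t)) (hgy (x t)) hμ hμl (hlip (x t))
    (hconc (x t)) (hyY t) (hint (x t))
  rw [hzero, sub_zero, zero_sub, inner_neg_left, ← hg] at hco
  have hproj : ‖y (t + 1) - ystar (x t)‖ ^ 2 ≤ ‖y t + γ • g - ystar (x t)‖ ^ 2 := by
    rw [hyup t]
    exact tiada_proj_s5 hYconv (hP _).1 (hP _).2 (hystar (x t)).1
  have hexp : ‖y t + γ • g - ystar (x t)‖ ^ 2
      = ‖y t - ystar (x t)‖ ^ 2 + 2 * (γ * ⟪g, y t - ystar (x t)⟫) + γ ^ 2 * ‖g‖ ^ 2 := by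
    have e : y t + γ • g - ystar (x t) = (y t - ystar (x t)) + γ • g := by abel
    rw [e, norm_add_sq_real, real_inner_smul_right, norm_smul, mul_pow,
      Real.norm_of_nonneg hγpos.le, real_inner_comm]
  rw [hexp] at hproj
  set D := ‖y t - ystar (x t)‖ ^ 2 with hD
  set ip := ⟪g, y t - ystar (x t)⟫ with hip
  have hDnn : 0 ≤ D := by positivity
  set G := γ / (μ + l) * ‖g‖ ^ 2 with hG
  have hGnn : 0 ≤ G := by positivity
  have hA : ‖y (t + 1) - ystar (x t)‖ ^ 2 ≤ (1 - 2 * θ) * D - G := by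
    have h1 : γ * ip ≤ -(θ * D) - G := by
      have h2 : (μ * l * D + ‖g‖ ^ 2) * (γ / (μ + l)) ≤ (l + μ) * -ip * (γ / (μ + l)) :=
        mul_le_mul_of_nonneg_right hco (by positivity)
      have e1 : (l + μ) * -ip * (γ / (μ + l)) = - (γ * ip) := by field_simp; ring
      have e2 : (μ * l * D + ‖g‖ ^ 2) * (γ / (μ + l)) = θ * D + G := by
        rw [hθ, hG]; field_simp
      linarith
    have h3 : γ ^ 2 * ‖g‖ ^ 2 ≤ G := by
      rw [hG]
      apply mul_le_mul_of_nonneg_right _ (by positivity)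
      rw [le_div_iff₀ hsum]
      nlinarith
    linarith
  have hB : ‖ystar (x t) - ystar (x (t + 1))‖ ^ 2 ≤ (l / μ) ^ 2 * (η ^ 2 * ‖gx‖ ^ 2) := by
    have h := pow_le_pow_left₀ (norm_nonneg _) (hystarlip (x t) (x (t + 1))) 2
    have e : x t - x (t + 1) = η • gx := by rw [hxup t]; abel
    rw [e, norm_smul, mul_pow, mul_pow, Real.norm_eq_abs, sq_abs] at h
    exact h
  have hy := tiada_young (y (t + 1) - ystar (x t)) (ystar (x t) - ystar (x (t + 1)))
    hθpos (by linarith)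
  rw [sub_add_sub_cancel] at hy
  have hA' : ‖y (t + 1) - ystar (x t)‖ ^ 2 / (1 - θ) ≤ D - G := by
    rw [div_le_iff₀ (by linarith)]
    nlinarith
  have hB' := div_le_div_of_nonneg_right hB hθpos.le
  have e1 : ηy / ((μ + l) * V) * ‖g‖ ^ 2 = G := by rw [hG, hγ]; field_simp
  have e2 : (μ + l) * (l / μ) ^ 2 * V * η ^ 2 / (ηy * μ * l) * ‖gx‖ ^ 2
      = (l / μ) ^ 2 * (η ^ 2 * ‖gx‖ ^ 2) / θ := by
    rw [hθ, hγ]; field_simp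
  rw [e1, e2]
  linarith
end

section
/- AdaGrad-type summation lemma (fractional powers): Let x_1, ..., x_T be nonnegative real numbers with x_1 > 0 and let 0 < α < 1. Then (Σ_{t=1}^T x_t)^{1−α} ≤ Σ_{t=1}^T x_t / (Σ_{k=1}^t x_k)^α ≤ (1/(1−α)) (Σ_{t=1}^T x_t)^{1−α}. -/
open Real Finset

lemma step_aux {s y α : ℝ} (hs : 0 < s) (hy : 0 ≤ y) (hα0 : 0 < α) (hα1 : α < 1) :
    (s + y) ^ (1 - α) ≤ s ^ (1 - α) + y / (s + y) ^ α ∧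
    1 / (1 - α) * s ^ (1 - α) + y / (s + y) ^ α ≤ 1 / (1 - α) * (s + y) ^ (1 - α) := by
  have hS : 0 < s + y := by linarith
  have hP : 0 < (s + y) ^ α := Real.rpow_pos_of_pos hS α
  have hp : 0 < s ^ α := Real.rpow_pos_of_pos hs α
  have hSe : (s + y) ^ (1 - α) = (s + y) / (s + y) ^ α := by
    rw [Real.rpow_sub hS, Real.rpow_one]
  have hse : s ^ (1 - α) = s / s ^ α := by
    rw [Real.rpow_sub hs, Real.rpow_one]
  constructor
  · have hle : s ^ α ≤ (s + y) ^ α := Real.rpow_le_rpow hs.le (by linarith) hα0.le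
    have h := div_le_div_of_nonneg_left hs.le hp hle
    rw [hSe, hse, add_div]
    linarith
  · have h := Real.geom_mean_le_arith_mean2_weighted (w₁ := 1 - α) (w₂ := α)
      (by linarith) hα0.le hs.le hS.le (by ring)
    have hb : 0 < 1 - α := by linarith
    have h2 : s ^ (1 - α) + (1 - α) * (y / (s + y) ^ α) ≤ (s + y) ^ (1 - α) := by
      rw [hSe, le_div_iff₀ hP, add_mul, mul_assoc, div_mul_cancel₀ _ hP.ne']
      linarith
    calc 1 / (1 - α) * s ^ (1 - α) + y / (s + y) ^ α
        = 1 / (1 - α) * (s ^ (1 - α) + (1 - α) * (y / (s + y) ^ α)) := by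
          field_simp
      _ ≤ _ := mul_le_mul_of_nonneg_left h2 (by positivity)

/-- AdaGrad-type summation lemma with fractional powers (Lemma A.2, first part):
for nonnegative `x_1, …, x_T` with `x_1 > 0` and `0 < α < 1`,
`(Σ_{t=1}^T x_t)^{1−α} ≤ Σ_{t=1}^T x_t / (Σ_{k=1}^t x_k)^α ≤ (Σ_{t=1}^T x_t)^{1−α}/(1−α)`. -/
theorem adagrad_sum_lemma_rpow
    (T : ℕ) (hT : 1 ≤ T) (x : ℕ → ℝ)
    (hx : ∀ t ∈ Finset.Icc 1 T, 0 ≤ x t) (hx1 : 0 < x 1)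
    (α : ℝ) (hα0 : 0 < α) (hα1 : α < 1) :
    (∑ t ∈ Finset.Icc 1 T, x t) ^ (1 - α)
        ≤ ∑ t ∈ Finset.Icc 1 T, x t / (∑ k ∈ Finset.Icc 1 t, x k) ^ α ∧
      ∑ t ∈ Finset.Icc 1 T, x t / (∑ k ∈ Finset.Icc 1 t, x k) ^ α
        ≤ (1 / (1 - α)) * (∑ t ∈ Finset.Icc 1 T, x t) ^ (1 - α) := by
  induction T, hT using Nat.le_induction with
  | base =>
    have hb : 0 < 1 - α := by linarith
    have h : x 1 ^ (1 - α) = x 1 / x 1 ^ α := by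
      rw [Real.rpow_sub hx1, Real.rpow_one]
    have h0 : 0 < x 1 ^ (1 - α) := Real.rpow_pos_of_pos hx1 _
    simp only [Finset.Icc_self, Finset.sum_singleton]
    rw [← h]
    refine ⟨le_rfl, le_mul_of_one_le_left h0.le ?_⟩
    rw [le_div_iff₀ hb]
    linarith
  | succ n hn ih =>
    have hx' : ∀ t ∈ Finset.Icc 1 n, 0 ≤ x t := fun t ht =>
      hx t (Finset.Icc_subset_Icc_right (Nat.le_succ n) ht)
    obtain ⟨h1, h2⟩ := ih hx'
    have hs : 0 < ∑ k ∈ Finset.Icc 1 n, x k :=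
      lt_of_lt_of_le hx1 (Finset.single_le_sum hx' (by simp [hn]))
    obtain ⟨g1, g2⟩ := step_aux hs (hx (n + 1) (by simp)) hα0 hα1
    rw [Finset.sum_Icc_succ_top (by omega : 1 ≤ n + 1),
      Finset.sum_Icc_succ_top (by omega : 1 ≤ n + 1),
      Finset.sum_Icc_succ_top (by omega : 1 ≤ n + 1)]
    constructor <;> linarith
end

section
/- AdaGrad-type summation lemma (logarithmic case): Let x_1, ..., x_T be nonnegative real numbers with x_1 > 0. Then Σ_{t=1}^T x_t / (Σ_{k=1}^t x_k) ≤ 1 + log((Σ_{t=1}^T x_t) / x_1). -/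
open Real Finset

/-- AdaGrad-type summation lemma, logarithmic case (Lemma A.2, second part):
for nonnegative `x_1, …, x_T` with `x_1 > 0`,
`Σ_{t=1}^T x_t / (Σ_{k=1}^t x_k) ≤ 1 + log((Σ_{t=1}^T x_t)/x_1)`. -/
theorem adagrad_sum_lemma_log
    (T : ℕ) (hT : 1 ≤ T) (x : ℕ → ℝ)
    (hx : ∀ t ∈ Finset.Icc 1 T, 0 ≤ x t) (hx1 : 0 < x 1) :
    ∑ t ∈ Finset.Icc 1 T, x t / (∑ k ∈ Finset.Icc 1 t, x k)
      ≤ 1 + Real.log ((∑ t ∈ Finset.Icc 1 T, x t) / x 1) := by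
  induction T, hT using Nat.le_induction with
  | base => simp [hx1.ne']
  | succ n hn ih =>
    have hx' : ∀ t ∈ Finset.Icc 1 n, 0 ≤ x t := fun t ht =>
      hx t (Finset.Icc_subset_Icc_right (Nat.le_succ n) ht)
    have ih := ih hx'
    have hy : 0 ≤ x (n + 1) := hx (n + 1) (by simp)
    have hS : 0 < ∑ k ∈ Finset.Icc 1 n, x k :=
      lt_of_lt_of_le hx1 (Finset.single_le_sum hx' (by simp [hn]))
    rw [Finset.sum_Icc_succ_top (by omega), Finset.sum_Icc_succ_top (by omega)]
    set S := ∑ k ∈ Finset.Icc 1 n, x k with hSd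
    have hSy : 0 < S + x (n + 1) := by linarith
    rw [Real.log_div hS.ne' hx1.ne'] at ih
    rw [Real.log_div hSy.ne' hx1.ne']
    have h := Real.log_le_sub_one_of_pos (div_pos hS hSy)
    rw [Real.log_div hS.ne' hSy.ne'] at h
    have e : x (n + 1) / (S + x (n + 1)) = 1 - S / (S + x (n + 1)) := by
      field_simp
      ring
    linarith
end

section
/- Lipschitzness of the best response map: If f is l-smooth and μ-strongly concave in y on the nonempty closed convex set Y, then the map y* : ℝ^{d1} → Y sending x to the unique maximizer of f(x,·) over Y is κ-Lipschitz, where κ := l/μ, i.e., ‖y*(x1) − y*(x2)‖ ≤ κ ‖x1 − x2‖ for all x1, x2 ∈ ℝ^{d1}. -/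
open Real
open scoped RealInnerProductSpace

/-- Lipschitzness of the best response map (Lemma 4.3 of Lin et al.): the map
`x ↦ y*(x)` is `κ`-Lipschitz with `κ := l/μ`. -/
theorem best_response_lipschitz
    {d1 d2 : ℕ}
    (Y : Set (EuclideanSpace ℝ (Fin d2)))
    (hYne : Y.Nonempty) (hYclosed : IsClosed Y) (hYconv : Convex ℝ Y)
    (f : EuclideanSpace ℝ (Fin d1) → EuclideanSpace ℝ (Fin d2) → ℝ)
    (hdiff : Differentiable ℝ
      (fun p : EuclideanSpace ℝ (Fin d1) × EuclideanSpace ℝ (Fin d2) => f p.1 p.2))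
    (l μ : ℝ) (hμ : 0 < μ) (hμl : μ ≤ l)
    (hsmooth : ∀ x1 x2 : EuclideanSpace ℝ (Fin d1), ∀ y1 ∈ Y, ∀ y2 ∈ Y,
      max ‖gradx f x1 y1 - gradx f x2 y2‖ ‖grady f x1 y1 - grady f x2 y2‖
        ≤ l * (‖x1 - x2‖ + ‖y1 - y2‖))
    (hconc : ∀ x' : EuclideanSpace ℝ (Fin d1), ∀ y1 ∈ Y, ∀ y2 ∈ Y,
      f x' y2 + ⟪grady f x' y1, y1 - y2⟫ + μ / 2 * ‖y1 - y2‖ ^ 2 ≤ f x' y1)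
    (ystar : EuclideanSpace ℝ (Fin d1) → EuclideanSpace ℝ (Fin d2))
    (hystar : ∀ x', ystar x' ∈ Y ∧ ∀ y' ∈ Y, f x' y' ≤ f x' (ystar x')) :
    ∀ x1 x2 : EuclideanSpace ℝ (Fin d1),
      ‖ystar x1 - ystar x2‖ ≤ (l / μ) * ‖x1 - x2‖ := by
  have hopt : ∀ x : EuclideanSpace ℝ (Fin d1), ∀ y ∈ Y,
      ⟪grady f x (ystar x), y - ystar x⟫ ≤ 0 := by
    intro x y hy
    have hd : DifferentiableAt ℝ (f x) (ystar x) := by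
      have h1 : DifferentiableAt ℝ (fun y : EuclideanSpace ℝ (Fin d2) => (x, y)) (ystar x) := by
        fun_prop
      exact (hdiff (x, ystar x)).comp (ystar x) h1
    have hg := hd.hasGradientAt.hasFDerivAt.hasFDerivWithinAt (s := Y)
    have hmax : IsLocalMaxOn (f x) Y (ystar x) :=
      IsMaxOn.localize (fun y' hy' => (hystar x).2 y' hy')
    have h := hmax.hasFDerivWithinAt_nonpos hg
      (sub_mem_posTangentConeAt_of_segment_subset (hYconv.segment_subset (hystar x).1 hy))
    simpa [grady] using h
  intro x1 x2
  have ha := (hystar x1).1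
  have hb := (hystar x2).1
  have h1 := hopt x1 _ hb
  have h2 := hopt x2 _ ha
  have c1 := hconc x1 _ ha _ hb
  have c2 := hconc x1 _ hb _ ha
  have hs := (le_max_right _ _).trans (hsmooth x1 x2 _ hb _ hb)
  rw [sub_self, norm_zero, add_zero] at hs
  generalize ystar x1 = a at *
  generalize ystar x2 = b at *
  have e1 : ⟪grady f x1 a, b - a⟫ = -⟪grady f x1 a, a - b⟫ := by
    rw [← inner_neg_right, neg_sub]
  have e2 : ⟪grady f x1 b, b - a⟫ = -⟪grady f x1 b, a - b⟫ := by
    rw [← inner_neg_right, neg_sub]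
  have hcs := real_inner_le_norm (grady f x1 b - grady f x2 b) (a - b)
  rw [inner_sub_left] at hcs
  rw [norm_sub_rev b a] at c2
  have hm := mul_le_mul_of_nonneg_right hs (norm_nonneg (a - b))
  have key : μ * ‖a - b‖ ^ 2 ≤ l * ‖x1 - x2‖ * ‖a - b‖ := by linarith
  rw [div_mul_eq_mul_div, le_div_iff₀ hμ]
  rcases (norm_nonneg (a - b)).eq_or_lt with h0 | h0
  · rw [← h0, zero_mul]
    exact mul_nonneg (hμ.le.trans hμl) (norm_nonneg _)
  · refine le_of_mul_le_mul_right ?_ h0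
    linarith [key, sq ‖a - b‖, show ‖a - b‖ * μ * ‖a - b‖ = μ * ‖a - b‖ ^ 2 by ring]
end

section
/- Smoothness of the primal function and Danskin-type formula: If f is l-smooth and μ-strongly concave in y on the nonempty closed convex set Y, then the primal function Φ(x) := f(x, y*(x)) = max_{y ∈ Y} f(x,y) is differentiable with ∇Φ(x) = ∇_x f(x, y*(x)) for every x, and ∇Φ is (l + κl)-Lipschitz, where κ := l/μ: ‖∇Φ(x1) − ∇Φ(x2)‖ ≤ (l + κl) ‖x1 − x2‖ for all x1, x2 ∈ ℝ^{d1}. -/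
open Real
open scoped RealInnerProductSpace

/-- Smoothness of the primal function `Φ(x) := f(x, y*(x))` and the Danskin-type formula
`∇Φ(x) = ∇_x f(x, y*(x))`, with `(l + κl)`-Lipschitz gradient, `κ := l/μ`. -/
theorem primal_function_smooth_danskin
    {d1 d2 : ℕ}
    (Y : Set (EuclideanSpace ℝ (Fin d2)))
    (hYne : Y.Nonempty) (hYclosed : IsClosed Y) (hYconv : Convex ℝ Y)
    (f : EuclideanSpace ℝ (Fin d1) → EuclideanSpace ℝ (Fin d2) → ℝ)
    (hdiff : Differentiable ℝ
      (fun p : EuclideanSpace ℝ (Fin d1) × EuclideanSpace ℝ (Fin d2) => f p.1 p.2))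
    (l μ : ℝ) (hμ : 0 < μ) (hμl : μ ≤ l)
    (hsmooth : ∀ x1 x2 : EuclideanSpace ℝ (Fin d1), ∀ y1 ∈ Y, ∀ y2 ∈ Y,
      max ‖gradx f x1 y1 - gradx f x2 y2‖ ‖grady f x1 y1 - grady f x2 y2‖
        ≤ l * (‖x1 - x2‖ + ‖y1 - y2‖))
    (hconc : ∀ x' : EuclideanSpace ℝ (Fin d1), ∀ y1 ∈ Y, ∀ y2 ∈ Y,
      f x' y2 + ⟪grady f x' y1, y1 - y2⟫ + μ / 2 * ‖y1 - y2‖ ^ 2 ≤ f x' y1)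
    (ystar : EuclideanSpace ℝ (Fin d1) → EuclideanSpace ℝ (Fin d2))
    (hystar : ∀ x', ystar x' ∈ Y ∧ ∀ y' ∈ Y, f x' y' ≤ f x' (ystar x')) :
    (∀ x : EuclideanSpace ℝ (Fin d1),
        HasGradientAt (fun x' => f x' (ystar x')) (gradx f x (ystar x)) x) ∧
      (∀ x1 x2 : EuclideanSpace ℝ (Fin d1),
        ‖gradx f x1 (ystar x1) - gradx f x2 (ystar x2)‖
          ≤ (l + (l / μ) * l) * ‖x1 - x2‖) := by
  have hl : 0 < l := lt_of_lt_of_le hμ hμl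
  have hgy : ∀ x y, HasGradientAt (f x) (grady f x y) y := by
    intro x y
    have h : DifferentiableAt ℝ (f x) y :=
      (hdiff (x, y)).comp (f := fun y' => (x, y')) y (by fun_prop)
    exact h.hasGradientAt
  have hgx : ∀ x y, HasGradientAt (fun x' => f x' y) (gradx f x y) x := by
    intro x y
    have h : DifferentiableAt ℝ (fun x' => f x' y) x :=
      (hdiff (x, y)).comp (f := fun x' => (x', y)) x (by fun_prop)
    exact h.hasGradientAt
  -- first-order optimality
  have hopt : ∀ x, ∀ y ∈ Y, ⟪grady f x (ystar x), y - ystar x⟫ ≤ 0 := by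
    intro x y hy
    have hmax : IsLocalMaxOn (f x) Y (ystar x) := by
      have : IsMaxOn (f x) Y (ystar x) := fun y' hy' => (hystar x).2 y' hy'
      exact this.localize
    have h1 := hmax.hasFDerivWithinAt_nonpos (hgy x (ystar x)).hasFDerivAt.hasFDerivWithinAt
      (sub_mem_posTangentConeAt_of_segment_subset (hYconv.segment_subset (hystar x).1 hy))
    simpa using h1
  have hlip : ∀ x1 x2, ‖ystar x1 - ystar x2‖ ≤ l / μ * ‖x1 - x2‖ := by
    intro x1 x2
    have hy1 := (hystar x1).1
    have hy2 := (hystar x2).1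
    have a1 := hopt x1 _ hy2
    have a2 := hopt x2 _ hy1
    have c1 := hconc x1 _ hy1 _ hy2
    have c2 := hconc x1 _ hy2 _ hy1
    have s := (le_max_right _ _).trans (hsmooth x1 x2 _ hy2 _ hy2)
    simp only [sub_self, norm_zero, add_zero] at s
    have cs := real_inner_le_norm (grady f x1 (ystar x2) - grady f x2 (ystar x2))
      (ystar x1 - ystar x2)
    rw [norm_sub_rev (ystar x2) (ystar x1), ← neg_sub (ystar x1) (ystar x2), inner_neg_right] at c2
    rw [← neg_sub (ystar x1) (ystar x2), inner_neg_right] at a1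
    rw [inner_sub_left] at cs
    have s2 := mul_le_mul_of_nonneg_right s (norm_nonneg (ystar x1 - ystar x2))
    have key : μ * ‖ystar x1 - ystar x2‖ ^ 2 ≤ l * ‖x1 - x2‖ * ‖ystar x1 - ystar x2‖ := by
      linarith
    rw [div_mul_eq_mul_div, le_div_iff₀ hμ]
    rcases (norm_nonneg (ystar x1 - ystar x2)).eq_or_lt with h0 | h0
    · rw [← h0, zero_mul]; positivity
    · nlinarith
  have hmv : ∀ x x', ∀ y ∈ Y, ∀ y' ∈ Y,
      |f x' y' - f x y' - ⟪gradx f x y, x' - x⟫| ≤ l * (‖x' - x‖ + ‖y' - y‖) * ‖x' - x‖ := by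
    intro x x' y hy y' hy'
    have h := (convex_segment (𝕜 := ℝ) x x').norm_image_sub_le_of_norm_hasFDerivWithin_le'
      (f := fun z => f z y') (C := l * (‖x' - x‖ + ‖y' - y‖))
      (φ := InnerProductSpace.toDual ℝ _ (gradx f x y))
      (fun z _ => (hgx z y').hasFDerivAt.hasFDerivWithinAt)
      (fun z hz => by
        rw [← map_sub, LinearIsometryEquiv.norm_map]
        refine ((le_max_left _ _).trans (hsmooth z x y' hy' y hy)).trans ?_
        have := norm_sub_le_of_mem_segment hz
        gcongr)
      (left_mem_segment ℝ x x') (right_mem_segment ℝ x x')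
    simpa using h
  refine ⟨?_, ?_⟩
  · intro x
    rw [hasGradientAt_iff_isLittleO]
    have hb : ∀ x', ‖f x' (ystar x') - f x (ystar x) - ⟪gradx f x (ystar x), x' - x⟫‖
        ≤ (l * (1 + l / μ)) * ‖‖x' - x‖ ^ 2‖ := by
      intro x'
      have hy := (hystar x).1
      have hy' := (hystar x').1
      have u := (abs_le.1 (hmv x x' _ hy _ hy')).2
      have v := (abs_le.1 (hmv x x' _ hy _ hy)).1
      have m1 := (hystar x).2 _ hy'
      have m2 := (hystar x').2 _ hy
      have L := hlip x' x
      have e : l * (‖x' - x‖ + ‖ystar x' - ystar x‖) * ‖x' - x‖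
          ≤ l * (‖x' - x‖ + l / μ * ‖x' - x‖) * ‖x' - x‖ := by gcongr
      have p : 0 ≤ l * (l / μ * ‖x' - x‖) * ‖x' - x‖ := by positivity
      simp only [sub_self, norm_zero, add_zero] at v
      rw [Real.norm_eq_abs, norm_pow, norm_norm, abs_le]
      constructor <;> nlinarith
    refine (Asymptotics.IsBigO.of_bound _ (Filter.Eventually.of_forall hb)).trans_isLittleO ?_
    exact Asymptotics.isLittleO_pow_sub_sub x one_lt_two
  · intro x1 x2
    refine ((le_max_left _ _).trans (hsmooth x1 x2 _ (hystar x1).1 _ (hystar x2).1)).trans ?_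
    have := mul_le_mul_of_nonneg_left (hlip x1 x2) hl.le
    linarith
end

section
/- Smoothness of the best response map under second-order Lipschitz continuity: Suppose f is twice continuously differentiable, l-smooth, μ-strongly concave in y on Y, each maximizer y*(x) lies in the interior of Y, and the mixed and dual Hessian blocks are L-Lipschitz: ‖∇²_{xy} f(x1,y1) − ∇²_{xy} f(x2,y2)‖ ≤ L(‖x1−x2‖ + ‖y1−y2‖) and ‖∇²_{yy} f(x1,y1) − ∇²_{yy} f(x2,y2)‖ ≤ L(‖x1−x2‖ + ‖y1−y2‖) for all x1,x2 ∈ ℝ^{d1}, y1,y2 ∈ Y (operator norms). Then y* is differentiable and its derivative is L̂-Lipschitz with L̂ = (L + Lκ)/μ + l(L + Lκ)/μ², i.e., ‖∇y*(x1) − ∇y*(x2)‖ ≤ L̂ ‖x1 − x2‖ for all x1, x2. -/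
open Real
open scoped RealInnerProductSpace

/-- Mixed Hessian block `∇²_{xy} f (x, y)`, as the derivative in `x` of `x' ↦ ∇_y f(x', y)`. -/
noncomputable def hessXY {d1 d2 : ℕ}
    (f : EuclideanSpace ℝ (Fin d1) → EuclideanSpace ℝ (Fin d2) → ℝ)
    (x : EuclideanSpace ℝ (Fin d1)) (y : EuclideanSpace ℝ (Fin d2)) :
    EuclideanSpace ℝ (Fin d1) →L[ℝ] EuclideanSpace ℝ (Fin d2) :=
  fderiv ℝ (fun x' => grady f x' y) x

/-- Dual Hessian block `∇²_{yy} f (x, y)`, as the derivative in `y` of `y' ↦ ∇_y f(x, y')`. -/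
noncomputable def hessYY {d1 d2 : ℕ}
    (f : EuclideanSpace ℝ (Fin d1) → EuclideanSpace ℝ (Fin d2) → ℝ)
    (x : EuclideanSpace ℝ (Fin d1)) (y : EuclideanSpace ℝ (Fin d2)) :
    EuclideanSpace ℝ (Fin d2) →L[ℝ] EuclideanSpace ℝ (Fin d2) :=
  fderiv ℝ (fun y' => grady f x y') y

open Filter Topology

lemma brs_exists_solve {E F : Type*} [NormedAddCommGroup E] [NormedSpace ℝ E]
    [NormedAddCommGroup F] [NormedSpace ℝ F] [FiniteDimensional ℝ F]
    (A : E →L[ℝ] F) (B : F →L[ℝ] F) (μ : ℝ) (hμ : 0 < μ) (hB : ∀ v, μ * ‖v‖ ≤ ‖B v‖) :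
    ∃ D : E →L[ℝ] F, ∀ v, B (D v) = - A v := by
  have hinj : Function.Injective (B : F →ₗ[ℝ] F) := by
    rw [injective_iff_map_eq_zero]
    intro v hv
    have h := hB v
    have hv' : B v = 0 := hv
    rw [hv', norm_zero] at h
    have : ‖v‖ = 0 := le_antisymm (by nlinarith [norm_nonneg v]) (norm_nonneg v)
    exact norm_eq_zero.1 this
  let e := LinearEquiv.ofInjectiveEndo (B : F →ₗ[ℝ] F) hinj
  refine ⟨-((LinearMap.toContinuousLinearMap (e.symm : F →ₗ[ℝ] F)).comp A), fun v => ?_⟩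
  have h : e (e.symm (A v)) = A v := e.apply_symm_apply _
  have h2 : ∀ w, e w = B w := fun w => rfl
  rw [h2] at h
  simp [h]

/-- The derivative of an expanding map is expanding. -/
lemma brs_expand {F : Type*} [NormedAddCommGroup F] [NormedSpace ℝ F]
    (g : F → F) (B : F →L[ℝ] F) (y : F) (μ : ℝ) (hg : HasFDerivAt g B y)
    (h : ∀ᶠ z in 𝓝 y, μ * ‖z - y‖ ≤ ‖g z - g y‖) (v : F) : μ * ‖v‖ ≤ ‖B v‖ := by
  have hl : HasDerivAt (fun t : ℝ => y + t • v) v 0 := by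
    simpa using ((hasDerivAt_id (0 : ℝ)).smul_const v).const_add y
  have hg' : HasFDerivAt g B (y + (0 : ℝ) • v) := by simpa using hg
  have hd := hg'.comp_hasDerivAt (0 : ℝ) hl
  have ht := (hasDerivAt_iff_tendsto_slope.1 hd).norm
  refine ge_of_tendsto ht ?_
  have hc : Tendsto (fun t : ℝ => y + t • v) (𝓝 0) (𝓝 y) := by
    simpa using hl.continuousAt.tendsto
  filter_upwards [(hc.eventually h).filter_mono nhdsWithin_le_nhds, self_mem_nhdsWithin] with t h1 h2
  have h2' : t ≠ 0 := h2
  have htp : 0 < |t| := abs_pos.2 h2'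
  simp only [slope, Function.comp, vsub_eq_sub, sub_zero, zero_smul, add_zero, norm_smul,
    norm_inv, Real.norm_eq_abs]
  rw [add_sub_cancel_left, norm_smul, Real.norm_eq_abs] at h1
  rw [inv_mul_eq_div, le_div_iff₀ htp]
  linarith

lemma brs_grady_contDiff {d1 d2 : ℕ}
    (f : EuclideanSpace ℝ (Fin d1) → EuclideanSpace ℝ (Fin d2) → ℝ)
    (hC2 : ContDiff ℝ 2
      (fun p : EuclideanSpace ℝ (Fin d1) × EuclideanSpace ℝ (Fin d2) => f p.1 p.2)) :
    ContDiff ℝ 1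
      (fun p : EuclideanSpace ℝ (Fin d1) × EuclideanSpace ℝ (Fin d2) => grady f p.1 p.2) := by
  have h : ContDiff ℝ 1 (fun p : EuclideanSpace ℝ (Fin d1) × EuclideanSpace ℝ (Fin d2) =>
      fderiv ℝ (f p.1) p.2) := by
    refine ContDiff.fderiv (n := 1) (m := 2) (f := fun (p : EuclideanSpace ℝ (Fin d1) ×
      EuclideanSpace ℝ (Fin d2)) y => f p.1 y) ?_ contDiff_snd (by norm_num)
    exact hC2.comp ((contDiff_fst.comp contDiff_fst).prodMk contDiff_snd)
  exact (InnerProductSpace.toDual ℝ (EuclideanSpace ℝ (Fin d2))).symm.toContinuousLinearEquiv.contDiff.comp h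

/-- Smoothness of the best response map under second-order Lipschitz continuity
(Lemma 2 of Chen et al.): `y*` is differentiable with `L̂`-Lipschitz derivative, where
`L̂ = (L + Lκ)/μ + l(L + Lκ)/μ²` and `κ := l/μ`. -/
theorem best_response_smooth
    {d1 d2 : ℕ}
    (Y : Set (EuclideanSpace ℝ (Fin d2)))
    (hYne : Y.Nonempty) (hYclosed : IsClosed Y) (hYconv : Convex ℝ Y)
    (f : EuclideanSpace ℝ (Fin d1) → EuclideanSpace ℝ (Fin d2) → ℝ)
    (hC2 : ContDiff ℝ 2
      (fun p : EuclideanSpace ℝ (Fin d1) × EuclideanSpace ℝ (Fin d2) => f p.1 p.2))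
    (l μ L : ℝ) (hμ : 0 < μ) (hμl : μ ≤ l) (hL : 0 < L)
    (hsmooth : ∀ x1 x2 : EuclideanSpace ℝ (Fin d1), ∀ y1 ∈ Y, ∀ y2 ∈ Y,
      max ‖gradx f x1 y1 - gradx f x2 y2‖ ‖grady f x1 y1 - grady f x2 y2‖
        ≤ l * (‖x1 - x2‖ + ‖y1 - y2‖))
    (hconc : ∀ x' : EuclideanSpace ℝ (Fin d1), ∀ y1 ∈ Y, ∀ y2 ∈ Y,
      f x' y2 + ⟪grady f x' y1, y1 - y2⟫ + μ / 2 * ‖y1 - y2‖ ^ 2 ≤ f x' y1)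
    (hhxy : ∀ x1 x2 : EuclideanSpace ℝ (Fin d1), ∀ y1 ∈ Y, ∀ y2 ∈ Y,
      ‖hessXY f x1 y1 - hessXY f x2 y2‖ ≤ L * (‖x1 - x2‖ + ‖y1 - y2‖))
    (hhyy : ∀ x1 x2 : EuclideanSpace ℝ (Fin d1), ∀ y1 ∈ Y, ∀ y2 ∈ Y,
      ‖hessYY f x1 y1 - hessYY f x2 y2‖ ≤ L * (‖x1 - x2‖ + ‖y1 - y2‖))
    (ystar : EuclideanSpace ℝ (Fin d1) → EuclideanSpace ℝ (Fin d2))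
    (hystar : ∀ x', ystar x' ∈ Y ∧ ∀ y' ∈ Y, f x' y' ≤ f x' (ystar x'))
    (hint : ∀ x', ystar x' ∈ interior Y) :
    Differentiable ℝ ystar ∧
      ∀ x1 x2 : EuclideanSpace ℝ (Fin d1),
        ‖fderiv ℝ ystar x1 - fderiv ℝ ystar x2‖
          ≤ ((L + L * (l / μ)) / μ + l * (L + L * (l / μ)) / μ ^ 2) * ‖x1 - x2‖ := by
  have hl : 0 < l := hμ.trans_le hμl
  have hg := brs_grady_contDiff f hC2
  have hgd := hg.differentiable (by norm_num)
  -- first-order condition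
  have hzero : ∀ x, grady f x (ystar x) = 0 := by
    intro x
    have hmax : IsLocalMax (f x) (ystar x) := by
      filter_upwards [mem_interior_iff_mem_nhds.1 (hint x)] with y hy
      exact (hystar x).2 y hy
    simp [grady, gradient, hmax.fderiv_eq_zero]
  -- strong monotonicity
  have hmono : ∀ x, ∀ y1 ∈ Y, ∀ y2 ∈ Y,
      μ * ‖y1 - y2‖ ≤ ‖grady f x y1 - grady f x y2‖ := by
    intro x y1 h1 y2 h2
    have a := hconc x y1 h1 y2 h2
    have b := hconc x y2 h2 y1 h1
    rw [norm_sub_rev y2 y1, ← neg_sub y1 y2, inner_neg_right] at b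
    have c : ⟪grady f x y1 - grady f x y2, y1 - y2⟫ ≤ - (μ * ‖y1 - y2‖ ^ 2) := by
      rw [inner_sub_left]; linarith
    have d := abs_le.1 (abs_real_inner_le_norm (grady f x y1 - grady f x y2) (y1 - y2))
    rcases (norm_nonneg (y1 - y2)).eq_or_lt with h | h
    · rw [← h]; simp
    · have : (μ * ‖y1 - y2‖) * ‖y1 - y2‖ ≤ ‖grady f x y1 - grady f x y2‖ * ‖y1 - y2‖ := by
        nlinarith [d.1]
      exact le_of_mul_le_mul_right this h
  -- Lipschitz continuity of the best response
  have hlip : ∀ x1 x2, ‖ystar x1 - ystar x2‖ ≤ l / μ * ‖x1 - x2‖ := by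
    intro x1 x2
    have a := hmono x1 _ (hystar x1).1 _ (hystar x2).1
    have b := (le_max_right _ _).trans (hsmooth x2 x1 _ (hystar x2).1 _ (hystar x2).1)
    rw [hzero, zero_sub, norm_neg] at a
    rw [hzero, zero_sub, norm_neg, sub_self, norm_zero, add_zero, norm_sub_rev] at b
    rw [div_mul_eq_mul_div, le_div_iff₀ hμ]
    linarith
  -- derivatives of the partial gradient
  have hYY : ∀ x y, HasFDerivAt (fun y' => grady f x y') (hessYY f x y) y := by
    intro x y
    refine DifferentiableAt.hasFDerivAt ?_
    exact (hgd (x, y)).comp y ((differentiableAt_const x).prodMk differentiableAt_id)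
  have hXY : ∀ x y, HasFDerivAt (fun x' => grady f x' y) (hessXY f x y) x := by
    intro x y
    refine DifferentiableAt.hasFDerivAt ?_
    exact DifferentiableAt.comp (g := fun p : EuclideanSpace ℝ (Fin d1) ×
      EuclideanSpace ℝ (Fin d2) => grady f p.1 p.2) (f := fun x' => (x', y)) x (hgd (x, y)) (differentiableAt_id.prodMk (differentiableAt_const y))
  have hB : ∀ x v, μ * ‖v‖ ≤ ‖hessYY f x (ystar x) v‖ := by
    intro x v
    refine brs_expand _ _ _ μ (hYY x (ystar x)) ?_ v
    filter_upwards [mem_interior_iff_mem_nhds.1 (hint x)] with y hy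
    exact hmono x y hy _ (hystar x).1
  have hpart : ∀ x y, ∀ u v,
      fderiv ℝ (fun p : EuclideanSpace ℝ (Fin d1) × EuclideanSpace ℝ (Fin d2) =>
        grady f p.1 p.2) (x, y) (u, v) = hessXY f x y u + hessYY f x y v := by
    intro x y u v
    have hG := (hgd (x, y)).hasFDerivAt
    have h1 := (hXY x y).unique (HasFDerivAt.comp (g := fun p : EuclideanSpace ℝ (Fin d1) ×
      EuclideanSpace ℝ (Fin d2) => grady f p.1 p.2) (f := fun x' => (x', y)) x hG
      (hasFDerivAt_prodMk_left x y))
    have h2 := (hYY x y).unique (hG.comp y (hasFDerivAt_prodMk_right x y))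
    rw [h1, h2]
    simp [← map_add]
  have hD : ∀ x, ∃ D : EuclideanSpace ℝ (Fin d1) →L[ℝ] EuclideanSpace ℝ (Fin d2),
      (∀ v, hessYY f x (ystar x) (D v) = - hessXY f x (ystar x) v) ∧ HasFDerivAt ystar D x := by
    intro x
    obtain ⟨D, hD⟩ := brs_exists_solve (hessXY f x (ystar x)) (hessYY f x (ystar x)) μ hμ (hB x)
    refine ⟨D, hD, ?_⟩
    have hcont : ContinuousAt ystar x := by
      refine (LipschitzWith.of_dist_le_mul (K := ⟨l / μ, by positivity⟩) fun a b => ?_).continuous.continuousAt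
      rw [dist_eq_norm, dist_eq_norm]
      exact hlip a b
    have hG := (hgd (x, ystar x)).hasFDerivAt.isLittleO
    have htend : Tendsto (fun x' => (x', ystar x')) (𝓝 x) (𝓝 (x, ystar x)) :=
      (continuousAt_id.prodMk hcont).tendsto
    have hG2 := hG.comp_tendsto htend
    refine HasFDerivAt.of_isLittleO ?_
    have hbig : (fun x' => (x', ystar x') - (x, ystar x)) =O[𝓝 x] fun x' => x' - x := by
      refine Asymptotics.IsBigO.of_bound (max 1 (l / μ)) (Eventually.of_forall fun x' => ?_)
      rw [Prod.mk_sub_mk, Prod.norm_mk]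
      refine max_le ?_ ((hlip x' x).trans ?_)
      · nlinarith [le_max_left 1 (l / μ), norm_nonneg (x' - x)]
      · exact mul_le_mul_of_nonneg_right (le_max_right _ _) (norm_nonneg _)
    have hG3 := hG2.trans_isBigO hbig
    refine Asymptotics.IsBigO.trans_isLittleO ?_ hG3
    refine Asymptotics.IsBigO.of_bound μ⁻¹ (Eventually.of_forall fun x' => ?_)
    have h := hB x (ystar x' - ystar x - D (x' - x))
    rw [map_sub (hessYY f x (ystar x)), hD] at h
    simp only [Function.comp, hzero, Prod.mk_sub_mk, hpart]
    rw [inv_mul_eq_div, le_div_iff₀ hμ, mul_comm]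
    refine h.trans (le_of_eq ?_)
    rw [← norm_neg]
    congr 1
    abel
  refine ⟨fun x => (hD x).choose_spec.2.differentiableAt, fun x1 x2 => ?_⟩
  obtain ⟨D1, e1, k1⟩ := hD x1
  obtain ⟨D2, e2, k2⟩ := hD x2
  rw [k1.fderiv, k2.fderiv]
  have hκ : 0 ≤ l / μ := by positivity
  have hD2 : ‖D2‖ ≤ l / μ :=
    k2.le_of_lip' hκ (Eventually.of_forall fun z => hlip z x2)
  have hsum : L * (‖x1 - x2‖ + ‖ystar x1 - ystar x2‖) ≤ L * (1 + l / μ) * ‖x1 - x2‖ := by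
    nlinarith [hlip x1 x2]
  have hA := (hhxy x1 x2 _ (hystar x1).1 _ (hystar x2).1).trans hsum
  have hBB := (hhyy x1 x2 _ (hystar x1).1 _ (hystar x2).1).trans hsum
  set c := L * (1 + l / μ) * ‖x1 - x2‖ with hc
  have hc0 : 0 ≤ c := by positivity
  have hfin : ((L + L * (l / μ)) / μ + l * (L + L * (l / μ)) / μ ^ 2) * ‖x1 - x2‖
      = (c + c * (l / μ)) / μ := by
    rw [hc]; field_simp
  rw [hfin]
  refine ContinuousLinearMap.opNorm_le_bound _ (by positivity) fun v => ?_
  have h := hB x1 ((D1 - D2) v)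
  have hid : hessYY f x1 (ystar x1) ((D1 - D2) v)
      = -((hessXY f x1 (ystar x1) - hessXY f x2 (ystar x2)) v)
        - (hessYY f x1 (ystar x1) - hessYY f x2 (ystar x2)) (D2 v) := by
    simp only [sub_apply, map_sub, e1, e2]
    abel
  rw [hid] at h
  have n1 := ContinuousLinearMap.le_of_opNorm_le _ hA v
  have n2 := ContinuousLinearMap.le_of_opNorm_le _ hBB (D2 v)
  have n3 := ContinuousLinearMap.le_of_opNorm_le _ hD2 v
  have n4 := mul_le_mul_of_nonneg_left n3 hc0
  have n5 := norm_sub_le (-((hessXY f x1 (ystar x1) - hessXY f x2 (ystar x2)) v))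
    ((hessYY f x1 (ystar x1) - hessYY f x2 (ystar x2)) (D2 v))
  rw [norm_neg] at n5
  rw [div_mul_eq_mul_div, le_div_iff₀ hμ]
  nlinarith
end

section
/- Self-bounding inequality for sums of fractional powers: Let n ≥ 1, let b_1, ..., b_n be positive reals and α_1, ..., α_n ∈ (0,1). If a real number x ≥ 0 satisfies x ≤ Σ_{i=1}^n b_i x^{α_i}, then x ≤ Σ_{i=1}^n (n b_i)^{1/(1−α_i)}. -/
open Real Finset

/-- Self-bounding inequality for sums of fractional powers: if `x ≥ 0` satisfies
`x ≤ Σ_{i=1}^n b_i x^{α_i}` with `b_i > 0` and `α_i ∈ (0,1)`, then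
`x ≤ Σ_{i=1}^n (n b_i)^{1/(1−α_i)}`. -/
theorem self_bounding_fractional_powers
    (n : ℕ) (hn : 1 ≤ n) (b a : Fin n → ℝ)
    (hb : ∀ i, 0 < b i) (ha : ∀ i, a i ∈ Set.Ioo (0 : ℝ) 1)
    (x : ℝ) (hx : 0 ≤ x) (h : x ≤ ∑ i, b i * x ^ a i) :
    x ≤ ∑ i, ((n : ℝ) * b i) ^ (1 / (1 - a i)) := by
  have hn0 : (0 : ℝ) < n := by exact_mod_cast hn
  have hnn : ∀ i, 0 ≤ ((n : ℝ) * b i) ^ (1 / (1 - a i)) := fun i =>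
    Real.rpow_nonneg (mul_nonneg hn0.le (hb i).le) _
  rcases hx.eq_or_lt with h0 | hpos
  · rw [← h0]
    exact Finset.sum_nonneg fun i _ => hnn i
  haveI : Nonempty (Fin n) := ⟨⟨0, hn⟩⟩
  obtain ⟨i, -, hi⟩ : ∃ i ∈ (Finset.univ : Finset (Fin n)), x / n ≤ b i * x ^ a i := by
    apply Finset.exists_le_of_sum_le Finset.univ_nonempty
    have : ∑ _i : Fin n, x / (n : ℝ) = x := by
      rw [Finset.sum_const, Finset.card_univ, Fintype.card_fin, nsmul_eq_mul]
      field_simp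
    rw [this]
    exact h
  have h1 : 0 < 1 - a i := by linarith [(ha i).2]
  have h2 : x ^ (1 - a i) ≤ n * b i := by
    rw [Real.rpow_sub hpos, Real.rpow_one, div_le_iff₀ (Real.rpow_pos_of_pos hpos _)]
    rw [div_le_iff₀ hn0] at hi
    linarith
  have h3 : x ≤ ((n : ℝ) * b i) ^ (1 / (1 - a i)) := by
    calc x = (x ^ (1 - a i)) ^ (1 / (1 - a i)) := by
          rw [← Real.rpow_mul hx, mul_one_div_cancel h1.ne', Real.rpow_one]
      _ ≤ _ := Real.rpow_le_rpow (Real.rpow_nonneg hx _) h2 (by positivity)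
  exact h3.trans (Finset.single_le_sum (f := fun i => ((n : ℝ) * b i) ^ (1 / (1 - a i)))
    (fun i _ => hnn i) (Finset.mem_univ i))
end

section
/- Counting lemma for large increments of a fractional power of an accumulating sum: Let v_0 > 0, let (a_t)_{t≥0} satisfy 0 ≤ a_t ≤ G² for all t, and define v_{t+1} = v_t + a_t. Let 0 < β < 1 and δ > 0. Then the set of indices t with (v_{t+1})^β − (v_t)^β > δ is finite, with cardinality at most 1 + (β/(δ v_0^{1−β})) · (βG²/δ)^{1/(1−β)}. -/
open Real

/-- Counting lemma for large increments of a fractional power of an accumulating sum: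
if `v_0 > 0`, `0 ≤ a_t ≤ G²` and `v_{t+1} = v_t + a_t`, `0 < β < 1`, `δ > 0`, then the set
of indices `t` with `(v_{t+1})^β − (v_t)^β > δ` is finite with cardinality at most
`1 + (β/(δ v_0^{1−β})) (βG²/δ)^{1/(1−β)}`. -/
theorem count_large_rpow_increments
    (G : ℝ) (hG : 0 < G) (v a : ℕ → ℝ) (hv0 : 0 < v 0)
    (ha : ∀ t, 0 ≤ a t ∧ a t ≤ G ^ 2)
    (hv : ∀ t, v (t + 1) = v t + a t)
    (β δ : ℝ) (hβ0 : 0 < β) (hβ1 : β < 1) (hδ : 0 < δ) :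
    {t : ℕ | δ < (v (t + 1)) ^ β - (v t) ^ β}.Finite ∧
      (Nat.card {t : ℕ | δ < (v (t + 1)) ^ β - (v t) ^ β} : ℝ)
        ≤ 1 + (β / (δ * (v 0) ^ (1 - β))) * (β * G ^ 2 / δ) ^ (1 / (1 - β)) := by
  have hsum : ∀ n, v n = v 0 + ∑ t ∈ Finset.range n, a t := by
    intro n
    induction n with
    | zero => simp
    | succ k ih => rw [hv, ih, Finset.sum_range_succ]; ring
  have hge : ∀ n, v 0 ≤ v n := by
    intro n
    rw [hsum n]
    have := Finset.sum_nonneg (s := Finset.range n) (f := a) (fun t _ => (ha t).1)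
    linarith
  have hvpos : ∀ n, 0 < v n := fun n => lt_of_lt_of_le hv0 (hge n)
  have hb1 : 0 < 1 - β := by linarith
  have hkey : ∀ t, δ < (v (t + 1)) ^ β - (v t) ^ β → δ * (v t) ^ (1 - β) < β * a t := by
    intro t ht
    have hp := hvpos t
    have hx : 0 ≤ a t / v t := div_nonneg (ha t).1 hp.le
    have hB := rpow_one_add_le_one_add_mul_self (s := a t / v t) (by linarith) hβ0.le hβ1.le
    have hfac : v (t + 1) = v t * (1 + a t / v t) := by
      rw [hv]; field_simp
    rw [hfac, Real.mul_rpow hp.le (by linarith)] at ht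
    have hP : 0 < v t ^ β := Real.rpow_pos_of_pos hp _
    have hQ : 0 < v t ^ (1 - β) := Real.rpow_pos_of_pos hp _
    have hPQ : v t ^ β * v t ^ (1 - β) = v t := by
      rw [← Real.rpow_add hp]; simp
    have h1 : δ < v t ^ β * (β * (a t / v t)) := by
      have := mul_le_mul_of_nonneg_left hB hP.le
      linarith
    have h2 := mul_lt_mul_of_pos_right h1 hQ
    have h3 : v t ^ β * (β * (a t / v t)) * v t ^ (1 - β) = β * a t := by
      calc _ = (v t ^ β * v t ^ (1 - β)) * (β * (a t / v t)) := by ring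
        _ = β * a t := by rw [hPQ]; field_simp
    linarith
  set M := (β * G ^ 2 / δ) ^ (1 / (1 - β)) with hM
  set q := (v 0) ^ (1 - β) with hq
  have hqpos : 0 < q := Real.rpow_pos_of_pos hv0 _
  have hMpos : 0 < M := Real.rpow_pos_of_pos (by positivity) _
  have hA : ∀ t, δ < (v (t + 1)) ^ β - (v t) ^ β → δ * q / β ≤ a t := by
    intro t ht
    have h1 := hkey t ht
    have h2 : q ≤ v t ^ (1 - β) := Real.rpow_le_rpow hv0.le (hge t) hb1.le
    rw [div_le_iff₀ hβ0]
    nlinarith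
  have hV : ∀ t, δ < (v (t + 1)) ^ β - (v t) ^ β → v t ≤ M := by
    intro t ht
    have h1 := hkey t ht
    have h2 : v t ^ (1 - β) ≤ β * G ^ 2 / δ := by
      rw [le_div_iff₀ hδ]
      nlinarith [(ha t).2]
    have h3 := Real.rpow_le_rpow (Real.rpow_nonneg (hvpos t).le _) h2
      (by positivity : 0 ≤ 1 / (1 - β))
    rwa [← Real.rpow_mul (hvpos t).le, mul_one_div_cancel hb1.ne', Real.rpow_one] at h3
  have hF : ∀ F : Finset ℕ, (↑F : Set ℕ) ⊆ {t : ℕ | δ < (v (t + 1)) ^ β - (v t) ^ β} →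
      (F.card : ℝ) ≤ 1 + (β / (δ * q)) * M := by
    intro F hF
    rcases F.eq_empty_or_nonempty with rfl | hne
    · simp only [Finset.card_empty, Nat.cast_zero]; positivity
    · have hm := F.max'_mem hne
      set m := F.max' hne
      have hsub : F.erase m ⊆ Finset.range m := by
        intro t ht
        rw [Finset.mem_range]
        exact lt_of_le_of_ne (F.le_max' t (Finset.mem_of_mem_erase ht)) (Finset.ne_of_mem_erase ht)
      have h1 : ∑ t ∈ F.erase m, a t ≤ ∑ t ∈ Finset.range m, a t :=
        Finset.sum_le_sum_of_subset_of_nonneg hsub (fun t _ _ => (ha t).1)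
      have h2 : (F.erase m).card • (δ * q / β) ≤ ∑ t ∈ F.erase m, a t :=
        Finset.card_nsmul_le_sum _ _ _ (fun t ht => hA t (hF (Finset.mem_of_mem_erase ht)))
      have h3 := hV m (hF hm)
      rw [hsum m] at h3
      have h4 : ((F.erase m).card : ℝ) + 1 = F.card := by
        exact_mod_cast Finset.card_erase_add_one hm
      rw [nsmul_eq_mul] at h2
      have h5 : ((F.erase m).card : ℝ) * (δ * q / β) ≤ M := by linarith
      have h6 : ((F.erase m).card : ℝ) ≤ M / (δ * q / β) := by
        rwa [le_div_iff₀ (by positivity)]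
      have h7 : M / (δ * q / β) = (β / (δ * q)) * M := by field_simp
      linarith
  have hfin : {t : ℕ | δ < (v (t + 1)) ^ β - (v t) ^ β}.Finite := by
    by_contra hinf
    obtain ⟨n, hn⟩ := exists_nat_gt (1 + (β / (δ * q)) * M)
    obtain ⟨F, hFs, hFc⟩ := Set.Infinite.exists_subset_card_eq hinf n
    have := hF F hFs
    rw [hFc] at this
    linarith
  refine ⟨hfin, ?_⟩
  have h := hF hfin.toFinset (by simp)
  rwa [← Nat.card_eq_card_finite_toFinset hfin] at h
end

section
/- Pathwise distance recursion under a smooth best-response map (core of Lemma C.3): Suppose y* : ℝ^{d1} → ℝ^{d2} is differentiable, κ-Lipschitz, and its derivative ∇y* is L̂-Lipschitz and satisfies ‖∇y*(x)‖ ≤ κ for all x (operator norm). Let x ∈ ℝ^{d1}, η > 0, g ∈ ℝ^{d1} with ‖g‖ ≤ G, and set x' := x − η g. Then for every u ∈ ℝ^{d2}, every h ∈ ℝ^{d1}, and every λ > 0, τ > 0: ‖u − y*(x')‖² ≤ (1 + λ + τ L̂ G² η²/2) ‖u − y*(x)‖² + (κ² + L̂/(2τ)) η² ‖g‖² + (κ²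 η²/λ) ‖h‖² + 2η ⟨u − y*(x), ∇y*(x)(g − h)⟩. -/
open Real
open scoped RealInnerProductSpace

theorem taylor_aux {E F : Type*} [NormedAddCommGroup E] [NormedSpace ℝ E]
    [NormedAddCommGroup F] [NormedSpace ℝ F] (y : E → F) (L : ℝ)
    (hd : Differentiable ℝ y)
    (hL : ∀ x1 x2, ‖fderiv ℝ y x1 - fderiv ℝ y x2‖ ≤ L * ‖x1 - x2‖) (x p : E) :
    ‖y (x + p) - y x - fderiv ℝ y x p‖ ≤ L * ‖p‖ ^ 2 / 2 := by
  have hf : ∀ t : ℝ, HasDerivAt (fun t : ℝ => y (x + t • p) - y x - t • fderiv ℝ y x p)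
      (fderiv ℝ y (x + t • p) p - fderiv ℝ y x p) t := by
    intro t
    have h1 : HasDerivAt (fun t : ℝ => x + t • p) p t := by
      simpa using ((hasDerivAt_id t).smul_const p).const_add x
    have h2 := (hd (x + t • p)).hasFDerivAt.comp_hasDerivAt t h1
    have h3 : HasDerivAt (fun t : ℝ => t • fderiv ℝ y x p) (fderiv ℝ y x p) t := by
      simpa using (hasDerivAt_id t).smul_const (fderiv ℝ y x p)
    exact (h2.sub_const (y x)).sub h3
  have hB : ∀ t : ℝ, HasDerivAt (fun t : ℝ => L * ‖p‖ ^ 2 / 2 * t ^ 2) (L * ‖p‖ ^ 2 * t) t := by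
    intro t
    refine ((hasDerivAt_pow 2 t).const_mul (L * ‖p‖ ^ 2 / 2)).congr_deriv ?_
    push_cast; ring
  have key := image_norm_le_of_norm_deriv_right_le_deriv_boundary (a := 0) (b := 1)
    (fun t _ => (hf t).continuousAt.continuousWithinAt)
    (fun t _ => (hf t).hasDerivWithinAt) (by simp) hB (fun t ht => by
      rw [← sub_apply]
      refine (ContinuousLinearMap.le_opNorm _ _).trans ?_
      have := hL (x + t • p) x
      rw [add_sub_cancel_left, norm_smul, Real.norm_of_nonneg ht.1] at this
      calc _ ≤ (L * (t * ‖p‖)) * ‖p‖ := by gcongr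
        _ = _ := by ring) (Set.right_mem_Icc.2 zero_le_one)
  simpa using key

/-- Pathwise distance recursion under a smooth best-response map
(core of Lemma C.3). -/
theorem moving_target_distance_recursion
    {d1 d2 : ℕ}
    (ystar : EuclideanSpace ℝ (Fin d1) → EuclideanSpace ℝ (Fin d2))
    (κ Lhat G : ℝ) (hκ : 0 < κ) (hLhat : 0 < Lhat) (hG : 0 < G)
    (hdiff : Differentiable ℝ ystar)
    (hlip : ∀ x1 x2, ‖ystar x1 - ystar x2‖ ≤ κ * ‖x1 - x2‖)
    (hdlip : ∀ x1 x2, ‖fderiv ℝ ystar x1 - fderiv ℝ ystar x2‖ ≤ Lhat * ‖x1 - x2‖)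
    (hdbd : ∀ x, ‖fderiv ℝ ystar x‖ ≤ κ)
    (x : EuclideanSpace ℝ (Fin d1)) (η : ℝ) (hη : 0 < η)
    (g : EuclideanSpace ℝ (Fin d1)) (hg : ‖g‖ ≤ G) :
    ∀ (u : EuclideanSpace ℝ (Fin d2)) (h : EuclideanSpace ℝ (Fin d1)) (lam τ : ℝ),
      0 < lam → 0 < τ →
      ‖u - ystar (x - η • g)‖ ^ 2
        ≤ (1 + lam + τ * Lhat * G ^ 2 * η ^ 2 / 2) * ‖u - ystar x‖ ^ 2
          + (κ ^ 2 + Lhat / (2 * τ)) * η ^ 2 * ‖g‖ ^ 2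
          + (κ ^ 2 * η ^ 2 / lam) * ‖h‖ ^ 2
          + 2 * η * ⟪u - ystar x, (fderiv ℝ ystar x) (g - h)⟫ := by
  intro u h lam τ hlam hτ
  have hT := taylor_aux ystar Lhat hdiff hdlip x (-(η • g))
  rw [← sub_eq_add_neg, norm_neg, norm_smul, Real.norm_of_nonneg hη.le] at hT
  have hl := hlip x (x - η • g)
  rw [sub_sub_cancel, norm_smul, Real.norm_of_nonneg hη.le] at hl
  set D := fderiv ℝ ystar x with hD
  set r := ystar (x - η • g) - ystar x - D (-(η • g)) with hr
  set v := u - ystar x with hv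
  have e1 : u - ystar (x - η • g) = v + (ystar x - ystar (x - η • g)) := by
    rw [hv]; abel
  have e2 : ystar x - ystar (x - η • g) = η • D (g - h) + η • D h - r := by
    rw [hr, map_neg, map_smul, map_sub, smul_sub]; abel
  have e3 : ⟪v, ystar x - ystar (x - η • g)⟫ = η * ⟪v, D (g - h)⟫ + η * ⟪v, D h⟫ - ⟪v, r⟫ := by
    rw [e2, inner_sub_right, inner_add_right, inner_smul_right, inner_smul_right]
  have i1 : ⟪v, D h⟫ ≤ ‖v‖ * (κ * ‖h‖) :=
    (real_inner_le_norm _ _).trans (by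
      gcongr
      exact (D.le_opNorm h).trans (by gcongr; exact hdbd x))
  have i2 : -⟪v, r⟫ ≤ ‖v‖ * (Lhat * (η * ‖g‖) ^ 2 / 2) := by
    have := abs_real_inner_le_norm v r
    have h2 := neg_le_abs ⟪v, r⟫
    have h3 : ‖v‖ * ‖r‖ ≤ ‖v‖ * (Lhat * (η * ‖g‖) ^ 2 / 2) := by gcongr
    linarith
  have i3 : ‖ystar x - ystar (x - η • g)‖ ^ 2 ≤ (κ * (η * ‖g‖)) ^ 2 := by gcongr
  have y1 : 2 * (η * (‖v‖ * (κ * ‖h‖))) ≤ lam * ‖v‖ ^ 2 + κ ^ 2 * η ^ 2 / lam * ‖h‖ ^ 2 := by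
    have : lam * ‖v‖ ^ 2 + κ ^ 2 * η ^ 2 / lam * ‖h‖ ^ 2 - 2 * (η * (‖v‖ * (κ * ‖h‖)))
        = (lam * ‖v‖ - κ * η * ‖h‖) ^ 2 / lam := by field_simp; ring
    have h2 : 0 ≤ (lam * ‖v‖ - κ * η * ‖h‖) ^ 2 / lam := by positivity
    linarith
  have y2 : 2 * (‖v‖ * (Lhat * (η * ‖g‖) ^ 2 / 2)) ≤
      τ * Lhat * G ^ 2 * η ^ 2 / 2 * ‖v‖ ^ 2 + Lhat / (2 * τ) * η ^ 2 * ‖g‖ ^ 2 := by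
    have h1 : 2 * (‖v‖ * (Lhat * (η * ‖g‖) ^ 2 / 2)) ≤ Lhat * η ^ 2 * ‖v‖ * ‖g‖ * G := by
      calc _ = Lhat * η ^ 2 * ‖v‖ * ‖g‖ * ‖g‖ := by ring
        _ ≤ _ := by gcongr
    have : τ * Lhat * G ^ 2 * η ^ 2 / 2 * ‖v‖ ^ 2 + Lhat / (2 * τ) * η ^ 2 * ‖g‖ ^ 2
        - Lhat * η ^ 2 * ‖v‖ * ‖g‖ * G
        = Lhat * η ^ 2 * (τ * G * ‖v‖ - ‖g‖) ^ 2 / (2 * τ) := by field_simp; ring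
    have h2 : 0 ≤ Lhat * η ^ 2 * (τ * G * ‖v‖ - ‖g‖) ^ 2 / (2 * τ) := by positivity
    linarith
  rw [e1, norm_add_sq_real, e3]
  have i1' := mul_le_mul_of_nonneg_left i1 hη.le
  linarith
end

section
/- Convergence of stochastic TiAda without the max coupling (Theorem D.1): Consider the variant of stochastic TiAda in which the primal update uses η_t = η^x/(v^x_{t+1})^α instead of η^x/max(v^x_{t+1}, v^y_{t+1})^α. Under the stated assumptions (f l-smooth, μ-strongly concave in y on Y, each maximizer y*(x) in the interior of Y, Φ(x) ≤ Φ_max for all x and Φ bounded below, stochastic gradients unbiased and bounded by G almost surely), there exists a constant C not depending on T such that for every T ≥ 1, both (1/T) E[Σ_{t=0}^{T-1} ‖∇_x f(x_t,y_t)‖²] and (1/T) E[Σ_{t=0}^{T-1} ‖∇_y f(x_t,y_t)‖²] are at most C (1 + log(1+T)) (T^{α−1} + T^{−α} + T^{−β} + T^{−1} + T^{2β−1} + T^{2β−2α}). -/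
open Real Finset MeasureTheory
open scoped RealInnerProductSpace

lemma aux_sum_div_rpow (v0 G p : ℝ) (hv0 : 0 < v0) :
    ∃ C : ℝ, 0 ≤ C ∧ ∀ (v a : ℕ → ℝ), v 0 = v0 → (∀ t, 0 ≤ a t) → (∀ t, a t ≤ G ^ 2) →
      (∀ t, v (t + 1) = v t + a t) → ∀ T : ℕ, 1 ≤ T →
      ∑ t ∈ range T, a t / (v (t + 1)) ^ p
        ≤ C * ((1 + Real.log (1 + (T : ℝ))) * (1 + (T : ℝ) ^ (1 - p))) := by
  set K := v0 ^ (1 - p) + (v0 + G ^ 2) ^ (1 - p) with hK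
  have hK0 : 0 ≤ K := by positivity
  set c := Real.log (1 + G ^ 2 / v0) with hc
  have hc0 : 0 ≤ c := Real.log_nonneg (by have : 0 ≤ G ^ 2 / v0 := by positivity
                                          linarith)
  refine ⟨K * (1 + c), by positivity, ?_⟩
  intro v a hv ha haG hrec T hT
  have hlow : ∀ t, v0 ≤ v t := by
    intro t
    induction t with
    | zero => exact hv.ge
    | succ k ih => rw [hrec]; linarith [ha k]
  have hup : ∀ t : ℕ, v t ≤ v0 + G ^ 2 * t := by
    intro t
    induction t with
    | zero => simp [hv]
    | succ k ih => rw [hrec]; push_cast; linarith [haG k]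
  have hT1 : (1 : ℝ) ≤ T := by exact_mod_cast hT
  have hTp : 0 < (T : ℝ) ^ (1 - p) := by positivity
  have hstep : ∀ t ∈ range T, a t / (v (t + 1)) ^ p
      ≤ (Real.log (v (t + 1)) - Real.log (v t)) * (K * (1 + (T : ℝ) ^ (1 - p))) := by
    intro t ht
    have hvt : 0 < v t := hv0.trans_le (hlow t)
    have hvt1 : 0 < v (t + 1) := hv0.trans_le (hlow _)
    have h1 : a t / (v (t + 1)) ^ p = a t / v (t + 1) * (v (t + 1)) ^ (1 - p) := by
      rw [Real.rpow_sub hvt1, Real.rpow_one]; field_simp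
    have h2 : a t / v (t + 1) ≤ Real.log (v (t + 1)) - Real.log (v t) := by
      have := Real.log_le_sub_one_of_pos (div_pos hvt hvt1)
      rw [Real.log_div hvt.ne' hvt1.ne'] at this
      have h3 : v t / v (t + 1) - 1 = - (a t / v (t + 1)) := by
        field_simp; rw [hrec]; ring
      linarith
    have htT : ((t + 1 : ℕ) : ℝ) ≤ T := by
      exact_mod_cast (Finset.mem_range.mp ht)
    have hvT : v (t + 1) ≤ (v0 + G ^ 2) * T := by
      have := hup (t + 1)
      nlinarith [sq_nonneg G]
    have h3 : (v (t + 1)) ^ (1 - p) ≤ K * (1 + (T : ℝ) ^ (1 - p)) := by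
      have e1 : 0 ≤ v0 ^ (1 - p) := by positivity
      have e2 : 0 ≤ (v0 + G ^ 2) ^ (1 - p) := by positivity
      rcases le_total 0 (1 - p) with hp | hp
      · calc (v (t + 1)) ^ (1 - p) ≤ ((v0 + G ^ 2) * T) ^ (1 - p) :=
              Real.rpow_le_rpow hvt1.le hvT hp
          _ = (v0 + G ^ 2) ^ (1 - p) * (T : ℝ) ^ (1 - p) :=
              Real.mul_rpow (by positivity) (by positivity)
          _ ≤ _ := by rw [hK]; nlinarith
      · calc (v (t + 1)) ^ (1 - p) ≤ v0 ^ (1 - p) :=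
              Real.rpow_le_rpow_of_nonpos hv0 (hlow _) hp
          _ ≤ _ := by rw [hK]; nlinarith
    rw [h1]
    have : 0 ≤ a t / v (t + 1) := div_nonneg (ha t) hvt1.le
    exact mul_le_mul h2 h3 (by positivity) (this.trans h2)
  refine (Finset.sum_le_sum hstep).trans ?_
  rw [← Finset.sum_mul, Finset.sum_range_sub (fun t => Real.log (v t))]
  have hlog : Real.log (v T) - Real.log (v 0) ≤ Real.log (1 + T) + c := by
    rw [hv, ← Real.log_div (hv0.trans_le (hlow T)).ne' hv0.ne', hc,
      ← Real.log_mul (by positivity) (by positivity)]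
    apply Real.log_le_log (div_pos (hv0.trans_le (hlow T)) hv0)
    rw [div_le_iff₀ hv0]
    have := hup T
    have h4 : (1 + (T : ℝ)) * (1 + G ^ 2 / v0) * v0 = (1 + T) * (v0 + G ^ 2) := by field_simp
    rw [h4]
    nlinarith [sq_nonneg G]
  have hl0 : 0 ≤ Real.log (1 + (T : ℝ)) := Real.log_nonneg (by linarith)
  have : Real.log (v T) - Real.log (v 0) ≤ (1 + c) * (1 + Real.log (1 + T)) := by
    nlinarith [mul_nonneg hc0 hl0]
  calc _ ≤ ((1 + c) * (1 + Real.log (1 + T))) * (K * (1 + (T : ℝ) ^ (1 - p))) := by gcongr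
    _ = _ := by ring

lemma aux_v_bounds (v0 G : ℝ) (hv0 : 0 < v0) (v a : ℕ → ℝ) (hv : v 0 = v0)
    (ha : ∀ t, 0 ≤ a t) (haG : ∀ t, a t ≤ G ^ 2) (hrec : ∀ t, v (t + 1) = v t + a t) :
    (∀ t, v0 ≤ v t) ∧ Monotone v ∧ ∀ T : ℕ, 1 ≤ T → ∀ t ≤ T, v t ≤ (v0 + G ^ 2) * T := by
  have hlow : ∀ t, v0 ≤ v t := by
    intro t
    induction t with
    | zero => exact hv.ge
    | succ k ih => rw [hrec]; linarith [ha k]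
  have hup : ∀ t : ℕ, v t ≤ v0 + G ^ 2 * t := by
    intro t
    induction t with
    | zero => simp [hv]
    | succ k ih => rw [hrec]; push_cast; linarith [haG k]
  refine ⟨hlow, monotone_nat_of_le_succ fun t => by rw [hrec]; linarith [ha t], ?_⟩
  intro T hT t ht
  have hT1 : (1 : ℝ) ≤ T := by exact_mod_cast hT
  have htT : (t : ℝ) ≤ T := by exact_mod_cast ht
  have := hup t
  nlinarith [sq_nonneg G]

lemma aux_telescope (w D : ℕ → ℝ) (M : ℝ) (hw0 : ∀ t, 0 ≤ w t) (hw : Monotone w)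
    (hD0 : ∀ t, 0 ≤ D t) (hDM : ∀ t, D t ≤ M) (T : ℕ) (hT : 1 ≤ T) :
    ∑ t ∈ range T, w t * (D t - D (t + 1)) ≤ M * w (T - 1) := by
  obtain ⟨n, rfl⟩ : ∃ n, T = n + 1 := ⟨T - 1, by omega⟩
  have key : ∀ n : ℕ, ∑ t ∈ range (n + 1), w t * (D t - D (t + 1))
      ≤ M * w n - w n * D (n + 1) := by
    intro n
    induction n with
    | zero => simp; nlinarith [hw0 0, hDM 0]
    | succ k ih =>
      rw [Finset.sum_range_succ]
      have h1 := hw (Nat.le_succ k)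
      have h2 := hDM (k + 1)
      simp only [Nat.succ_eq_add_one] at h1
      nlinarith
  have := key n
  have h2 := mul_nonneg (hw0 n) (hD0 (n + 1))
  simp only [Nat.add_sub_cancel]
  linarith

lemma aux_proj {E : Type*} [NormedAddCommGroup E] [InnerProductSpace ℝ E] (Y : Set E)
    (hYconv : Convex ℝ Y) (P : E → E)
    (hP : ∀ z, P z ∈ Y ∧ ∀ w ∈ Y, ‖P z - z‖ ≤ ‖w - z‖) (z w : E) (hw : w ∈ Y) :
    ‖P z - w‖ ^ 2 ≤ ‖z - w‖ ^ 2 := by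
  obtain ⟨h1, h2⟩ := hP z
  have : Nonempty Y := ⟨⟨_, h1⟩⟩
  have h3 : ‖z - P z‖ = ⨅ w : Y, ‖z - w‖ := by
    apply le_antisymm
    · apply le_ciInf
      intro w
      rw [norm_sub_rev, norm_sub_rev z]
      exact h2 w w.2
    · exact ciInf_le ⟨0, by rintro _ ⟨w, rfl⟩; positivity⟩ (⟨P z, h1⟩ : Y)
  have h4 := (norm_eq_iInf_iff_real_inner_le_zero hYconv h1).1 h3 w hw
  have h5 : z - w = (z - P z) - (w - P z) := by abel
  rw [norm_sub_rev (P z) w, h5, norm_sub_sq_real (z - P z)]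
  nlinarith [sq_nonneg ‖z - P z‖]

lemma aux_condExp {Ω E : Type*} [NormedAddCommGroup E] [InnerProductSpace ℝ E] [CompleteSpace E]
    {m m0 : MeasurableSpace Ω} (hm : m ≤ m0) (μP : Measure Ω) [IsProbabilityMeasure μP]
    (h g g' : Ω → E) (c G : ℝ) (hh : StronglyMeasurable[m] h)
    (hhc : ∀ᵐ ω ∂μP, ‖h ω‖ ≤ c) (hg : AEStronglyMeasurable g μP)
    (hgG : ∀ᵐ ω ∂μP, ‖g ω‖ ≤ G) (hgg : μP[g|m] =ᵐ[μP] g') :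
    Integrable (fun ω => ⟪h ω, g ω⟫) μP ∧ Integrable (fun ω => ⟪h ω, g' ω⟫) μP ∧
      ∫ ω, ⟪h ω, g ω⟫ ∂μP = ∫ ω, ⟪h ω, g' ω⟫ ∂μP := by
  have hgi : Integrable g μP := Integrable.of_bound hg G hgG
  have hi : Integrable (fun ω => ⟪h ω, g ω⟫) μP := by
    refine Integrable.of_bound ((hh.mono hm).aestronglyMeasurable.inner hg) (c * G) ?_
    filter_upwards [hhc, hgG] with ω h1 h2
    exact (norm_inner_le_norm _ _).trans
      (mul_le_mul h1 h2 (norm_nonneg _) ((norm_nonneg _).trans h1))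
  have key := condExp_bilin_of_stronglyMeasurable_left (μ := μP) (innerSL ℝ (E := E)) hh hi hgi
  have key2 : μP[fun ω => ⟪h ω, g ω⟫|m] =ᵐ[μP] fun ω => ⟪h ω, g' ω⟫ := by
    refine key.trans ?_
    filter_upwards [hgg] with ω h1
    rw [h1]; rfl
  refine ⟨hi, integrable_condExp.congr key2, ?_⟩
  rw [← integral_condExp hm, integral_congr_ae key2]

lemma aux_condExp_bound {Ω E : Type*} [NormedAddCommGroup E] [InnerProductSpace ℝ E]
    [CompleteSpace E]
    {m m0 : MeasurableSpace Ω} (hm : m ≤ m0) (μP : Measure Ω) [IsProbabilityMeasure μP]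
    (g g' : Ω → E) (G : ℝ) (hgi : Integrable g μP)
    (hgG : ∀ᵐ ω ∂μP, ‖g ω‖ ≤ G) (hgg : μP[g|m] =ᵐ[μP] g') :
    AEStronglyMeasurable g' μP ∧ ∀ᵐ ω ∂μP, ‖g' ω‖ ≤ G := by
  refine ⟨(integrable_condExp.congr hgg).aestronglyMeasurable, ?_⟩
  have h1 := norm_condExp_le (μ := μP) (m := m) g
  have h2 : μP[(fun ω => ‖g ω‖)|m] ≤ᵐ[μP] μP[(fun _ => G)|m] := by
    refine condExp_mono hgi.norm (integrable_const _) hgG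
  rw [condExp_const hm] at h2
  filter_upwards [h1, h2, hgg] with ω e1 e2 e3
  rw [← e3]
  exact e1.trans e2
lemma aux_ystep {E : Type*} [NormedAddCommGroup E] [InnerProductSpace ℝ E]
    (y ys ys' y1 g : E) (γ Γ μ : ℝ) (hγ : 0 < γ) (hΓ : γ ≤ Γ) (hμ : 0 < μ)
    (h : ‖y1 - ys‖ ^ 2 ≤ ‖y + γ • g - ys‖ ^ 2) :
    0 ≤ (1 / γ) * (‖y - ys‖ ^ 2 - ‖y1 - ys'‖ ^ 2) + 2 * ⟪y - ys, g⟫ + μ * ‖y - ys‖ ^ 2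
      + (1 + μ * Γ) * (γ * ‖g‖ ^ 2)
      + (1 / γ + 2 / μ * (1 / γ) ^ 2) * ‖ys - ys'‖ ^ 2 := by
  have hN : ‖y + γ • g - ys‖ ^ 2
      = ‖y - ys‖ ^ 2 + 2 * γ * ⟪y - ys, g⟫ + γ ^ 2 * ‖g‖ ^ 2 := by
    have : y + γ • g - ys = (y - ys) + γ • g := by abel
    rw [this, norm_add_sq_real, real_inner_smul_right, norm_smul, Real.norm_eq_abs, mul_pow,
      sq_abs]
    ring
  rw [hN] at h
  have hCS := abs_real_inner_le_norm (y - ys) g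
  have hI := (abs_le.1 hCS).2
  have htri : ‖y1 - ys'‖ ≤ ‖y1 - ys‖ + ‖ys - ys'‖ := norm_sub_le_norm_sub_add_norm_sub _ _ _
  set A := ‖y1 - ys‖
  set B := ‖ys - ys'‖
  set H := ‖y - ys‖
  set I := ⟪y - ys, g⟫
  set g2 := ‖g‖
  have hA : 0 ≤ A := norm_nonneg _
  have hB : 0 ≤ B := norm_nonneg _
  have hH : 0 ≤ H := norm_nonneg _
  have hg : 0 ≤ g2 := norm_nonneg _
  set w := 1 / γ with hw
  have hw0 : 0 < w := by positivity
  have hwγ : w * γ = 1 := by rw [hw]; field_simp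
  have hsq : ‖y1 - ys'‖ ^ 2 ≤ (A + B) ^ 2 := by gcongr
  have hm : μ * (1 / μ) = 1 := by field_simp
  have h2m : 2 / μ = 2 * (1 / μ) := by ring
  have hy : w * (2 * A * B) ≤ μ / 2 * A ^ 2 + 2 / μ * w ^ 2 * B ^ 2 := by
    have := sq_nonneg (μ * A - 2 * w * B)
    have h3 : 0 ≤ (μ * A - 2 * w * B) ^ 2 / (2 * μ) := by positivity
    have h4 : (μ * A - 2 * w * B) ^ 2 / (2 * μ)
      = μ / 2 * A ^ 2 + 2 / μ * w ^ 2 * B ^ 2 - w * (2 * A * B) := by field_simp; ring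
    linarith
  have hA2 : w * A ^ 2 ≤ w * H ^ 2 + 2 * I + γ * g2 ^ 2 := by
    have := mul_le_mul_of_nonneg_left h hw0.le
    have e : w * (H ^ 2 + 2 * γ * I + γ ^ 2 * g2 ^ 2)
      = w * H ^ 2 + 2 * (w * γ) * I + (w * γ) * γ * g2 ^ 2 := by ring
    rw [e, hwγ] at this
    linarith
  have hA3 : A ^ 2 ≤ 2 * H ^ 2 + 2 * γ ^ 2 * g2 ^ 2 := by
    nlinarith [sq_nonneg (H - γ * g2), mul_le_mul_of_nonneg_left hI hγ.le]
  have hA4 : μ / 2 * A ^ 2 ≤ μ * H ^ 2 + μ * Γ * (γ * g2 ^ 2) := by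
    have e1 := mul_le_mul_of_nonneg_left hA3 (by positivity : 0 ≤ μ / 2)
    have e2 : μ * (γ * g2 ^ 2) * γ ≤ μ * (γ * g2 ^ 2) * Γ :=
      mul_le_mul_of_nonneg_left hΓ (by positivity)
    nlinarith
  have := mul_le_mul_of_nonneg_left hsq hw0.le
  nlinarith

lemma aux_grady_ystar {d1 d2 : ℕ} (Y : Set (EuclideanSpace ℝ (Fin d2)))
    (f : EuclideanSpace ℝ (Fin d1) → EuclideanSpace ℝ (Fin d2) → ℝ)
    (ystar : EuclideanSpace ℝ (Fin d1) → EuclideanSpace ℝ (Fin d2))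
    (hystar : ∀ x', ystar x' ∈ Y ∧ ∀ y' ∈ Y, f x' y' ≤ f x' (ystar x'))
    (hint : ∀ x', ystar x' ∈ interior Y)
    (x' : EuclideanSpace ℝ (Fin d1)) : grady f x' (ystar x') = 0 := by
  have hloc : IsLocalMax (f x') (ystar x') := by
    have : Y ∈ nhds (ystar x') := mem_interior_iff_mem_nhds.1 (hint x')
    filter_upwards [this] with z hz using (hystar x').2 z hz
  unfold grady gradient
  rw [hloc.fderiv_eq_zero]; simp

lemma aux_mono {d1 d2 : ℕ} (Y : Set (EuclideanSpace ℝ (Fin d2)))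
    (f : EuclideanSpace ℝ (Fin d1) → EuclideanSpace ℝ (Fin d2) → ℝ)
    (μ : ℝ)
    (hconc : ∀ x' : EuclideanSpace ℝ (Fin d1), ∀ y1 ∈ Y, ∀ y2 ∈ Y,
      f x' y2 + ⟪grady f x' y1, y1 - y2⟫ + μ / 2 * ‖y1 - y2‖ ^ 2 ≤ f x' y1)
    (ystar : EuclideanSpace ℝ (Fin d1) → EuclideanSpace ℝ (Fin d2))
    (hystar : ∀ x', ystar x' ∈ Y ∧ ∀ y' ∈ Y, f x' y' ≤ f x' (ystar x'))
    (hint : ∀ x', ystar x' ∈ interior Y)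
    (x' : EuclideanSpace ℝ (Fin d1)) (y : EuclideanSpace ℝ (Fin d2)) (hy : y ∈ Y) :
    ⟪y - ystar x', grady f x' y⟫ ≤ - (μ * ‖y - ystar x'‖ ^ 2) := by
  have h1 := hconc x' y hy (ystar x') (hystar x').1
  have h2 := hconc x' (ystar x') (hystar x').1 y hy
  rw [aux_grady_ystar Y f ystar hystar hint, inner_zero_left, norm_sub_rev] at h2
  rw [real_inner_comm]
  linarith

lemma aux_dist {d1 d2 : ℕ} (Y : Set (EuclideanSpace ℝ (Fin d2)))
    (f : EuclideanSpace ℝ (Fin d1) → EuclideanSpace ℝ (Fin d2) → ℝ)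
    (μ : ℝ)
    (hconc : ∀ x' : EuclideanSpace ℝ (Fin d1), ∀ y1 ∈ Y, ∀ y2 ∈ Y,
      f x' y2 + ⟪grady f x' y1, y1 - y2⟫ + μ / 2 * ‖y1 - y2‖ ^ 2 ≤ f x' y1)
    (ystar : EuclideanSpace ℝ (Fin d1) → EuclideanSpace ℝ (Fin d2))
    (hystar : ∀ x', ystar x' ∈ Y ∧ ∀ y' ∈ Y, f x' y' ≤ f x' (ystar x'))
    (hint : ∀ x', ystar x' ∈ interior Y)
    (x' : EuclideanSpace ℝ (Fin d1)) (y : EuclideanSpace ℝ (Fin d2)) (hy : y ∈ Y) :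
    μ * ‖y - ystar x'‖ ≤ ‖grady f x' y‖ := by
  have h1 := aux_mono Y f μ hconc ystar hystar hint x' y hy
  have h2 := (abs_le.1 (abs_real_inner_le_norm (y - ystar x') (grady f x' y))).1
  by_cases h0 : ‖y - ystar x'‖ = 0
  · rw [h0]; simp
  · have hp : 0 < ‖y - ystar x'‖ := lt_of_le_of_ne (norm_nonneg _) (Ne.symm h0)
    have : ‖y - ystar x'‖ * (μ * ‖y - ystar x'‖) ≤ ‖y - ystar x'‖ * ‖grady f x' y‖ := by
      nlinarith
    exact le_of_mul_le_mul_left this hp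

lemma aux_lip {d1 d2 : ℕ} (Y : Set (EuclideanSpace ℝ (Fin d2)))
    (f : EuclideanSpace ℝ (Fin d1) → EuclideanSpace ℝ (Fin d2) → ℝ)
    (l μ : ℝ) (hμ : 0 < μ)
    (hsmooth : ∀ x1 x2 : EuclideanSpace ℝ (Fin d1), ∀ y1 ∈ Y, ∀ y2 ∈ Y,
      max ‖gradx f x1 y1 - gradx f x2 y2‖ ‖grady f x1 y1 - grady f x2 y2‖
        ≤ l * (‖x1 - x2‖ + ‖y1 - y2‖))
    (hconc : ∀ x' : EuclideanSpace ℝ (Fin d1), ∀ y1 ∈ Y, ∀ y2 ∈ Y,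
      f x' y2 + ⟪grady f x' y1, y1 - y2⟫ + μ / 2 * ‖y1 - y2‖ ^ 2 ≤ f x' y1)
    (ystar : EuclideanSpace ℝ (Fin d1) → EuclideanSpace ℝ (Fin d2))
    (hystar : ∀ x', ystar x' ∈ Y ∧ ∀ y' ∈ Y, f x' y' ≤ f x' (ystar x'))
    (hint : ∀ x', ystar x' ∈ interior Y)
    (x1 x2 : EuclideanSpace ℝ (Fin d1)) :
    ‖ystar x1 - ystar x2‖ ≤ l / μ * ‖x1 - x2‖ := by
  have h1 := aux_dist Y f μ hconc ystar hystar hint x2 (ystar x1) (hystar x1).1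
  have h2 := (le_max_right _ _).trans
    (hsmooth x2 x1 (ystar x1) (hystar x1).1 (ystar x1) (hystar x1).1)
  rw [aux_grady_ystar Y f ystar hystar hint x1, sub_self, norm_zero, add_zero, sub_zero,
    norm_sub_rev] at h2
  rw [div_mul_eq_mul_div, le_div_iff₀ hμ]
  linarith

lemma aux_descent {d1 d2 : ℕ} (Y : Set (EuclideanSpace ℝ (Fin d2)))
    (f : EuclideanSpace ℝ (Fin d1) → EuclideanSpace ℝ (Fin d2) → ℝ)
    (hdiff : Differentiable ℝ
      (fun p : EuclideanSpace ℝ (Fin d1) × EuclideanSpace ℝ (Fin d2) => f p.1 p.2))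
    (l μ : ℝ) (hμ : 0 < μ) (hμl : μ ≤ l)
    (hsmooth : ∀ x1 x2 : EuclideanSpace ℝ (Fin d1), ∀ y1 ∈ Y, ∀ y2 ∈ Y,
      max ‖gradx f x1 y1 - gradx f x2 y2‖ ‖grady f x1 y1 - grady f x2 y2‖
        ≤ l * (‖x1 - x2‖ + ‖y1 - y2‖))
    (hconc : ∀ x' : EuclideanSpace ℝ (Fin d1), ∀ y1 ∈ Y, ∀ y2 ∈ Y,
      f x' y2 + ⟪grady f x' y1, y1 - y2⟫ + μ / 2 * ‖y1 - y2‖ ^ 2 ≤ f x' y1)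
    (ystar : EuclideanSpace ℝ (Fin d1) → EuclideanSpace ℝ (Fin d2))
    (hystar : ∀ x', ystar x' ∈ Y ∧ ∀ y' ∈ Y, f x' y' ≤ f x' (ystar x'))
    (hint : ∀ x', ystar x' ∈ interior Y)
    (x1 x2 : EuclideanSpace ℝ (Fin d1)) :
    f x2 (ystar x2) ≤ f x1 (ystar x1) + ⟪gradx f x1 (ystar x1), x2 - x1⟫
      + (l + l * (l / μ)) * ‖x2 - x1‖ ^ 2 := by
  have hopt := (hystar x1).2 _ (hystar x2).1
  set y2 := ystar x2 with hy2
  have hy2Y : y2 ∈ Y := (hystar x2).1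
  have hl : 0 < l := hμ.trans_le hμl
  have hd : Differentiable ℝ (fun x' => f x' y2) :=
    hdiff.comp (differentiable_id.prodMk (differentiable_const y2))
  have hmv := Convex.norm_image_sub_le_of_norm_hasFDerivWithin_le'
    (f := fun x' => f x' y2) (f' := fun z => fderiv ℝ (fun x' => f x' y2) z)
    (φ := fderiv ℝ (fun x' => f x' y2) x1) (C := l * ‖x2 - x1‖) (s := segment ℝ x1 x2)
    (x := x1) (y := x2)
    (fun z _ => (hd z).hasFDerivAt.hasFDerivWithinAt)
    (by
      intro z hz
      have h1 := (le_max_left _ _).trans (hsmooth z x1 y2 hy2Y y2 hy2Y)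
      rw [sub_self, norm_zero, add_zero] at h1
      have h2 : ‖fderiv ℝ (fun x' => f x' y2) z - fderiv ℝ (fun x' => f x' y2) x1‖
          = ‖gradx f z y2 - gradx f x1 y2‖ := by
        unfold gradx gradient
        rw [← map_sub, LinearIsometryEquiv.norm_map]
      rw [h2]
      refine h1.trans ?_
      gcongr
      exact norm_sub_le_of_mem_segment hz)
    (convex_segment _ _) (left_mem_segment _ _ _) (right_mem_segment _ _ _)
  have hfd : fderiv ℝ (fun x' => f x' y2) x1 (x2 - x1) = ⟪gradx f x1 y2, x2 - x1⟫ := by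
    unfold gradx
    rw [inner_gradient_left]
  rw [hfd] at hmv
  have hmv2 := (abs_le.1 hmv).2
  have hsm := (le_max_left _ _).trans (hsmooth x1 x1 y2 hy2Y (ystar x1) (hystar x1).1)
  rw [sub_self, norm_zero, zero_add] at hsm
  have hlip := aux_lip Y f l μ hμ hsmooth hconc ystar hystar hint x2 x1
  rw [← hy2] at hlip
  have hin : ⟪gradx f x1 y2, x2 - x1⟫ - ⟪gradx f x1 (ystar x1), x2 - x1⟫
      ≤ l * (l / μ) * ‖x2 - x1‖ ^ 2 := by
    rw [← inner_sub_left]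
    refine (real_inner_le_norm _ _).trans ?_
    have : ‖gradx f x1 y2 - gradx f x1 (ystar x1)‖ ≤ l * (l / μ * ‖x2 - x1‖) :=
      hsm.trans (by gcongr)
    calc _ ≤ l * (l / μ * ‖x2 - x1‖) * ‖x2 - x1‖ := by gcongr
      _ = _ := by ring
  nlinarith

lemma aux_w (v0 G η p : ℝ) (hv0 : 0 < v0) (hη : 0 < η) (hp : 0 < p) (v a : ℕ → ℝ)
    (hv : v 0 = v0)
    (ha : ∀ t, 0 ≤ a t) (haG : ∀ t, a t ≤ G ^ 2) (hrec : ∀ t, v (t + 1) = v t + a t) :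
    (∀ t, 0 < η / v (t + 1) ^ p) ∧ (∀ t, η / v (t + 1) ^ p ≤ η / v0 ^ p) ∧
    Monotone (fun t => 1 / (η / v (t + 1) ^ p)) ∧
    ∀ T : ℕ, 1 ≤ T → ∀ t < T, 1 / (η / v (t + 1) ^ p) ≤ (v0 + G ^ 2) ^ p / η * (T : ℝ) ^ p := by
  obtain ⟨h1, h2, h3⟩ := aux_v_bounds v0 G hv0 v a hv ha haG hrec
  have hpos : ∀ t, 0 < v t := fun t => hv0.trans_le (h1 t)
  have hpp : ∀ t, 0 < v t ^ p := fun t => Real.rpow_pos_of_pos (hpos t) p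
  refine ⟨fun t => div_pos hη (hpp _), fun t => ?_, ?_, ?_⟩
  · have : v0 ^ p ≤ v (t + 1) ^ p := Real.rpow_le_rpow hv0.le (h1 _) hp.le
    have h0 : 0 < v0 ^ p := Real.rpow_pos_of_pos hv0 p
    gcongr
  · intro s t hst
    simp only [one_div_div]
    have : v (s + 1) ^ p ≤ v (t + 1) ^ p :=
      Real.rpow_le_rpow (hpos _).le (h2 (by omega)) hp.le
    gcongr
  · intro T hT t ht
    rw [one_div_div, div_mul_eq_mul_div, ← Real.mul_rpow (by positivity) (by positivity)]
    have : v (t + 1) ^ p ≤ ((v0 + G ^ 2) * T) ^ p :=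
      Real.rpow_le_rpow (hpos _).le (h3 T hT _ ht) hp.le
    gcongr

lemma aux_xstep {E : Type*} [NormedAddCommGroup E] [InnerProductSpace ℝ E]
    (x x1 g p : E) (η K a b : ℝ) (hη : 0 < η) (hx : x1 = x - η • g)
    (h : b ≤ a + ⟪p, x1 - x⟫ + K * ‖x1 - x‖ ^ 2) :
    0 ≤ (1 / η) * (a - b) - ⟪p, g⟫ + K * (η * ‖g‖ ^ 2) := by
  have e : x1 - x = - (η • g) := by rw [hx]; abel
  rw [e, inner_neg_right, real_inner_smul_right, norm_neg, norm_smul, Real.norm_eq_abs, mul_pow,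
    sq_abs] at h
  have h2 : 0 ≤ (1 / η) * (a + -(η * ⟪p, g⟫) + K * (η ^ 2 * ‖g‖ ^ 2) - b) :=
    mul_nonneg (by positivity) (by linarith)
  have h3 : (1 / η) * (a + -(η * ⟪p, g⟫) + K * (η ^ 2 * ‖g‖ ^ 2) - b)
    = (1 / η) * (a - b) - ⟪p, g⟫ + K * (η * ‖g‖ ^ 2) := by field_simp; ring
  linarith

/-- The rate. -/
noncomputable def auxR (α β : ℝ) (T : ℕ) : ℝ :=
  ((T : ℝ) ^ (α - 1) + (T : ℝ) ^ (-α) + (T : ℝ) ^ (-β) + (T : ℝ) ^ (-(1 : ℝ))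
              + (T : ℝ) ^ (2 * β - 1) + (T : ℝ) ^ (2 * β - 2 * α))

lemma auxR_mul (α β : ℝ) (T : ℕ) (hT : 1 ≤ T) :
    (T : ℝ) * auxR α β T = (T : ℝ) ^ α + (T : ℝ) ^ (1 - α) + (T : ℝ) ^ (1 - β) + 1
      + (T : ℝ) ^ (2 * β) + (T : ℝ) ^ (2 * β) * (T : ℝ) ^ (1 - 2 * α) := by
  have hT1 : (0 : ℝ) < T := by exact_mod_cast hT
  have key : ∀ p : ℝ, (T : ℝ) * (T : ℝ) ^ p = (T : ℝ) ^ (1 + p) := by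
    intro p; rw [Real.rpow_add hT1, Real.rpow_one]
  unfold auxR
  simp only [mul_add, key]
  rw [← Real.rpow_add hT1]
  have : (1 : ℝ) = (T : ℝ) ^ (0 : ℝ) := by simp
  congr 1
  · congr 1
    · congr 1
      · congr 1
        · congr 1
          ring_nf
      · norm_num
    · ring_nf
  · ring_nf

lemma aux_final_x (α β M K c : ℝ) (hM : 0 ≤ M) (hK : 0 ≤ K) (hc : 0 ≤ c)
    (T : ℕ) (hT : 1 ≤ T) :
    M * (K * (T : ℝ) ^ α) + c * ((1 + Real.log (1 + (T : ℝ))) * (1 + (T : ℝ) ^ (1 - α)))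
      ≤ (M * K + c) * ((1 + Real.log (1 + (T : ℝ))) * (T * auxR α β T)) := by
  rw [auxR_mul α β T hT]
  have hT1 : (1 : ℝ) ≤ T := by exact_mod_cast hT
  have hL : 1 ≤ 1 + Real.log (1 + (T : ℝ)) := by
    have := Real.log_nonneg (by linarith : (1 : ℝ) ≤ 1 + T); linarith
  set L := 1 + Real.log (1 + (T : ℝ))
  have e1 : 0 ≤ (T : ℝ) ^ α := by positivity
  have e2 : 0 ≤ (T : ℝ) ^ (1 - α) := by positivity
  have e3 : 0 ≤ (T : ℝ) ^ (1 - β) := by positivity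
  have e4 : 0 ≤ (T : ℝ) ^ (2 * β) := by positivity
  have e5 : 0 ≤ (T : ℝ) ^ (2 * β) * (T : ℝ) ^ (1 - 2 * α) := by positivity
  set Q := (T : ℝ) ^ α + (T : ℝ) ^ (1 - α) + (T : ℝ) ^ (1 - β) + 1
      + (T : ℝ) ^ (2 * β) + (T : ℝ) ^ (2 * β) * (T : ℝ) ^ (1 - 2 * α) with hQ
  have q1 : (T : ℝ) ^ α ≤ L * Q := by
    have : (T : ℝ) ^ α ≤ Q := by linarith
    nlinarith
  have q2 : L * (1 + (T : ℝ) ^ (1 - α)) ≤ L * Q := by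
    have : 1 + (T : ℝ) ^ (1 - α) ≤ Q := by linarith
    gcongr
  calc _ = (M * K) * (T : ℝ) ^ α + c * (L * (1 + (T : ℝ) ^ (1 - α))) := by ring
    _ ≤ (M * K) * (L * Q) + c * (L * Q) := by gcongr
    _ = _ := by ring

lemma aux_final_y (α β M K c m d : ℝ) (hβ : 0 < β) (hM : 0 ≤ M) (hK : 0 ≤ K) (hc : 0 ≤ c)
    (hm : 0 ≤ m) (hd : 0 ≤ d) (T : ℕ) (hT : 1 ≤ T) :
    M * (K * (T : ℝ) ^ β) + c * ((1 + Real.log (1 + (T : ℝ))) * (1 + (T : ℝ) ^ (1 - β)))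
      + (K * (T : ℝ) ^ β + m * (K * (T : ℝ) ^ β) ^ 2) *
        (d * ((1 + Real.log (1 + (T : ℝ))) * (1 + (T : ℝ) ^ (1 - 2 * α))))
      ≤ (M * K + c + (K + m * K ^ 2) * d) *
        ((1 + Real.log (1 + (T : ℝ))) * (T * auxR α β T)) := by
  rw [auxR_mul α β T hT]
  have hT1 : (1 : ℝ) ≤ T := by exact_mod_cast hT
  have hL : 1 ≤ 1 + Real.log (1 + (T : ℝ)) := by
    have := Real.log_nonneg (by linarith : (1 : ℝ) ≤ 1 + T); linarith
  set L := 1 + Real.log (1 + (T : ℝ))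
  have e1 : 0 ≤ (T : ℝ) ^ α := by positivity
  have e2 : 0 ≤ (T : ℝ) ^ (1 - α) := by positivity
  have e3 : 0 ≤ (T : ℝ) ^ (1 - β) := by positivity
  have e4 : 0 ≤ (T : ℝ) ^ (2 * β) := by positivity
  have e6 : 0 ≤ (T : ℝ) ^ (1 - 2 * α) := by positivity
  have e5 : 0 ≤ (T : ℝ) ^ (2 * β) * (T : ℝ) ^ (1 - 2 * α) := by positivity
  have e7 : ((T : ℝ) ^ β) ^ 2 = (T : ℝ) ^ (2 * β) := by
    rw [← Real.rpow_natCast, ← Real.rpow_mul (by positivity)]; congr 1; push_cast; ring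
  have e8 : (T : ℝ) ^ β ≤ (T : ℝ) ^ (2 * β) :=
    Real.rpow_le_rpow_of_exponent_le hT1 (by linarith)
  set Q := (T : ℝ) ^ α + (T : ℝ) ^ (1 - α) + (T : ℝ) ^ (1 - β) + 1
      + (T : ℝ) ^ (2 * β) + (T : ℝ) ^ (2 * β) * (T : ℝ) ^ (1 - 2 * α) with hQ
  have q1 : (T : ℝ) ^ β ≤ L * Q := by
    have : (T : ℝ) ^ β ≤ Q := by linarith
    nlinarith
  have q2 : L * (1 + (T : ℝ) ^ (1 - β)) ≤ L * Q := by
    have : 1 + (T : ℝ) ^ (1 - β) ≤ Q := by linarith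
    gcongr
  have q3 : (T : ℝ) ^ (2 * β) * (L * (1 + (T : ℝ) ^ (1 - 2 * α))) ≤ L * Q := by
    have : (T : ℝ) ^ (2 * β) * (1 + (T : ℝ) ^ (1 - 2 * α)) ≤ Q := by linarith
    calc _ = L * ((T : ℝ) ^ (2 * β) * (1 + (T : ℝ) ^ (1 - 2 * α))) := by ring
      _ ≤ _ := by gcongr
  calc _ = (M * K) * (T : ℝ) ^ β + c * (L * (1 + (T : ℝ) ^ (1 - β)))
        + (K * (T : ℝ) ^ β + m * K ^ 2 * ((T : ℝ) ^ β) ^ 2) *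
        (d * (L * (1 + (T : ℝ) ^ (1 - 2 * α)))) := by ring
    _ ≤ (M * K) * (L * Q) + c * (L * Q)
        + (K * (T : ℝ) ^ (2 * β) + m * K ^ 2 * (T : ℝ) ^ (2 * β)) *
        (d * (L * (1 + (T : ℝ) ^ (1 - 2 * α)))) := by
        rw [e7]; gcongr
    _ = (M * K) * (L * Q) + c * (L * Q)
        + (K + m * K ^ 2) * d * ((T : ℝ) ^ (2 * β) *
          (L * (1 + (T : ℝ) ^ (1 - 2 * α)))) := by ring
    _ ≤ (M * K) * (L * Q) + c * (L * Q) + (K + m * K ^ 2) * d * (L * Q) := by gcongr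
    _ = _ := by ring

set_option maxHeartbeats 2000000 in
/-- Theorem D.1 (stochastic TiAda without the max coupling): with the primal stepsize
`η^x/(v^x_{t+1})^α`, both expected averaged squared gradient norms are bounded by
`C (1 + log(1+T)) (T^{α−1} + T^{−α} + T^{−β} + T^{−1} + T^{2β−1} + T^{2β−2α})`. -/
theorem tiada_without_max_stochastic_convergence
    {d1 d2 : ℕ}
    (Y : Set (EuclideanSpace ℝ (Fin d2)))
    (hYne : Y.Nonempty) (hYclosed : IsClosed Y) (hYconv : Convex ℝ Y)
    (P : EuclideanSpace ℝ (Fin d2) → EuclideanSpace ℝ (Fin d2))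
    (hP : ∀ z, P z ∈ Y ∧ ∀ w ∈ Y, ‖P z - z‖ ≤ ‖w - z‖)
    (f : EuclideanSpace ℝ (Fin d1) → EuclideanSpace ℝ (Fin d2) → ℝ)
    (hdiff : Differentiable ℝ
      (fun p : EuclideanSpace ℝ (Fin d1) × EuclideanSpace ℝ (Fin d2) => f p.1 p.2))
    (l μ G Φmax : ℝ) (hμ : 0 < μ) (hμl : μ ≤ l) (hG : 0 < G)
    (hsmooth : ∀ x1 x2 : EuclideanSpace ℝ (Fin d1), ∀ y1 ∈ Y, ∀ y2 ∈ Y,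
      max ‖gradx f x1 y1 - gradx f x2 y2‖ ‖grady f x1 y1 - grady f x2 y2‖
        ≤ l * (‖x1 - x2‖ + ‖y1 - y2‖))
    (hconc : ∀ x' : EuclideanSpace ℝ (Fin d1), ∀ y1 ∈ Y, ∀ y2 ∈ Y,
      f x' y2 + ⟪grady f x' y1, y1 - y2⟫ + μ / 2 * ‖y1 - y2‖ ^ 2 ≤ f x' y1)
    (ystar : EuclideanSpace ℝ (Fin d1) → EuclideanSpace ℝ (Fin d2))
    (hystar : ∀ x', ystar x' ∈ Y ∧ ∀ y' ∈ Y, f x' y' ≤ f x' (ystar x'))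
    (hint : ∀ x', ystar x' ∈ interior Y)
    (hΦmax : ∀ x', f x' (ystar x') ≤ Φmax)
    (hΦbdd : BddBelow (Set.range fun x' => f x' (ystar x')))
    (Ω : Type*) [m0 : MeasurableSpace Ω] (μP : Measure Ω) [IsProbabilityMeasure μP]
    (F : Filtration ℕ m0)
    (ηx ηy α β : ℝ) (hηx : 0 < ηx) (hηy : 0 < ηy)
    (hβ : 0 < β) (hβα : β < α) (hα : α < 1)
    (x : ℕ → Ω → EuclideanSpace ℝ (Fin d1)) (y : ℕ → Ω → EuclideanSpace ℝ (Fin d2))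
    (vx vy : ℕ → Ω → ℝ)
    (gxs : ℕ → Ω → EuclideanSpace ℝ (Fin d1)) (gys : ℕ → Ω → EuclideanSpace ℝ (Fin d2))
    (x0 : EuclideanSpace ℝ (Fin d1)) (y0 : EuclideanSpace ℝ (Fin d2)) (vx0 vy0 : ℝ)
    (hx0 : ∀ ω, x 0 ω = x0) (hy0 : ∀ ω, y 0 ω = y0) (hy0Y : y0 ∈ Y)
    (hvx0 : ∀ ω, vx 0 ω = vx0) (hvy0 : ∀ ω, vy 0 ω = vy0)
    (hvx0pos : 0 < vx0) (hvy0pos : 0 < vy0)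
    (hxmeas : ∀ t, StronglyMeasurable[F t] (x t))
    (hymeas : ∀ t, StronglyMeasurable[F t] (y t))
    (hvxmeas : ∀ t, StronglyMeasurable[F t] (vx t))
    (hvymeas : ∀ t, StronglyMeasurable[F t] (vy t))
    (hgxmeas : ∀ t, StronglyMeasurable[F (t + 1)] (gxs t))
    (hgymeas : ∀ t, StronglyMeasurable[F (t + 1)] (gys t))
    (hunbx : ∀ t, μP[gxs t|F t] =ᵐ[μP] fun ω => gradx f (x t ω) (y t ω))
    (hunby : ∀ t, μP[gys t|F t] =ᵐ[μP] fun ω => grady f (x t ω) (y t ω))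
    (hbdx : ∀ t, ∀ᵐ ω ∂μP, ‖gxs t ω‖ ≤ G)
    (hbdy : ∀ t, ∀ᵐ ω ∂μP, ‖gys t ω‖ ≤ G)
    (hvx : ∀ t ω, vx (t + 1) ω = vx t ω + ‖gxs t ω‖ ^ 2)
    (hvy : ∀ t ω, vy (t + 1) ω = vy t ω + ‖gys t ω‖ ^ 2)
    (hxup : ∀ t ω, x (t + 1) ω = x t ω - (ηx / (vx (t + 1) ω) ^ α) • gxs t ω)
    (hyup : ∀ t ω, y (t + 1) ω = P (y t ω + (ηy / (vy (t + 1) ω) ^ β) • gys t ω)) :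
    ∃ C : ℝ, ∀ T : ℕ, 1 ≤ T →
      (1 / (T : ℝ)) *
          ∫ ω, (∑ t ∈ Finset.range T, ‖gradx f (x t ω) (y t ω)‖ ^ 2) ∂μP
        ≤ C * (1 + Real.log (1 + (T : ℝ))) *
            ((T : ℝ) ^ (α - 1) + (T : ℝ) ^ (-α) + (T : ℝ) ^ (-β) + (T : ℝ) ^ (-(1 : ℝ))
              + (T : ℝ) ^ (2 * β - 1) + (T : ℝ) ^ (2 * β - 2 * α)) ∧
      (1 / (T : ℝ)) *
          ∫ ω, (∑ t ∈ Finset.range T, ‖grady f (x t ω) (y t ω)‖ ^ 2) ∂μP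
        ≤ C * (1 + Real.log (1 + (T : ℝ))) *
            ((T : ℝ) ^ (α - 1) + (T : ℝ) ^ (-α) + (T : ℝ) ^ (-β) + (T : ℝ) ^ (-(1 : ℝ))
              + (T : ℝ) ^ (2 * β - 1) + (T : ℝ) ^ (2 * β - 2 * α)) := by
  classical
  have hl : 0 < l := hμ.trans_le hμl
  -- basic facts
  have hYt : ∀ t ω, y t ω ∈ Y := by
    intro t ω
    cases t with
    | zero => rw [hy0]; exact hy0Y
    | succ k => rw [hyup]; exact (hP _).1
  have hmono := aux_mono Y f μ hconc ystar hystar hint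
  have hdist := aux_dist Y f μ hconc ystar hystar hint
  have hgy0 := aux_grady_ystar Y f ystar hystar hint
  have hlip := aux_lip Y f l μ hμ hsmooth hconc ystar hystar hint
  have hdesc := aux_descent Y f hdiff l μ hμ hμl hsmooth hconc ystar hystar hint
  have hycont : Continuous ystar := by
    refine (LipschitzWith.of_dist_le_mul (K := ⟨l / μ, by positivity⟩) ?_).continuous
    intro a b
    rw [dist_eq_norm, dist_eq_norm]
    exact hlip a b
  have hpcont : Continuous (fun z => gradx f z (ystar z)) := by
    refine (LipschitzWith.of_dist_le_mul (K := ⟨l * (1 + l / μ), by positivity⟩) ?_).continuous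
    intro a b
    rw [dist_eq_norm, dist_eq_norm]
    have h1 := (le_max_left _ _).trans (hsmooth a b _ (hystar a).1 _ (hystar b).1)
    have h2 := hlip a b
    change _ ≤ l * (1 + l / μ) * ‖a - b‖
    nlinarith
  obtain ⟨Φmin, hΦmin⟩ := hΦbdd
  have hΦmin' : ∀ z, Φmin ≤ f z (ystar z) := fun z => hΦmin ⟨z, rfl⟩
  have hMx : 0 ≤ Φmax - Φmin := by linarith [hΦmin' x0, hΦmax x0]
  obtain ⟨Cb, hCb0, hCb⟩ := aux_sum_div_rpow vy0 G β hvy0pos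
  obtain ⟨Ca, hCa0, hCa⟩ := aux_sum_div_rpow vx0 G α hvx0pos
  obtain ⟨Cc, hCc0, hCc⟩ := aux_sum_div_rpow vx0 G (2 * α) hvx0pos
  set Ky := (vy0 + G ^ 2) ^ β / ηy with hKy
  set Kx := (vx0 + G ^ 2) ^ α / ηx with hKx
  have hKy0 : 0 ≤ Ky := by positivity
  have hKx0 : 0 ≤ Kx := by positivity
  set Γ := ηy / vy0 ^ β with hΓ
  have hΓ0 : 0 ≤ Γ := by positivity
  set M := (G / μ) ^ 2 with hM
  have hM0 : 0 ≤ M := by positivity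
  set Kd := l + l * (l / μ) with hKd
  have hKd0 : 0 ≤ Kd := by positivity
  set cy := (1 + μ * Γ) * ηy * Cb with hcy
  have hcy0 : 0 ≤ cy := by positivity
  set dy := (l / μ) ^ 2 * ηx ^ 2 * Cc with hdy
  have hdy0 : 0 ≤ dy := by positivity
  set cx := Kd * ηx * Ca with hcx
  have hcx0 : 0 ≤ cx := by positivity
  set C1 := M * Ky + cy + (Ky + 2 / μ * Ky ^ 2) * dy with hC1
  have hC10 : 0 ≤ C1 := by positivity
  set C2 := (Φmax - Φmin) * Kx + cx with hC2
  have hC20 : 0 ≤ C2 := by positivity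
  -- integrability / conditional expectations
  have hgxa : ∀ t, AEStronglyMeasurable (gxs t) μP := fun t =>
    ((hgxmeas t).mono (F.le _)).aestronglyMeasurable
  have hgya : ∀ t, AEStronglyMeasurable (gys t) μP := fun t =>
    ((hgymeas t).mono (F.le _)).aestronglyMeasurable
  have hX := fun t => aux_condExp_bound (F.le t) μP (gxs t) _ G
    (Integrable.of_bound (hgxa t) G (hbdx t)) (hbdx t) (hunbx t)
  have hYY := fun t => aux_condExp_bound (F.le t) μP (gys t) _ G
    (Integrable.of_bound (hgya t) G (hbdy t)) (hbdy t) (hunby t)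
  have hhmeas : ∀ t, StronglyMeasurable[F t] (fun ω => y t ω - ystar (x t ω)) := fun t =>
    (hymeas t).sub (hycont.comp_stronglyMeasurable (hxmeas t))
  have hpmeas : ∀ t, StronglyMeasurable[F t] (fun ω => gradx f (x t ω) (ystar (x t ω))) := fun t =>
    hpcont.comp_stronglyMeasurable (hxmeas t)
  have hhbd : ∀ t, ∀ᵐ ω ∂μP, ‖y t ω - ystar (x t ω)‖ ≤ G / μ := by
    intro t
    filter_upwards [(hYY t).2] with ω h1
    rw [le_div_iff₀ hμ]
    have := hdist (x t ω) (y t ω) (hYt t ω)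
    linarith
  have hpdiff : ∀ t ω, ‖gradx f (x t ω) (ystar (x t ω)) - gradx f (x t ω) (y t ω)‖
      ≤ l * ‖y t ω - ystar (x t ω)‖ := by
    intro t ω
    have h1 := (le_max_left _ _).trans
      (hsmooth (x t ω) (x t ω) _ (hystar (x t ω)).1 _ (hYt t ω))
    rw [sub_self, norm_zero, zero_add, norm_sub_rev (ystar _)] at h1
    exact h1
  have hpbd : ∀ t, ∀ᵐ ω ∂μP, ‖gradx f (x t ω) (ystar (x t ω))‖ ≤ G + l * (G / μ) := by
    intro t
    filter_upwards [(hX t).2, hhbd t] with ω h1 h2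
    have h3 := hpdiff t ω
    have h4 := norm_le_norm_add_norm_sub' (gradx f (x t ω) (ystar (x t ω))) (gradx f (x t ω) (y t ω))
    have h5 := mul_le_mul_of_nonneg_left h2 hl.le
    linarith
  have hEy := fun t => aux_condExp (F.le t) μP _ (gys t) _ (G / μ) G (hhmeas t) (hhbd t) (hgya t)
    (hbdy t) (hunby t)
  have hEx := fun t => aux_condExp (F.le t) μP _ (gxs t) _ (G + l * (G / μ)) G (hpmeas t) (hpbd t)
    (hgxa t) (hbdx t) (hunbx t)
  have hDi : ∀ t, Integrable (fun ω => ‖y t ω - ystar (x t ω)‖ ^ 2) μP := by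
    intro t
    refine Integrable.of_bound
      ((((hhmeas t).mono (F.le t)).norm.pow 2).aestronglyMeasurable) M ?_
    filter_upwards [hhbd t] with ω h1
    rw [Real.norm_eq_abs, abs_of_nonneg (by positivity), hM]
    gcongr
  have hgxi : ∀ t, Integrable (fun ω => ‖gradx f (x t ω) (y t ω)‖ ^ 2) μP := by
    intro t
    refine Integrable.of_bound ((hX t).1.norm.pow 2) (G ^ 2) ?_
    filter_upwards [(hX t).2] with ω h1
    rw [Real.norm_eq_abs, abs_of_nonneg (by positivity)]
    gcongr
  have hgyi : ∀ t, Integrable (fun ω => ‖grady f (x t ω) (y t ω)‖ ^ 2) μP := by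
    intro t
    refine Integrable.of_bound ((hYY t).1.norm.pow 2) (G ^ 2) ?_
    filter_upwards [(hYY t).2] with ω h1
    rw [Real.norm_eq_abs, abs_of_nonneg (by positivity)]
    gcongr
  -- pathwise bound for y
  have hpathy : ∀ T : ℕ, 1 ≤ T → ∀ᵐ ω ∂μP,
      ∑ t ∈ range T, (- (2 * ⟪y t ω - ystar (x t ω), gys t ω⟫)
        - μ * ‖y t ω - ystar (x t ω)‖ ^ 2)
      ≤ C1 * ((1 + Real.log (1 + (T : ℝ))) * (T * auxR α β T)) := by
    intro T hT
    filter_upwards [ae_all_iff.2 hbdx, ae_all_iff.2 hbdy, ae_all_iff.2 hhbd] with ω b1 b2 b3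
    have a2 : ∀ t, ‖gys t ω‖ ^ 2 ≤ G ^ 2 := fun t => by have := b2 t; gcongr
    have a1 : ∀ t, ‖gxs t ω‖ ^ 2 ≤ G ^ 2 := fun t => by have := b1 t; gcongr
    have s1 := hCb (fun t => vy t ω) (fun t => ‖gys t ω‖ ^ 2) (hvy0 ω) (fun t => by positivity)
      a2 (fun t => hvy t ω) T hT
    have s2 := hCc (fun t => vx t ω) (fun t => ‖gxs t ω‖ ^ 2) (hvx0 ω) (fun t => by positivity)
      a1 (fun t => hvx t ω) T hT
    obtain ⟨w1, w2, w3, w4⟩ := aux_w vy0 G ηy β hvy0pos hηy hβ (fun t => vy t ω)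
      (fun t => ‖gys t ω‖ ^ 2) (hvy0 ω) (fun t => by positivity) a2 (fun t => hvy t ω)
    obtain ⟨u1, -⟩ := aux_w vx0 G ηx α hvx0pos hηx (hβ.trans hβα) (fun t => vx t ω)
      (fun t => ‖gxs t ω‖ ^ 2) (hvx0 ω) (fun t => by positivity) a1 (fun t => hvx t ω)
    have hvxpos := (aux_v_bounds vx0 G hvx0pos (fun t => vx t ω)
      (fun t => ‖gxs t ω‖ ^ 2) (hvx0 ω) (fun t => by positivity) a1 (fun t => hvx t ω)).1
    have tel := aux_telescope _ (fun t => ‖y t ω - ystar (x t ω)‖ ^ 2) M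
      (fun t => (one_div_pos.2 (w1 t)).le) w3 (fun t => by positivity)
      (fun t => by have := b3 t; simp only [hM]; gcongr) T hT
    have wl := w4 T hT (T - 1) (by omega)
    beta_reduce at s1 s2 w1 w2 w4 u1 hvxpos tel wl
    have step : ∀ t ∈ range T, - (2 * ⟪y t ω - ystar (x t ω), gys t ω⟫)
        - μ * ‖y t ω - ystar (x t ω)‖ ^ 2 ≤
        (1 / (ηy / vy (t + 1) ω ^ β)) * (‖y t ω - ystar (x t ω)‖ ^ 2
          - ‖y (t + 1) ω - ystar (x (t + 1) ω)‖ ^ 2)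
        + ((1 + μ * Γ) * ηy) * (‖gys t ω‖ ^ 2 / vy (t + 1) ω ^ β)
        + ((Ky * (T : ℝ) ^ β + 2 / μ * (Ky * (T : ℝ) ^ β) ^ 2) * ((l / μ) ^ 2 * ηx ^ 2)) *
          (‖gxs t ω‖ ^ 2 / vx (t + 1) ω ^ (2 * α)) := by
      intro t ht
      have hst := aux_ystep (y t ω) (ystar (x t ω)) (ystar (x (t + 1) ω)) (y (t + 1) ω) (gys t ω)
        _ Γ μ (w1 t) (w2 t) hμ
        (by rw [hyup]; exact aux_proj Y hYconv P hP _ _ (hystar _).1)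
      have hwt := w4 T hT t (Finset.mem_range.1 ht)
      have hw0 := (one_div_pos.2 (w1 t)).le
      have hB : ‖ystar (x t ω) - ystar (x (t + 1) ω)‖ ^ 2
          ≤ (l / μ) ^ 2 * ηx ^ 2 * (‖gxs t ω‖ ^ 2 / vx (t + 1) ω ^ (2 * α)) := by
        have h1 := hlip (x t ω) (x (t + 1) ω)
        have h2 : x t ω - x (t + 1) ω = (ηx / (vx (t + 1) ω) ^ α) • gxs t ω := by
          rw [hxup]; abel
        rw [h2, norm_smul, Real.norm_eq_abs, abs_of_pos (u1 t)] at h1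
        have hvp : 0 < vx (t + 1) ω := hvx0pos.trans_le (hvxpos (t + 1))
        have h3 : vx (t + 1) ω ^ (2 * α) = (vx (t + 1) ω ^ α) ^ 2 := by
          rw [← Real.rpow_natCast, ← Real.rpow_mul hvp.le]; congr 1; push_cast; ring
        calc _ ≤ (l / μ * (ηx / (vx (t + 1) ω) ^ α * ‖gxs t ω‖)) ^ 2 := by gcongr
          _ = _ := by rw [h3]; field_simp
      have hBB : (1 / (ηy / vy (t + 1) ω ^ β) + 2 / μ * (1 / (ηy / vy (t + 1) ω ^ β)) ^ 2)
            * ‖ystar (x t ω) - ystar (x (t + 1) ω)‖ ^ 2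
          ≤ (Ky * (T : ℝ) ^ β + 2 / μ * (Ky * (T : ℝ) ^ β) ^ 2) *
            ((l / μ) ^ 2 * ηx ^ 2 * (‖gxs t ω‖ ^ 2 / vx (t + 1) ω ^ (2 * α))) := by
        gcongr
      have hg : ηy / vy (t + 1) ω ^ β * ‖gys t ω‖ ^ 2
        = ηy * (‖gys t ω‖ ^ 2 / vy (t + 1) ω ^ β) := by ring
      rw [hg] at hst
      linarith
    refine (Finset.sum_le_sum step).trans ?_
    rw [Finset.sum_add_distrib, Finset.sum_add_distrib, ← Finset.mul_sum, ← Finset.mul_sum]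
    refine le_trans ?_ (aux_final_y α β M Ky cy (2 / μ) dy hβ hM0 hKy0 hcy0 (by positivity) hdy0
      T hT)
    have t1 := tel.trans (mul_le_mul_of_nonneg_left wl hM0)
    have t2 := mul_le_mul_of_nonneg_left s1 (by positivity : 0 ≤ (1 + μ * Γ) * ηy)
    have t3 := mul_le_mul_of_nonneg_left s2 (by positivity : 0 ≤
      (Ky * (T : ℝ) ^ β + 2 / μ * (Ky * (T : ℝ) ^ β) ^ 2) * ((l / μ) ^ 2 * ηx ^ 2))
    refine (add_le_add (add_le_add t1 t2) t3).trans (le_of_eq ?_)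
    rw [hcy, hdy]; ring
  -- pathwise bound for x
  have hpathx : ∀ T : ℕ, 1 ≤ T → ∀ᵐ ω ∂μP,
      ∑ t ∈ range T, ⟪gradx f (x t ω) (ystar (x t ω)), gxs t ω⟫
      ≤ C2 * ((1 + Real.log (1 + (T : ℝ))) * (T * auxR α β T)) := by
    intro T hT
    filter_upwards [ae_all_iff.2 hbdx] with ω b1
    have a1 : ∀ t, ‖gxs t ω‖ ^ 2 ≤ G ^ 2 := fun t => by have := b1 t; gcongr
    have s1 := hCa (fun t => vx t ω) (fun t => ‖gxs t ω‖ ^ 2) (hvx0 ω) (fun t => by positivity)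
      a1 (fun t => hvx t ω) T hT
    obtain ⟨w1, w2, w3, w4⟩ := aux_w vx0 G ηx α hvx0pos hηx (hβ.trans hβα) (fun t => vx t ω)
      (fun t => ‖gxs t ω‖ ^ 2) (hvx0 ω) (fun t => by positivity) a1 (fun t => hvx t ω)
    have tel := aux_telescope _ (fun t => f (x t ω) (ystar (x t ω)) - Φmin) (Φmax - Φmin)
      (fun t => (one_div_pos.2 (w1 t)).le) w3 (fun t => by linarith [hΦmin' (x t ω)])
      (fun t => by linarith [hΦmax (x t ω)]) T hT
    have wl := w4 T hT (T - 1) (by omega)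
    beta_reduce at s1 w1 tel wl
    have step : ∀ t ∈ range T, ⟪gradx f (x t ω) (ystar (x t ω)), gxs t ω⟫ ≤
        (1 / (ηx / vx (t + 1) ω ^ α)) * (f (x t ω) (ystar (x t ω)) - Φmin
          - (f (x (t + 1) ω) (ystar (x (t + 1) ω)) - Φmin))
        + (Kd * ηx) * (‖gxs t ω‖ ^ 2 / vx (t + 1) ω ^ α) := by
      intro t _
      have hst := aux_xstep (x t ω) (x (t + 1) ω) (gxs t ω) _ _ Kd _ _ (w1 t) (hxup t ω)
        (hdesc (x t ω) (x (t + 1) ω))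
      have hg : ηx / vx (t + 1) ω ^ α * ‖gxs t ω‖ ^ 2
        = ηx * (‖gxs t ω‖ ^ 2 / vx (t + 1) ω ^ α) := by ring
      rw [hg] at hst
      rw [sub_sub_sub_cancel_right]
      linarith
    refine (Finset.sum_le_sum step).trans ?_
    rw [Finset.sum_add_distrib, ← Finset.mul_sum]
    refine le_trans ?_ (aux_final_x α β (Φmax - Φmin) Kx cx hMx hKx0 hcx0 T hT)
    have t1 := tel.trans (mul_le_mul_of_nonneg_left wl hMx)
    have t2 := mul_le_mul_of_nonneg_left s1 (by positivity : 0 ≤ Kd * ηx)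
    refine (add_le_add t1 t2).trans (le_of_eq ?_)
    rw [hcx]; ring
  -- expectation for y
  have hED : ∀ T : ℕ, 1 ≤ T → ∑ t ∈ range T, ∫ ω, ‖y t ω - ystar (x t ω)‖ ^ 2 ∂μP
      ≤ C1 / μ * ((1 + Real.log (1 + (T : ℝ))) * (T * auxR α β T)) := by
    intro T hT
    have hi : ∀ t, Integrable (fun ω => - (2 * ⟪y t ω - ystar (x t ω), gys t ω⟫)
        - μ * ‖y t ω - ystar (x t ω)‖ ^ 2) μP := fun t =>
      ((hEy t).1.const_mul 2).neg.sub ((hDi t).const_mul μ)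
    have h1 := integral_mono_ae (integrable_finsetSum (range T) fun t _ => hi t)
      (integrable_const _) (hpathy T hT)
    rw [integral_finsetSum _ fun t _ => hi t] at h1
    simp only [integral_const, probReal_univ, one_smul] at h1
    have h2 : ∀ t ∈ range T, μ * ∫ ω, ‖y t ω - ystar (x t ω)‖ ^ 2 ∂μP ≤
        ∫ ω, (- (2 * ⟪y t ω - ystar (x t ω), gys t ω⟫)
        - μ * ‖y t ω - ystar (x t ω)‖ ^ 2) ∂μP := by
      intro t _
      have hneg : Integrable (fun ω => - (2 * ⟪y t ω - ystar (x t ω), gys t ω⟫)) μP :=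
        ((hEy t).1.const_mul 2).neg
      rw [integral_sub hneg ((hDi t).const_mul μ), integral_neg,
        integral_const_mul, integral_const_mul, (hEy t).2.2]
      have h3 : ∫ ω, ⟪y t ω - ystar (x t ω), grady f (x t ω) (y t ω)⟫ ∂μP
          ≤ ∫ ω, - (μ * ‖y t ω - ystar (x t ω)‖ ^ 2) ∂μP :=
        integral_mono (hEy t).2.1 ((hDi t).const_mul μ).neg fun ω => hmono _ _ (hYt t ω)
      rw [integral_neg, integral_const_mul] at h3
      linarith
    have h3 := (Finset.sum_le_sum h2).trans h1
    rw [← Finset.mul_sum] at h3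
    rw [div_mul_eq_mul_div, le_div_iff₀ hμ]
    linarith
  have hEgy : ∀ T : ℕ, 1 ≤ T → ∑ t ∈ range T, ∫ ω, ‖grady f (x t ω) (y t ω)‖ ^ 2 ∂μP
      ≤ l ^ 2 * (C1 / μ) * ((1 + Real.log (1 + (T : ℝ))) * (T * auxR α β T)) := by
    intro T hT
    have h1 : ∀ t ∈ range T, ∫ ω, ‖grady f (x t ω) (y t ω)‖ ^ 2 ∂μP
        ≤ l ^ 2 * ∫ ω, ‖y t ω - ystar (x t ω)‖ ^ 2 ∂μP := by
      intro t _
      rw [← integral_const_mul]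
      refine integral_mono (hgyi t) ((hDi t).const_mul _) fun ω => ?_
      have h2 := (le_max_right _ _).trans
        (hsmooth (x t ω) (x t ω) _ (hYt t ω) _ (hystar (x t ω)).1)
      rw [sub_self, norm_zero, zero_add, hgy0, sub_zero] at h2
      calc ‖grady f (x t ω) (y t ω)‖ ^ 2 ≤ (l * ‖y t ω - ystar (x t ω)‖) ^ 2 := by gcongr
        _ = _ := by ring
    refine (Finset.sum_le_sum h1).trans ?_
    rw [← Finset.mul_sum, mul_assoc]
    exact mul_le_mul_of_nonneg_left (hED T hT) (by positivity)
  have hEgx : ∀ T : ℕ, 1 ≤ T → ∑ t ∈ range T, ∫ ω, ‖gradx f (x t ω) (y t ω)‖ ^ 2 ∂μP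
      ≤ (2 * C2 + l ^ 2 * (C1 / μ)) * ((1 + Real.log (1 + (T : ℝ))) * (T * auxR α β T)) := by
    intro T hT
    have h1 := integral_mono_ae (integrable_finsetSum (range T) fun t _ => (hEx t).1)
      (integrable_const _) (hpathx T hT)
    rw [integral_finsetSum _ fun t _ => (hEx t).1] at h1
    simp only [integral_const, probReal_univ, one_smul] at h1
    have h2 : ∀ t ∈ range T, ∫ ω, ‖gradx f (x t ω) (y t ω)‖ ^ 2 ∂μP ≤
        2 * ∫ ω, ⟪gradx f (x t ω) (ystar (x t ω)), gxs t ω⟫ ∂μP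
        + l ^ 2 * ∫ ω, ‖y t ω - ystar (x t ω)‖ ^ 2 ∂μP := by
      intro t _
      rw [(hEx t).2.2, ← integral_const_mul, ← integral_const_mul,
        ← integral_add ((hEx t).2.1.const_mul 2) ((hDi t).const_mul _)]
      refine integral_mono (hgxi t) (((hEx t).2.1.const_mul 2).add ((hDi t).const_mul _))
        fun ω => ?_
      have h3 := hpdiff t ω
      have h4 := norm_sub_sq_real (gradx f (x t ω) (ystar (x t ω))) (gradx f (x t ω) (y t ω))
      have h5 : ‖gradx f (x t ω) (ystar (x t ω)) - gradx f (x t ω) (y t ω)‖ ^ 2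
          ≤ (l * ‖y t ω - ystar (x t ω)‖) ^ 2 := by gcongr
      change _ ≤ 2 * ⟪gradx f (x t ω) (ystar (x t ω)), gradx f (x t ω) (y t ω)⟫
        + l ^ 2 * ‖y t ω - ystar (x t ω)‖ ^ 2
      rw [mul_pow] at h5
      have h6 := sq_nonneg ‖gradx f (x t ω) (ystar (x t ω))‖
      linarith
    refine (Finset.sum_le_sum h2).trans ?_
    rw [Finset.sum_add_distrib, ← Finset.mul_sum, ← Finset.mul_sum]
    have h6 := mul_le_mul_of_nonneg_left (hED T hT) (by positivity : 0 ≤ l ^ 2)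
    linarith
  -- conclusion
  refine ⟨2 * C2 + l ^ 2 * (C1 / μ), fun T hT => ?_⟩
  have hT1 : (1 : ℝ) ≤ T := by exact_mod_cast hT
  have hTpos : (0 : ℝ) < T := by linarith
  have hL : 0 ≤ Real.log (1 + (T : ℝ)) := Real.log_nonneg (by linarith)
  have hR : 0 ≤ auxR α β T := by unfold auxR; positivity
  change _ ≤ _ * _ * auxR α β T ∧ _ ≤ _ * _ * auxR α β T
  rw [integral_finsetSum _ fun t _ => hgxi t, integral_finsetSum _ fun t _ => hgyi t]
  have hfin : ∀ S C : ℝ, S ≤ C * ((1 + Real.log (1 + (T : ℝ))) * (T * auxR α β T)) →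
      1 / (T : ℝ) * S ≤ C * (1 + Real.log (1 + (T : ℝ))) * auxR α β T := by
    intro S C h
    rw [one_div, inv_mul_le_iff₀ hTpos]
    linarith
  refine ⟨hfin _ _ (hEgx T hT), hfin _ _ ((hEgy T hT).trans ?_)⟩
  gcongr
  linarith
end
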